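/- Let K be a number field of degree greater than 1 having at least one real embedding, and let 𝔪 be a nonzero ideal of O_K. Then the group SΓ₁(𝔪) is generated by the matrices (1, b; 0, 1) for b∈O_K together with the matrices (1, 0; c, 1) for c∈𝔪. -/

import Mathlib

open NumberField

set_option linter.all false


open NumberField

namespace Vas

section basics
variable {K : Type*} [Field K]

/-- The special linear group of degree two. -/
abbrev SL (K : Type*) [Field K] := Matrix.SpecialLinearGroup (Fin 2) K

/-- Build an element of `SL₂`. -/
def mk4 (a b c d : K) (h : a * d - b * c = 1) : SL K :=
  ⟨!![a, b; c, d], by rw [Matrix.det_fin_two_of]; exact h⟩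

@[simp] lemma mk4_00 (a b c d : K) (h) : (mk4 a b c d h).1 0 0 = a := rfl
@[simp] lemma mk4_01 (a b c d : K) (h) : (mk4 a b c d h).1 0 1 = b := rfl
@[simp] lemma mk4_10 (a b c d : K) (h) : (mk4 a b c d h).1 1 0 = c := rfl
@[simp] lemma mk4_11 (a b c d : K) (h) : (mk4 a b c d h).1 1 1 = d := rfl

lemma ext4 {g h : SL K} (h00 : g.1 0 0 = h.1 0 0) (h01 : g.1 0 1 = h.1 0 1)
    (h10 : g.1 1 0 = h.1 1 0) (h11 : g.1 1 1 = h.1 1 1) : g = h := by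
  apply Subtype.ext
  ext i j
  fin_cases i <;> fin_cases j <;> assumption

lemma det4 (g : SL K) : g.1 0 0 * g.1 1 1 - g.1 0 1 * g.1 1 0 = 1 := by
  have := g.2
  rwa [Matrix.det_fin_two] at this

@[simp] lemma mul00 (g h : SL K) : (g * h).1 0 0 = g.1 0 0 * h.1 0 0 + g.1 0 1 * h.1 1 0 := by
  simp [Matrix.mul_apply, Fin.sum_univ_two]
@[simp] lemma mul01 (g h : SL K) : (g * h).1 0 1 = g.1 0 0 * h.1 0 1 + g.1 0 1 * h.1 1 1 := by
  simp [Matrix.mul_apply, Fin.sum_univ_two]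
@[simp] lemma mul10 (g h : SL K) : (g * h).1 1 0 = g.1 1 0 * h.1 0 0 + g.1 1 1 * h.1 1 0 := by
  simp [Matrix.mul_apply, Fin.sum_univ_two]
@[simp] lemma mul11 (g h : SL K) : (g * h).1 1 1 = g.1 1 0 * h.1 0 1 + g.1 1 1 * h.1 1 1 := by
  simp [Matrix.mul_apply, Fin.sum_univ_two]
@[simp] lemma one00 : (1 : SL K).1 0 0 = 1 := by simp
@[simp] lemma one01 : (1 : SL K).1 0 1 = 0 := by simp
@[simp] lemma one10 : (1 : SL K).1 1 0 = 0 := by simp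
@[simp] lemma one11 : (1 : SL K).1 1 1 = 1 := by simp
@[simp] lemma inv00 (g : SL K) : (g⁻¹).1 0 0 = g.1 1 1 := by
  rw [Matrix.SpecialLinearGroup.coe_inv, Matrix.adjugate_fin_two]; simp
@[simp] lemma inv01 (g : SL K) : (g⁻¹).1 0 1 = - g.1 0 1 := by
  rw [Matrix.SpecialLinearGroup.coe_inv, Matrix.adjugate_fin_two]; simp
@[simp] lemma inv10 (g : SL K) : (g⁻¹).1 1 0 = - g.1 1 0 := by
  rw [Matrix.SpecialLinearGroup.coe_inv, Matrix.adjugate_fin_two]; simp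
@[simp] lemma inv11 (g : SL K) : (g⁻¹).1 1 1 = g.1 0 0 := by
  rw [Matrix.SpecialLinearGroup.coe_inv, Matrix.adjugate_fin_two]; simp

/-- upper unipotent -/
def UU (x : K) : SL K := mk4 1 x 0 1 (by ring)
/-- lower unipotent -/
def LL (x : K) : SL K := mk4 1 0 x 1 (by ring)
/-- torus -/
def HH (t : Kˣ) : SL K := mk4 t 0 0 (t⁻¹ : Kˣ) (by simp)

@[simp] lemma UU00 (x : K) : (UU x).1 0 0 = 1 := rfl
@[simp] lemma UU01 (x : K) : (UU x).1 0 1 = x := rfl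
@[simp] lemma UU10 (x : K) : (UU x).1 1 0 = 0 := rfl
@[simp] lemma UU11 (x : K) : (UU x).1 1 1 = 1 := rfl
@[simp] lemma LL00 (x : K) : (LL x).1 0 0 = 1 := rfl
@[simp] lemma LL01 (x : K) : (LL x).1 0 1 = 0 := rfl
@[simp] lemma LL10 (x : K) : (LL x).1 1 0 = x := rfl
@[simp] lemma LL11 (x : K) : (LL x).1 1 1 = 1 := rfl
@[simp] lemma HH00 (x : Kˣ) : (HH x).1 0 0 = x := rfl
@[simp] lemma HH01 (x : Kˣ) : (HH x).1 0 1 = 0 := rfl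
@[simp] lemma HH10 (x : Kˣ) : (HH x).1 1 0 = 0 := rfl
@[simp] lemma HH11 (x : Kˣ) : (HH x).1 1 1 = (x : K)⁻¹ := by simp [HH]

lemma UU_add (x y : K) : UU (x + y) = UU x * UU y := by apply ext4 <;> simp [add_comm]
lemma LL_add (x y : K) : LL (x + y) = LL x * LL y := by apply ext4 <;> simp
lemma UU_neg (x : K) : UU (-x) = (UU x)⁻¹ := by apply ext4 <;> simp
lemma LL_neg (x : K) : LL (-x) = (LL x)⁻¹ := by apply ext4 <;> simp
@[simp] lemma UU_zero : UU (0 : K) = 1 := by apply ext4 <;> simp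
@[simp] lemma LL_zero : LL (0 : K) = 1 := by apply ext4 <;> simp
lemma HH_mul (x y : Kˣ) : HH (x * y) = HH x * HH y := by apply ext4 <;> simp [mul_comm]
lemma HH_one : HH (1 : Kˣ) = 1 := by apply ext4 <;> simp
lemma HH_inv (x : Kˣ) : HH x⁻¹ = (HH x)⁻¹ := by apply ext4 <;> simp

lemma HH_conj00 (t : Kˣ) (g : SL K) : (HH t * g * (HH t)⁻¹).1 0 0 = g.1 0 0 := by
  simp only [mul00, mul01, HH00, HH01, inv00, inv10, HH11, HH10]; field_simp; ring
lemma HH_conj01 (t : Kˣ) (g : SL K) : (HH t * g * (HH t)⁻¹).1 0 1 = t ^ 2 * g.1 0 1 := by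
  simp only [mul00, mul01, HH00, HH01, inv01, inv11, HH11, HH10]; ring
lemma HH_conj10 (t : Kˣ) (g : SL K) : (HH t * g * (HH t)⁻¹).1 1 0 = (t : K)⁻¹ ^ 2 * g.1 1 0 := by
  simp only [mul10, mul11, HH00, HH01, inv00, inv10, HH11, HH10]; ring
lemma HH_conj11 (t : Kˣ) (g : SL K) : (HH t * g * (HH t)⁻¹).1 1 1 = g.1 1 1 := by
  simp only [mul10, mul11, HH00, HH01, inv01, inv11, HH11, HH10]; field_simp; ring

lemma HH_conj_UU (t : Kˣ) (x : K) : HH t * UU x * (HH t)⁻¹ = UU (t ^ 2 * x) := by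
  apply ext4 <;> simp only [HH_conj00, HH_conj01, HH_conj10, HH_conj11] <;> simp
lemma HH_conj_LL (t : Kˣ) (x : K) : HH t * LL x * (HH t)⁻¹ = LL ((t : K)⁻¹ ^ 2 * x) := by
  apply ext4 <;> simp only [HH_conj00, HH_conj01, HH_conj10, HH_conj11] <;> simp

/-- two elements with the same first column differ by an upper unipotent on the right -/
lemma same_col {g h : SL K} (h0 : g.1 0 0 = h.1 0 0) (h1 : g.1 1 0 = h.1 1 0) :
    g = h * UU (h.1 1 1 * g.1 0 1 - h.1 0 1 * g.1 1 1) := by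
  have e1 := det4 g
  have e2 := det4 h
  rw [h0, h1] at e1
  apply ext4
  · simp [h0]
  · simp only [mul01, UU01, UU11]
    linear_combination (-g.1 0 1) * e2 + h.1 0 1 * e1
  · simp [h1]
  · simp only [mul11, UU01, UU11]
    linear_combination (-g.1 1 1) * e2 + h.1 1 1 * e1

/-- explicit factorisation of `SL₂(K)` -/
lemma factor (g : SL K) : ∃ w x y z : K, g = LL w * UU x * LL y * UU z := by
  have key : ∀ g : SL K, g.1 1 0 ≠ 0 → ∃ x y z : K, g = UU x * LL y * UU z := by
    intro g hg
    refine ⟨(g.1 0 0 - 1) / g.1 1 0, g.1 1 0, (g.1 1 1 - 1) / g.1 1 0, ?_⟩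
    have := det4 g
    apply ext4
    · simp; field_simp; ring
    · simp; field_simp; linear_combination -this
    · simp
    · simp; field_simp; ring
  by_cases h : g.1 1 0 = 0
  · have h0 : g.1 0 0 ≠ 0 := by
      intro h0
      have := det4 g
      simp [h, h0] at this
    obtain ⟨x, y, z, e⟩ := key (LL 1 * g) (by simp [h, h0])
    refine ⟨-1, x, y, z, ?_⟩
    rw [mul_assoc, mul_assoc, ← mul_assoc (UU x), ← e, LL_neg]; simp
  · obtain ⟨x, y, z, e⟩ := key g h
    exact ⟨0, x, y, z, by simpa using e⟩

end basics

section int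
variable {K : Type*} [Field K]

/-- `x ∈ n O` -/
def inI (n : 𝓞 K) (x : K) : Prop := ∃ y : 𝓞 K, x = n * y

lemma inI.add {n : 𝓞 K} {x y : K} (hx : inI n x) (hy : inI n y) : inI n (x + y) := by
  obtain ⟨a, rfl⟩ := hx; obtain ⟨b, rfl⟩ := hy; exact ⟨a + b, by push_cast; ring⟩
lemma inI.neg {n : 𝓞 K} {x : K} (hx : inI n x) : inI n (-x) := by
  obtain ⟨a, rfl⟩ := hx; exact ⟨-a, by push_cast; ring⟩
lemma inI.sub {n : 𝓞 K} {x y : K} (hx : inI n x) (hy : inI n y) : inI n (x - y) := by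
  rw [sub_eq_add_neg]; exact hx.add hy.neg
lemma inI_zero (n : 𝓞 K) : inI n 0 := ⟨0, by simp⟩
lemma inI.mul {n m : 𝓞 K} {x y : K} (hx : inI n x) (hy : inI m y) : inI (n * m) (x * y) := by
  obtain ⟨a, rfl⟩ := hx; obtain ⟨b, rfl⟩ := hy; exact ⟨a * b, by push_cast; ring⟩
lemma inI.mulr {n : 𝓞 K} {x y : K} (hx : inI n x) (hy : inI 1 y) : inI n (x * y) := by
  simpa using hx.mul hy
lemma inI.mull {n : 𝓞 K} {x y : K} (hx : inI 1 x) (hy : inI n y) : inI n (x * y) := by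
  simpa using hx.mul hy
lemma inI.mono {n m : 𝓞 K} (h : n ∣ m) {x : K} (hx : inI m x) : inI n x := by
  obtain ⟨a, rfl⟩ := hx; obtain ⟨b, rfl⟩ := h; exact ⟨b * a, by push_cast; ring⟩
lemma inI.int {n : 𝓞 K} {x : K} (hx : inI n x) : inI 1 x := hx.mono (one_dvd _)
lemma inI_coe (x : 𝓞 K) : inI 1 (x : K) := ⟨x, by simp⟩
lemma inI_one : inI (1 : 𝓞 K) (1 : K) := ⟨1, by simp⟩
lemma inI_self (n : 𝓞 K) : inI n (n : K) := ⟨1, by simp⟩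
lemma inI_coe_iff {n x : 𝓞 K} : inI n (x : K) ↔ n ∣ x := by
  constructor
  · rintro ⟨y, h⟩; exact ⟨y, by exact_mod_cast h⟩
  · rintro ⟨y, rfl⟩; exact ⟨y, by push_cast; ring⟩
lemma inI.of_sub_one {n : 𝓞 K} {x : K} (hx : inI n (x - 1)) : inI 1 x := by
  simpa using hx.int.add inI_one

/-- the group generated by `U(kO)` and `L(mO)` -/
def EE (k m : 𝓞 K) : Subgroup (SL K) :=
  Subgroup.closure ({g | ∃ x, inI k x ∧ g = UU x} ∪ {g | ∃ x, inI m x ∧ g = LL x})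

lemma UU_mem {k m : 𝓞 K} {x : K} (h : inI k x) : UU x ∈ EE k m :=
  Subgroup.subset_closure (Or.inl ⟨x, h, rfl⟩)
lemma LL_mem {k m : 𝓞 K} {x : K} (h : inI m x) : LL x ∈ EE k m :=
  Subgroup.subset_closure (Or.inr ⟨x, h, rfl⟩)

lemma EE_le {k m : 𝓞 K} {S : Subgroup (SL K)} (h1 : ∀ x, inI k x → UU x ∈ S)
    (h2 : ∀ x, inI m x → LL x ∈ S) : EE k m ≤ S := by
  refine (Subgroup.closure_le _).2 ?_
  rintro g (⟨x, hx, rfl⟩ | ⟨x, hx, rfl⟩)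
  · exact h1 x hx
  · exact h2 x hx

lemma EE_mono {k m k' m' : 𝓞 K} (hk : k ∣ k') (hm : m ∣ m') : EE k' m' ≤ EE k m :=
  EE_le (fun _ hx => UU_mem (hx.mono hk)) (fun _ hx => LL_mem (hx.mono hm))

/-- conjugation criterion -/
lemma EE_conj {k m : 𝓞 K} {S : Subgroup (SL K)} (g : SL K)
    (h1 : ∀ x, inI k x → g * UU x * g⁻¹ ∈ S)
    (h2 : ∀ x, inI m x → g * LL x * g⁻¹ ∈ S) {e : SL K} (he : e ∈ EE k m) :
    g * e * g⁻¹ ∈ S := by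
  have : EE k m ≤ S.comap (MulAut.conj g).toMonoidHom :=
    EE_le (fun x hx => by simpa using h1 x hx) (fun x hx => by simpa using h2 x hx)
  simpa using this he

/-- the congruence group `Γ₁(m)` inside `SL₂(K)` -/
def GG (m : 𝓞 K) : Subgroup (SL K) where
  carrier := {g | inI m (g.1 0 0 - 1) ∧ inI 1 (g.1 0 1) ∧ inI m (g.1 1 0) ∧ inI m (g.1 1 1 - 1)}
  mul_mem' := by
    rintro g h ⟨a1, a2, a3, a4⟩ ⟨b1, b2, b3, b4⟩
    refine ⟨?_, ?_, ?_, ?_⟩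
    · have : (g * h).1 0 0 - 1 = (g.1 0 0 - 1) * h.1 0 0 + (h.1 0 0 - 1) + g.1 0 1 * h.1 1 0 := by
        rw [mul00]; ring
      rw [this]
      exact ((a1.mulr b1.of_sub_one).add b1).add (a2.mull b3)
    · rw [mul01]
      exact (a1.of_sub_one.mull b2).add (a2.mulr b4.of_sub_one)
    · rw [mul10]
      exact (a3.mulr b1.of_sub_one).add (a4.of_sub_one.mull b3)
    · have : (g * h).1 1 1 - 1 = (g.1 1 1 - 1) * h.1 1 1 + (h.1 1 1 - 1) + g.1 1 0 * h.1 0 1 := by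
        rw [mul11]; ring
      rw [this]
      exact ((a4.mulr b4.of_sub_one).add b4).add (a3.mulr b2)
  one_mem' := by
    refine ⟨?_, ?_, ?_, ?_⟩ <;> simp [inI_zero]
  inv_mem' := by
    rintro g ⟨a1, a2, a3, a4⟩
    refine ⟨?_, ?_, ?_, ?_⟩
    · simpa using a4
    · simpa using a2.neg
    · simpa using a3.neg
    · simpa using a1

lemma mem_GG {m : 𝓞 K} {g : SL K} : g ∈ GG m ↔
    inI m (g.1 0 0 - 1) ∧ inI 1 (g.1 0 1) ∧ inI m (g.1 1 0) ∧ inI m (g.1 1 1 - 1) := Iff.rfl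

/-- the principal congruence set -/
def PP (n : 𝓞 K) (g : SL K) : Prop :=
  inI n (g.1 0 0 - 1) ∧ inI n (g.1 0 1) ∧ inI n (g.1 1 0) ∧ inI n (g.1 1 1 - 1)

lemma PP.mono {n m : 𝓞 K} (h : n ∣ m) {g : SL K} (hg : PP m g) : PP n g :=
  ⟨hg.1.mono h, hg.2.1.mono h, hg.2.2.1.mono h, hg.2.2.2.mono h⟩
lemma PP.memGG {n m : 𝓞 K} (h : n ∣ m) {g : SL K} (hg : PP m g) : g ∈ GG n :=
  ⟨hg.1.mono h, hg.2.1.int, hg.2.2.1.mono h, hg.2.2.2.mono h⟩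

lemma EE_le_GG (m : 𝓞 K) : EE 1 m ≤ GG m :=
  EE_le (fun x hx => by refine ⟨?_, ?_, ?_, ?_⟩ <;> simp [inI_zero, hx])
    (fun x hx => by refine ⟨?_, ?_, ?_, ?_⟩ <;> simp [inI_zero, hx])

lemma GG_mono {m m' : 𝓞 K} (h : m ∣ m') : GG m' ≤ GG m := fun _ hg =>
  ⟨hg.1.mono h, hg.2.1, hg.2.2.1.mono h, hg.2.2.2.mono h⟩

/-- `K`-units coming from units of the ring of integers -/
def uK (v : (𝓞 K)ˣ) : Kˣ := Units.map (algebraMap (𝓞 K) K).toMonoidHom v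

@[simp] lemma uK_coe (v : (𝓞 K)ˣ) : ((uK v : Kˣ) : K) = ((v : 𝓞 K) : K) := rfl
@[simp] lemma uK_inv_coe (v : (𝓞 K)ˣ) : (((v : 𝓞 K) : K))⁻¹ = ((v⁻¹ : (𝓞 K)ˣ) : 𝓞 K) := by
  rw [← uK_coe, ← Units.val_inv_eq_inv_val, ← uK_coe]; simp [uK]
lemma uK_mul (v w : (𝓞 K)ˣ) : uK (v * w) = uK v * uK w := by simp [uK]
lemma uK_inv (v : (𝓞 K)ˣ) : uK v⁻¹ = (uK v)⁻¹ := by simp [uK]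

/-- torus elements are elementary -/
lemma HH_mem {n m : 𝓞 K} (v : (𝓞 K)ˣ) (h : n * m ∣ (v : 𝓞 K) - 1) : HH (uK v) ∈ EE n m := by
  obtain ⟨y, hy⟩ := h
  have hv : ((v : 𝓞 K) : K) = 1 + n * m * y := by
    have : ((v : 𝓞 K) : K) - 1 = n * m * y := by exact_mod_cast congrArg (algebraMap (𝓞 K) K) hy
    linear_combination this
  have hv0 : ((v : 𝓞 K) : K) ≠ 0 := by rw [← uK_coe]; exact Units.ne_zero _
  have e : HH (uK v) = LL (-(m * y * ((v : 𝓞 K) : K)⁻¹)) * UU (n : K) * LL ((m : K) * y) *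
      UU (-(n * ((v : 𝓞 K) : K)⁻¹)) := by
    apply ext4
    · simp only [HH00, mul00, mul01, mul10, mul11, UU00, UU01, UU10, UU11, LL00, LL01, LL10, LL11,
        uK_coe]
      linear_combination hv
    · simp only [HH01, mul00, mul01, mul10, mul11, UU00, UU01, UU10, UU11, LL00, LL01, LL10, LL11,
        uK_coe]
      field_simp
      linear_combination (-n : K) * hv
    · simp only [HH10, mul00, mul01, mul10, mul11, UU00, UU01, UU10, UU11, LL00, LL01, LL10, LL11,
        uK_coe]
      field_simp
      linear_combination (-m * y : K) * hv
    · simp only [HH11, mul00, mul01, mul10, mul11, UU00, UU01, UU10, UU11, LL00, LL01, LL10, LL11,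
        uK_coe]
      field_simp
      rw [hv]; ring
  rw [e, uK_inv_coe]
  refine mul_mem (mul_mem (mul_mem (LL_mem ?_) (UU_mem ?_)) (LL_mem ?_)) (UU_mem ?_)
  · exact ⟨-(y * (v⁻¹ : (𝓞 K)ˣ)), by push_cast; ring⟩
  · exact inI_self n
  · exact ⟨y, rfl⟩
  · exact ⟨-(v⁻¹ : (𝓞 K)ˣ), by push_cast; ring⟩

end int
end Vas

open NumberField

namespace Vas
section A2
variable {K : Type*} [Field K] [NumberField K]

lemma isCoprime_of_primes {a n : 𝓞 K} (h : ∀ P : Ideal (𝓞 K), P.IsMaximal → n ∈ P → a ∉ P) :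
    IsCoprime a n := by
  rw [← Ideal.isCoprime_span_singleton_iff, Ideal.isCoprime_iff_sup_eq]
  by_contra hne
  obtain ⟨P, hP, hle⟩ := Ideal.exists_le_maximal _ hne
  refine h P hP (hle ?_) (hle ?_)
  · exact Ideal.mem_sup_right (Ideal.mem_span_singleton_self n)
  · exact Ideal.mem_sup_left (Ideal.mem_span_singleton_self a)

lemma cop_not_mem {a n : 𝓞 K} (h : IsCoprime a n) {P : Ideal (𝓞 K)} (hP : P.IsPrime)
    (hn : n ∈ P) : a ∉ P := by
  intro ha
  obtain ⟨x, y, e⟩ := h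
  apply hP.ne_top
  rw [Ideal.eq_top_iff_one, ← e]
  exact P.add_mem (P.mul_mem_left _ ha) (P.mul_mem_left _ hn)

lemma finite_primes {n : 𝓞 K} (hn : n ≠ 0) :
    {P : Ideal (𝓞 K) | P.IsMaximal ∧ n ∈ P}.Finite := by
  have := Ideal.finite_factors (I := Ideal.span {n}) (by simpa using hn)
  refine (this.image (fun v => v.asIdeal)).subset ?_
  rintro P ⟨hP, hnP⟩
  refine ⟨⟨P, hP.isPrime, ?_⟩, ?_, rfl⟩
  · rintro rfl; simp at hnP; exact hn hnP
  · simpa [Ideal.dvd_iff_le, Ideal.span_le] using hnP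

lemma crt_max {S : Set (Ideal (𝓞 K))} (hS : S.Finite) (hm : ∀ P ∈ S, P.IsMaximal)
    (x : Ideal (𝓞 K) → 𝓞 K) : ∃ r, ∀ P ∈ S, r - x P ∈ P := by
  have := hS.to_subtype
  obtain ⟨r, hr⟩ := Ideal.exists_forall_sub_mem_ideal (R := 𝓞 K) (I := fun P : S => P.1)
    (by
      intro P Q hPQ
      have := hm _ P.2
      have := hm _ Q.2
      exact Ideal.isCoprime_of_isMaximal
        (fun h => hPQ (Subtype.ext h))) (fun P => x P.1)
  exact ⟨r, fun P hP => hr ⟨P, hP⟩⟩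

lemma exists_coprime {a c n : 𝓞 K} (hac : IsCoprime a c) (hn : n ≠ 0) :
    ∃ t, IsCoprime (a + t * c) n := by
  classical
  obtain ⟨t, ht⟩ := crt_max (finite_primes hn) (fun P hP => hP.1) (fun P => if a ∈ P then 1 else 0)
  refine ⟨t, isCoprime_of_primes ?_⟩
  intro P hP hnP hmem
  have h1 := ht P ⟨hP, hnP⟩
  split_ifs at h1 with ha
  · have hc : t * c ∈ P := by simpa using P.sub_mem hmem ha
    have h2 : (1 : 𝓞 K) ∈ P ∨ c ∈ P := by
      rcases hP.isPrime.mem_or_mem hc with h | h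
      · left; simpa using P.sub_mem h h1
      · right; exact h
    rcases h2 with h | h
    · exact hP.ne_top ((Ideal.eq_top_iff_one _).2 h)
    · exact cop_not_mem hac hP.isPrime h ha
  · apply ha
    have : t * c ∈ P := P.mul_mem_right _ (by simpa using h1)
    simpa using P.sub_mem hmem this

/-- lift an element of `Γ(m)` -/
lemma GG_lift {m : 𝓞 K} {γ : SL K} (h : γ ∈ GG m) : ∃ a b c d : 𝓞 K,
    γ.1 0 0 = a ∧ γ.1 0 1 = b ∧ γ.1 1 0 = c ∧ γ.1 1 1 = d ∧ m ∣ a - 1 ∧ m ∣ c ∧ m ∣ d - 1 ∧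
    a * d - b * c = 1 := by
  obtain ⟨h1, h2, h3, h4⟩ := h
  obtain ⟨a, ha⟩ := h1.of_sub_one
  obtain ⟨b, hb⟩ := h2
  obtain ⟨c, hc⟩ := h3.int
  obtain ⟨d, hd⟩ := h4.of_sub_one
  simp only [map_one, one_mul] at ha hb hc hd
  refine ⟨a, b, c, d, ha, hb, hc, hd, ?_, ?_, ?_, ?_⟩
  · rw [ha] at h1; rw [← inI_coe_iff]; push_cast; exact h1
  · rw [hc] at h3; rw [← inI_coe_iff]; exact h3
  · rw [hd] at h4; rw [← inI_coe_iff]; push_cast; exact h4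
  · have := det4 γ
    rw [ha, hb, hc, hd] at this
    exact_mod_cast this

theorem approx {μ ν : 𝓞 K} (hν : ν ≠ 0) (h : μ ∣ ν) {γ : SL K} (hγ : γ ∈ GG μ) :
    ∃ e ∈ EE 1 μ, PP ν (e * γ) := by
  obtain ⟨a, b, c, d, ha, hb, hc, hd, hma, hmc, hmd, hdet⟩ := GG_lift hγ
  obtain ⟨t, ht⟩ := exists_coprime (a := a) (c := c) (n := ν) ⟨d, -b, by linear_combination hdet⟩ hν
  obtain ⟨x, y, hxy⟩ := ht
  set a' := a + t * c with ha'
  have hma' : μ ∣ a' - 1 := by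
    have : a' - 1 = (a - 1) + t * c := by rw [ha']; ring
    rw [this]; exact dvd_add hma (dvd_mul_of_dvd_right hmc _)
  set s := (1 - a' - c) * x with hs
  have hms : μ ∣ s := by
    rw [hs]; apply dvd_mul_of_dvd_left
    have : 1 - a' - c = -(a' - 1) - c := by ring
    rw [this]; exact dvd_sub (hma'.neg_right) hmc
  set e₀ : SL K := LL ((a' - 1 : 𝓞 K) : K) * UU ((1 : 𝓞 K) : K) * LL (s : K) * UU (t : K) with he0
  have he0m : e₀ ∈ EE 1 μ := by
    refine mul_mem (mul_mem (mul_mem (LL_mem ?_) (UU_mem ?_)) (LL_mem ?_)) (UU_mem ?_)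
    · exact inI_coe_iff.2 hma'
    · exact inI_coe _
    · exact inI_coe_iff.2 hms
    · exact inI_coe _
  have h1 : e₀ * γ ∈ GG μ := mul_mem (EE_le_GG _ he0m) hγ
  obtain ⟨a2, b2, c2, d2, ha2, hb2, hc2, hd2, -, -, -, hdet2⟩ := GG_lift h1
  -- the first column after the first two steps
  have r1 : c + s * a' - (1 - a') = -(1 - a' - c) * y * ν := by
    rw [hs]; linear_combination (1 - a' - c) * hxy
  have e1 : a2 - 1 = -(1 - a' - c) * y * ν := by
    have : (e₀ * γ).1 0 0 = ((a' + (c + s * a') : 𝓞 K) : K) := by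
      simp only [he0, mul00, mul01, mul10, mul11, UU00, UU01, UU10, UU11, LL00, LL01, LL10, LL11,
        ha, hb, hc, hd, ha']
      push_cast; ring
    rw [ha2] at this
    have : a2 = a' + (c + s * a') := by exact_mod_cast this
    rw [this]; linear_combination r1
  have e2 : c2 = (-(1 - a' - c) * y + (a' - 1) * (-(1 - a' - c) * y)) * ν := by
    have : (e₀ * γ).1 1 0 = (((c + s * a') + (a' - 1) * (a' + (c + s * a')) : 𝓞 K) : K) := by
      simp only [he0, mul00, mul01, mul10, mul11, UU00, UU01, UU10, UU11, LL00, LL01, LL10, LL11,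
        ha, hb, hc, hd, ha']
      push_cast; ring
    rw [hc2] at this
    have : c2 = (c + s * a') + (a' - 1) * (a' + (c + s * a')) := by exact_mod_cast this
    rw [this]; linear_combination (1 + (a' - 1)) * r1
  have n1 : ν ∣ a2 - 1 := ⟨-(1 - a' - c) * y, by rw [e1]; ring⟩
  have n2 : ν ∣ c2 := ⟨_, by rw [e2, mul_comm]⟩
  have n3 : ν ∣ d2 - 1 := by
    have : d2 - 1 = b2 * c2 - (a2 - 1) * d2 := by linear_combination hdet2
    rw [this]; exact dvd_sub (dvd_mul_of_dvd_right n2 _) (dvd_mul_of_dvd_left n1 _)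
  refine ⟨UU ((-b2 : 𝓞 K) : K) * e₀, mul_mem (UU_mem (inI_coe _)) he0m, ?_⟩
  rw [mul_assoc]
  refine ⟨?_, ?_, ?_, ?_⟩
  · rw [mul00, ha2, hc2, UU00, UU01]
    rw [show (1 * (a2:K) + ((-b2 : 𝓞 K) : K) * (c2:K) - 1) = ((a2 - 1 - b2 * c2 : 𝓞 K) : K) by push_cast; ring]
    exact inI_coe_iff.2 (dvd_sub n1 (dvd_mul_of_dvd_right n2 _))
  · rw [mul01, hb2, hd2, UU00, UU01]
    rw [show (1 * (b2:K) + ((-b2 : 𝓞 K) : K) * (d2:K)) = ((-b2 * (d2 - 1) : 𝓞 K) : K) by push_cast; ring]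
    exact inI_coe_iff.2 (dvd_mul_of_dvd_right n3 _)
  · rw [mul10, ha2, hc2, UU10, UU11]
    simpa using inI_coe_iff.2 n2
  · rw [mul11, hb2, hd2, UU10, UU11]
    rw [show (0 * (b2:K) + 1 * (d2:K) - 1) = ((d2 - 1 : 𝓞 K) : K) by push_cast; ring]
    exact inI_coe_iff.2 n3

end A2
end Vas

open NumberField

namespace Vas
section B6
variable {K : Type*} [Field K] [NumberField K]

lemma rank_le (F : IntermediateField ℚ K) (j : ℕ) (hj : j ≠ 0)
    (h : ∀ u : (𝓞 K)ˣ, ((u : 𝓞 K) : K) ^ j ∈ F) :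
    Units.rank K ≤ Units.rank F := by
  have lift : ∀ u : (𝓞 K)ˣ, ∃ w : (𝓞 F)ˣ, Units.map (algebraMap (𝓞 F) (𝓞 K)).toMonoidHom w = u ^ j := by
    intro u
    have key : ∀ u : (𝓞 K)ˣ, ∃ w : 𝓞 F, algebraMap (𝓞 F) (𝓞 K) w = (u : 𝓞 K) ^ j := by
      intro u
      have hIntg : IsIntegral ℤ (⟨((u : 𝓞 K) : K) ^ j, h u⟩ : F) := by
        rw [← isIntegral_algebraMap_iff (B := K) (algebraMap F K).injective]
        exact ((u : 𝓞 K).isIntegral_coe).pow j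
      refine ⟨⟨_, hIntg⟩, ?_⟩
      apply RingOfIntegers.ext
      rfl
    obtain ⟨w, hw⟩ := key u
    obtain ⟨w', hw'⟩ := key u⁻¹
    have hinj : Function.Injective (algebraMap (𝓞 F) (𝓞 K)) := FaithfulSMul.algebraMap_injective _ _
    have hmul : w * w' = 1 := by
      apply hinj
      rw [map_mul, hw, hw', ← mul_pow]
      simp
    refine ⟨⟨w, w', hmul, by rw [mul_comm, hmul]⟩, ?_⟩
    ext
    simp [hw]
  obtain ⟨f, hf⟩ := exists_linearIndependent_of_le_finrank (R := ℤ) (M := Additive (𝓞 K)ˣ) le_rfl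
  choose w hw using lift
  have hl : LinearIndependent ℤ (fun i => Additive.ofMul (w (f i).toMul)) := by
    rw [linearIndependent_iff'] at hf ⊢
    intro s g hg i hi
    have := congrArg (MonoidHom.toAdditive (Units.map (algebraMap (𝓞 F) (𝓞 K)).toMonoidHom)) hg
    rw [map_sum, map_zero] at this
    have h2 : ∑ i ∈ s, (g i * j) • f i = 0 := by
      rw [← this]
      refine Finset.sum_congr rfl ?_
      intro k hk
      rw [map_zsmul, mul_zsmul]
      have e := congrArg Additive.ofMul (hw (f k).toMul)
      rw [MonoidHom.toAdditive_apply_apply]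
      rw [toMul_ofMul]
      rw [e]
      simp
    have h3 := hf s _ h2 i hi
    simpa [hj] using h3
  have := hl.fintype_card_le_finrank
  rw [← Units.finrank_eq, ← Units.finrank_eq]
  simpa using this

theorem adjoin_units (hreal : Nonempty (K →+* ℝ)) (j : ℕ) (hj : j ≠ 0) (F : IntermediateField ℚ K)
    (h : ∀ u : (𝓞 K)ˣ, ((u : 𝓞 K) : K) ^ j ∈ F) : F = ⊤ := by
  by_contra hne
  have h1 := rank_le F j hj h
  obtain ⟨ρ⟩ := hreal
  let φ : K →+* ℂ := (Complex.ofRealHom).comp ρ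
  letI : Algebra F ℂ := (φ.comp (algebraMap F K)).toAlgebra
  have hcard := AlgHom.card F K ℂ
  have hfr : Module.finrank F K ≠ 1 := by
    intro h
    apply hne
    exact IntermediateField.finrank_eq_one_iff_eq_top.1 h
  have hpos : 0 < Module.finrank F K := Module.finrank_pos
  let φ' : K →ₐ[F] ℂ := { φ with commutes' := fun r => rfl }
  have : Nontrivial (K →ₐ[F] ℂ) := by
    rw [← Fintype.one_lt_card_iff_nontrivial, hcard]; omega
  obtain ⟨ψ, hψ⟩ := exists_ne φ'
  have hbij : Function.Bijective (fun w : InfinitePlace K => w.comap (algebraMap F K)) := by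
    rw [Fintype.bijective_iff_surjective_and_card]
    refine ⟨InfinitePlace.comap_surjective, ?_⟩
    have := InfinitePlace.card_mono (k := F) (K := K)
    unfold Units.rank at h1
    have p1 : 0 < Fintype.card (InfinitePlace K) := Fintype.card_pos
    have p2 : 0 < Fintype.card (InfinitePlace F) := Fintype.card_pos
    omega
  have hc : (InfinitePlace.mk (ψ : K →+* ℂ)).comap (algebraMap F K) =
      (InfinitePlace.mk φ).comap (algebraMap F K) := by
    rw [InfinitePlace.comap_mk, InfinitePlace.comap_mk]
    congr 1
    exact ψ.comp_algebraMap
  have := hbij.1 hc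
  rw [InfinitePlace.mk_eq_iff] at this
  apply hψ
  ext x
  rcases this with h | h
  · exact congrArg (fun f : K →+* ℂ => f x) h
  · have h2 := congrArg (fun f : K →+* ℂ => f x) h
    simp only [ComplexEmbedding.conjugate_coe_eq] at h2
    have h3 : (starRingEnd ℂ) ((starRingEnd ℂ) (ψ x)) = (starRingEnd ℂ) (φ x) := by
      rw [← h2]; rfl
    rw [Complex.conj_conj] at h3
    rw [h3]
    exact Complex.conj_ofReal _

/-- there is a unit in `U^j` which is not `±1` -/
lemma exists_unit (hdeg : 1 < Module.finrank ℚ K) (hreal : Nonempty (K →+* ℝ)) (j : ℕ)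
    (hj : j ≠ 0) : ∃ u : (𝓞 K)ˣ, (((u : 𝓞 K) : K) ^ j) ^ 2 ≠ 1 := by
  by_contra! hcon
  have := adjoin_units hreal j hj ⊥ (fun u => by
    rcases mul_self_eq_one_iff.1 ((sq _).symm.trans (hcon u)) with h | h
    · rw [h]; exact one_mem _
    · rw [h]; exact neg_mem (one_mem _))
  have h2 : Module.finrank ℚ (⊥ : IntermediateField ℚ K) = Module.finrank ℚ K := by
    rw [this]; exact IntermediateField.finrank_top'
  rw [IntermediateField.finrank_bot] at h2
  omega

end B6
end Vas

open NumberField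

namespace Vas
section A3
variable {K : Type*} [Field K] [NumberField K]

lemma finite_quot {k : 𝓞 K} (hk : k ≠ 0) : Finite (𝓞 K ⧸ Ideal.span {k}) :=
  Ring.HasFiniteQuotients.finiteQuotient (by simpa using hk)

lemma mk_eq_zero' {k x : 𝓞 K} : Ideal.Quotient.mk (Ideal.span {k}) x = 0 ↔ k ∣ x := by
  rw [Ideal.Quotient.eq_zero_iff_mem, Ideal.mem_span_singleton]

/-- the exponent of `(O/k)ˣ` -/
noncomputable def lam (k : 𝓞 K) : ℕ := Nat.card (𝓞 K ⧸ Ideal.span {k})ˣ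

lemma lam_ne_zero {k : 𝓞 K} (hk : k ≠ 0) : lam k ≠ 0 := by
  have := finite_quot hk
  exact Nat.card_ne_zero.2 ⟨inferInstance, inferInstance⟩

lemma isUnit_mk_of_coprime {k a : 𝓞 K} (h : IsCoprime a k) :
    IsUnit (Ideal.Quotient.mk (Ideal.span {k}) a) := by
  obtain ⟨x, y, e⟩ := h
  have := congrArg (Ideal.Quotient.mk (Ideal.span {k})) e
  rw [map_add, map_mul, map_mul, (mk_eq_zero' (k := k) (x := k)).2 dvd_rfl, mul_zero, add_zero,
    map_one] at this
  exact IsUnit.of_mul_eq_one_right _ this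

lemma lam_spec {k a : 𝓞 K} (h : IsCoprime a k) : k ∣ a ^ lam k - 1 := by
  rw [← mk_eq_zero', map_sub, map_pow, map_one, sub_eq_zero]
  obtain ⟨u, hu⟩ := isUnit_mk_of_coprime h
  rw [← hu, ← Units.val_pow_eq_pow_val, lam, pow_card_eq_one']
  rfl

lemma unit_span (hreal : Nonempty (K →+* ℝ)) (hdeg : 1 < Module.finrank ℚ K) (j : ℕ) (hj : j ≠ 0) :
    ∃ n : 𝓞 K, n ≠ 0 ∧ ∀ S : AddSubgroup K,
      (∀ u : (𝓞 K)ˣ, ((u : 𝓞 K) : K) ^ j - 1 ∈ S) → ∀ x, inI n x → x ∈ S := by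
  set S : AddSubgroup K :=
    AddSubgroup.closure {x | ∃ u : (𝓞 K)ˣ, x = ((u : 𝓞 K) : K) ^ j - 1} with hS
  suffices h : ∃ n : 𝓞 K, n ≠ 0 ∧ ∀ x, inI n x → x ∈ S by
    obtain ⟨n, hn, h⟩ := h
    refine ⟨n, hn, fun T hT x hx => ?_⟩
    have : S ≤ T := by
      rw [hS, AddSubgroup.closure_le]
      rintro x ⟨u, rfl⟩; exact hT u
    exact this (h x hx)
  have hu : ∀ u : (𝓞 K)ˣ, ((u : 𝓞 K) : K) ^ j - 1 ∈ S := fun u =>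
    AddSubgroup.subset_closure ⟨u, rfl⟩
  let F : Subalgebra ℚ K :=
    { carrier := {x | ∃ n : ℤ, n ≠ 0 ∧ ∀ s ∈ S, (n : K) * x * s ∈ S}
      mul_mem' := by
        rintro x y ⟨n, hn, h⟩ ⟨m, hm, h'⟩
        refine ⟨n * m, mul_ne_zero hn hm, fun s hs => ?_⟩
        have := h _ (h' s hs)
        push_cast
        convert this using 1; ring
      add_mem' := by
        rintro x y ⟨n, hn, h⟩ ⟨m, hm, h'⟩
        refine ⟨n * m, mul_ne_zero hn hm, fun s hs => ?_⟩
        have := S.add_mem (S.zsmul_mem (h s hs) m) (S.zsmul_mem (h' s hs) n)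
        simp only [zsmul_eq_mul] at this
        push_cast
        convert this using 1; ring
      algebraMap_mem' := by
        intro r
        refine ⟨r.den, by exact_mod_cast r.den_nz, fun s hs => ?_⟩
        have := S.zsmul_mem hs r.num
        convert this using 1
        rw [zsmul_eq_mul]
        congr 1
        have h2 : ((r.den : ℚ) : K) * (r : K) = ((r.num : ℚ) : K) := by
          rw [← Rat.cast_mul]; congr 1; rw [mul_comm]; exact Rat.mul_den_eq_num r
        rw [Rat.cast_natCast, Rat.cast_intCast] at h2
        rw [eq_ratCast, Int.cast_natCast, h2] }
  have hF : F.toIntermediateField (fun x hx => F.inv_mem_of_algebraic (x := ⟨x, hx⟩)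
      (Algebra.IsAlgebraic.isAlgebraic (R := ℚ) x)) = ⊤ := by
    refine adjoin_units hreal j hj _ ?_
    intro u
    refine ⟨1, one_ne_zero, fun s hs => ?_⟩
    rw [Int.cast_one, one_mul]
    refine AddSubgroup.closure_induction (p := fun s _ => ((u : 𝓞 K) : K) ^ j * s ∈ S)
      ?_ ?_ ?_ ?_ hs
    · rintro x ⟨v, rfl⟩
      have := S.sub_mem (hu (u * v)) (hu u)
      convert this using 1
      push_cast; ring
    · simp
    · intro x y _ _ h1 h2
      rw [mul_add]; exact S.add_mem h1 h2
    · intro x _ h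
      rw [mul_neg]; exact S.neg_mem h
  have hall : ∀ x : K, ∃ n : ℤ, n ≠ 0 ∧ (n : K) * x ∈ S := by
    intro x
    obtain ⟨u, hu1⟩ := exists_unit hdeg hreal j hj
    set s0 := ((u : 𝓞 K) : K) ^ j - 1 with hs0
    have hs00 : s0 ≠ 0 := by
      intro h
      apply hu1
      rw [sub_eq_zero.1 h, one_pow]
    have hx : x / s0 ∈ F := by
      have : x / s0 ∈ (⊤ : IntermediateField ℚ K) := IntermediateField.mem_top
      rw [← hF] at this
      exact this
    obtain ⟨n, hn, h⟩ := hx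
    refine ⟨n, hn, ?_⟩
    have := h s0 (hu u)
    convert this using 1
    field_simp
  choose c hc hcS using hall
  let b := RingOfIntegers.basis K
  refine ⟨((∏ i, c (b i) : ℤ) : 𝓞 K), ?_, ?_⟩
  · exact_mod_cast Finset.prod_ne_zero_iff.2 (fun i _ => hc _)
  · rintro x ⟨y, rfl⟩
    rw [← b.sum_repr y]
    rw [show ((∑ i, b.repr y i • b i : 𝓞 K) : K) = ∑ i, ((b.repr y i • b i : 𝓞 K) : K) from
      map_sum (algebraMap (𝓞 K) K) _ _, Finset.mul_sum]
    refine S.sum_mem (fun i _ => ?_)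
    have hdvd : c (b i) ∣ ∏ i, c (b i) := Finset.dvd_prod_of_mem (fun i => c (b i)) (Finset.mem_univ i)
    obtain ⟨e, he⟩ := hdvd
    rw [he]
    have := S.zsmul_mem (hcS (b i)) (e * b.repr y i)
    convert this using 1
    have hz : ∀ z : ℤ, ((z : 𝓞 K) : K) = z := fun z => map_intCast (algebraMap (𝓞 K) K) z
    simp only [zsmul_eq_mul, Int.cast_mul, map_mul, hz]
    ring

lemma contU_aux {x : K} {n p q z : 𝓞 K} (w : (𝓞 K)ˣ) (hd : n * n ∣ (w : 𝓞 K) - 1) (hx : x ≠ 0)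
    (W : K) (Wi : 𝓞 K) (hW : ((w : 𝓞 K) : K) * (Wi : K) = 1)
    (hpq : (p : K) / q = x) (hp : (p : K) ≠ 0) (hq : (q : K) ≠ 0)
    (hwz : ((w : 𝓞 K) : K) - 1 = n * n * p * q * z) :
    UU x * LL ((((w : 𝓞 K) : K) - 1) / x) * (UU x)⁻¹ ∈ EE n n := by
  have hH := HH_mem w hd
  have h00 : (HH (uK w)).1 0 0 = ((w : 𝓞 K) : K) := rfl
  have h11 : (HH (uK w)).1 1 1 = (Wi : K) := by
    rw [HH11, uK_coe]; exact inv_eq_of_mul_eq_one_right hW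
  have h01 : (HH (uK w)).1 0 1 = 0 := rfl
  have h10 : (HH (uK w)).1 1 0 = 0 := rfl
  generalize ((w : 𝓞 K) : K) = W at *
  generalize HH (uK w) = H at *
  have e : UU x * LL ((W - 1) / x) * (UU x)⁻¹ =
      LL ((W - 1) / x * Wi) * H * UU (x * Wi - x) := by
    apply ext4
    · simp only [mul00, mul01, mul10, mul11, UU00, UU01, UU10, UU11, LL00, LL01, LL10, LL11, inv00,
        inv01, inv10, inv11, h00, h01, h10, h11]
      field_simp; ring
    · simp only [mul00, mul01, mul10, mul11, UU00, UU01, UU10, UU11, LL00, LL01, LL10, LL11, inv00,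
        inv01, inv10, inv11, h00, h01, h10, h11]
      field_simp; linear_combination (-x) * hW
    · simp only [mul00, mul01, mul10, mul11, UU00, UU01, UU10, UU11, LL00, LL01, LL10, LL11, inv00,
        inv01, inv10, inv11, h00, h01, h10, h11]
      field_simp; linear_combination (1 - W) * hW
    · simp only [mul00, mul01, mul10, mul11, UU00, UU01, UU10, UU11, LL00, LL01, LL10, LL11, inv00,
        inv01, inv10, inv11, h00, h01, h10, h11]
      field_simp
      linear_combination x * (W + Wi - W * Wi - 2) * hW
  rw [e]
  refine mul_mem (mul_mem (LL_mem ?_) hH) (UU_mem ?_)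
  · refine ⟨n * q * q * z * Wi, ?_⟩
    rw [hwz, ← hpq]
    push_cast; field_simp
  · have : x * Wi - x = - (x * (W - 1) * Wi) := by linear_combination x * hW
    refine ⟨-(n * p * p * z * Wi), ?_⟩
    rw [this, hwz, ← hpq]
    push_cast; field_simp

lemma contU (hreal : Nonempty (K →+* ℝ)) (hdeg : 1 < Module.finrank ℚ K) (x : K) {n : 𝓞 K}
    (hn : n ≠ 0) : ∃ n' : 𝓞 K, n' ≠ 0 ∧ n ∣ n' ∧ ∀ s, inI n' s → UU x * LL s * (UU x)⁻¹ ∈ EE n n := by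
  by_cases hx : x = 0
  · subst hx
    exact ⟨n, hn, dvd_rfl, fun s hs => by simpa using LL_mem hs⟩
  obtain ⟨p, q, hq, hpq⟩ := IsFractionRing.div_surjective (A := 𝓞 K) x
  have hq0 : q ≠ 0 := nonZeroDivisors.ne_zero hq
  have hq0' : (q : K) ≠ 0 := by exact_mod_cast hq0
  have hp0 : p ≠ 0 := by rintro rfl; simp at hpq; exact hx hpq.symm
  have hp0' : (p : K) ≠ 0 := by exact_mod_cast hp0
  set k := n * n * p * q with hk
  have hk0 : k ≠ 0 := by rw [hk]; exact mul_ne_zero (mul_ne_zero (mul_ne_zero hn hn) hp0) hq0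
  obtain ⟨n2, hn2, hspan⟩ := unit_span hreal hdeg (lam k) (lam_ne_zero hk0)
  refine ⟨n2 * q * n, mul_ne_zero (mul_ne_zero hn2 hq0) hn, dvd_mul_left _ _, ?_⟩
  let S : AddSubgroup K :=
    { carrier := {y | UU x * LL (y / x) * (UU x)⁻¹ ∈ EE n n}
      add_mem' := by
        intro y z hy hz
        have hy' : UU x * LL (y/x) * (UU x)⁻¹ ∈ EE n n := hy
        have hz' : UU x * LL (z/x) * (UU x)⁻¹ ∈ EE n n := hz
        have := mul_mem hy' hz'
        simp only [Set.mem_setOf_eq]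
        convert this using 1
        rw [add_div, LL_add]; group
      zero_mem' := by simp
      neg_mem' := by
        intro y hy
        have hy' : UU x * LL (y/x) * (UU x)⁻¹ ∈ EE n n := hy
        have := inv_mem hy'
        simp only [Set.mem_setOf_eq]
        convert this using 1
        rw [neg_div, LL_neg]; group }
  have key := hspan S (fun u => by
    have hdiv := lam_spec (k := k) (a := u) (by exact (isCoprime_one_left).of_isCoprime_of_dvd_left (by exact u.isUnit.dvd))
    obtain ⟨z, hz⟩ := hdiv
    set w : (𝓞 K)ˣ := u ^ lam k with hw
    have hwc : ((u : 𝓞 K) : K) ^ lam k = ((w : 𝓞 K) : K) := by rw [hw]; push_cast; rfl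
    rw [hwc]
    have hw0 : ((w : 𝓞 K) : K) ≠ 0 := by rw [← uK_coe]; exact Units.ne_zero _
    have hwz : ((w : 𝓞 K) : K) - 1 = n * n * p * q * z := by
      have h1 : (w : 𝓞 K) - 1 = n * n * p * q * z := by
        rw [← hk, ← hz, hw]; push_cast; rfl
      exact_mod_cast congrArg (algebraMap (𝓞 K) K) h1
    have hWi : ((w : 𝓞 K) : K) * (((w⁻¹ : (𝓞 K)ˣ) : 𝓞 K) : K) = 1 := by
      rw [← uK_inv_coe]; exact mul_inv_cancel₀ hw0
    have hdvd : n * n ∣ (w : 𝓞 K) - 1 := by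
      refine ⟨p * q * z, ?_⟩
      apply RingOfIntegers.ext
      push_cast
      rw [hwz]; ring
    exact contU_aux w hdvd hx 0 _ hWi hpq hp0' hq0' hwz)
  rintro s ⟨y, rfl⟩
  have := key (((n2 * q * n : 𝓞 K) : K) * y * x) ⟨p * n * y, by rw [← hpq]; push_cast; field_simp⟩
  have h2 : UU x * LL ((((n2 * q * n : 𝓞 K) : K) * y * x) / x) * (UU x)⁻¹ ∈ EE n n := this
  rwa [mul_div_cancel_right₀ _ hx] at h2

/-- Weyl element -/
def WW : SL K := mk4 0 1 (-1) 0 (by ring)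

lemma WW_UU (x : K) : WW * UU x * WW⁻¹ = LL (-x) := by
  apply ext4 <;> simp [WW]
lemma WW_LL (x : K) : WW * LL x * WW⁻¹ = UU (-x) := by
  apply ext4 <;> simp [WW]

lemma WW_EE {n : 𝓞 K} {e : SL K} (he : e ∈ EE n n) : WW * e * WW⁻¹ ∈ EE n n := by
  refine EE_conj WW ?_ ?_ he
  · intro x hx; rw [WW_UU]; exact LL_mem hx.neg
  · intro x hx; rw [WW_LL]; exact UU_mem hx.neg

lemma WW_EE' {n : 𝓞 K} {e : SL K} (he : e ∈ EE n n) : WW⁻¹ * e * WW ∈ EE n n := by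
  have := EE_conj (S := EE n n) (WW⁻¹ : SL K) ?_ ?_ he
  · simpa using this
  · intro x hx
    rw [show (WW⁻¹ : SL K) * UU x * WW⁻¹⁻¹ = LL (-x) by apply ext4 <;> simp [WW]]
    exact LL_mem hx.neg
  · intro x hx
    rw [show (WW⁻¹ : SL K) * LL x * WW⁻¹⁻¹ = UU (-x) by apply ext4 <;> simp [WW]]
    exact UU_mem hx.neg

lemma contU' (hreal : Nonempty (K →+* ℝ)) (hdeg : 1 < Module.finrank ℚ K) (x : K) {n : 𝓞 K}
    (hn : n ≠ 0) : ∃ n' : 𝓞 K, n' ≠ 0 ∧ ∀ e ∈ EE n' n', UU x * e * (UU x)⁻¹ ∈ EE n n := by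
  obtain ⟨n', h0, h1, h2⟩ := contU hreal hdeg x hn
  refine ⟨n', h0, fun e he => EE_conj _ ?_ h2 he⟩
  intro y hy
  have : UU x * UU y * (UU x)⁻¹ = UU y := by rw [← UU_neg, ← UU_add, ← UU_add]; congr 1; ring
  rw [this]; exact UU_mem (hy.mono h1)

lemma contL' (hreal : Nonempty (K →+* ℝ)) (hdeg : 1 < Module.finrank ℚ K) (x : K) {n : 𝓞 K}
    (hn : n ≠ 0) : ∃ n' : 𝓞 K, n' ≠ 0 ∧ ∀ e ∈ EE n' n', LL x * e * (LL x)⁻¹ ∈ EE n n := by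
  obtain ⟨n', h0, h2⟩ := contU' hreal hdeg (-x) hn
  refine ⟨n', h0, fun e he => ?_⟩
  have h3 := WW_EE (h2 _ (WW_EE' he))
  have h4 : LL x = WW * UU (-x) * WW⁻¹ := by rw [WW_UU, neg_neg]
  rw [h4]
  convert h3 using 1
  group

theorem cont (hreal : Nonempty (K →+* ℝ)) (hdeg : 1 < Module.finrank ℚ K) (g : SL K) {n : 𝓞 K}
    (hn : n ≠ 0) : ∃ n' : 𝓞 K, n' ≠ 0 ∧ ∀ e ∈ EE n' n', g * e * g⁻¹ ∈ EE n n := by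
  obtain ⟨w, x, y, z, rfl⟩ := factor g
  obtain ⟨n1, h1, H1⟩ := contL' hreal hdeg w hn
  obtain ⟨n2, h2, H2⟩ := contU' hreal hdeg x h1
  obtain ⟨n3, h3, H3⟩ := contL' hreal hdeg y h2
  obtain ⟨n4, h4, H4⟩ := contU' hreal hdeg z h3
  refine ⟨n4, h4, fun e he => ?_⟩
  have := H1 _ (H2 _ (H3 _ (H4 _ he)))
  convert this using 1
  group

lemma exists_denom (x : K) : ∃ D : 𝓞 K, D ≠ 0 ∧ inI 1 (D * x) := by
  obtain ⟨p, q, hq, hpq⟩ := IsFractionRing.div_surjective (A := 𝓞 K) x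
  have hq0 : q ≠ 0 := nonZeroDivisors.ne_zero hq
  have hq0' : (q : K) ≠ 0 := by exact_mod_cast hq0
  exact ⟨q, hq0, p, by rw [← hpq]; push_cast; field_simp⟩

lemma contP_aux {D : 𝓞 K} {n : 𝓞 K} {x y z : K} (hx : inI 1 (D * x)) (hy : inI 1 (D * y))
    (hz : inI (n * D * D) z) : inI n (x * z * y) := by
  obtain ⟨p, hp⟩ := hx
  obtain ⟨q, hq⟩ := hy
  obtain ⟨r, rfl⟩ := hz
  refine ⟨p * q * r, ?_⟩
  have hp' : (D : K) * x = p := by rw [hp]; push_cast; ring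
  have hq' : (D : K) * y = q := by rw [hq]; push_cast; ring
  simp only [map_mul]
  linear_combination (n * r * D * y : K) * hp' + (n * r * p : K) * hq'

theorem contP (g : SL K) {n : 𝓞 K} (hn : n ≠ 0) :
    ∃ n' : 𝓞 K, n' ≠ 0 ∧ ∀ γ, PP n' γ → PP n (g * γ * g⁻¹) := by
  obtain ⟨D1, h1, e1⟩ := exists_denom (g.1 0 0)
  obtain ⟨D2, h2, e2⟩ := exists_denom (g.1 0 1)
  obtain ⟨D3, h3, e3⟩ := exists_denom (g.1 1 0)
  obtain ⟨D4, h4, e4⟩ := exists_denom (g.1 1 1)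
  set D := D1 * D2 * D3 * D4 with hD
  have f1 : inI 1 (D * g.1 0 0) := by
    have : (D : K) * g.1 0 0 = ((D2 * D3 * D4 : 𝓞 K) : K) * (D1 * g.1 0 0) := by rw [hD]; push_cast; ring
    rw [this]; exact (inI_coe _).mulr e1
  have f2 : inI 1 (D * g.1 0 1) := by
    have : (D : K) * g.1 0 1 = ((D1 * D3 * D4 : 𝓞 K) : K) * (D2 * g.1 0 1) := by rw [hD]; push_cast; ring
    rw [this]; exact (inI_coe _).mulr e2
  have f3 : inI 1 (D * g.1 1 0) := by
    have : (D : K) * g.1 1 0 = ((D1 * D2 * D4 : 𝓞 K) : K) * (D3 * g.1 1 0) := by rw [hD]; push_cast; ring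
    rw [this]; exact (inI_coe _).mulr e3
  have f4 : inI 1 (D * g.1 1 1) := by
    have : (D : K) * g.1 1 1 = ((D1 * D2 * D3 : 𝓞 K) : K) * (D4 * g.1 1 1) := by rw [hD]; push_cast; ring
    rw [this]; exact (inI_coe _).mulr e4
  have hD0 : D ≠ 0 := mul_ne_zero (mul_ne_zero (mul_ne_zero h1 h2) h3) h4
  refine ⟨n * D * D, mul_ne_zero (mul_ne_zero hn hD0) hD0, ?_⟩
  rintro γ ⟨a1, a2, a3, a4⟩
  have hdet := det4 g
  refine ⟨?_, ?_, ?_, ?_⟩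
  · have : (g * γ * g⁻¹).1 0 0 - 1 = g.1 0 0 * (γ.1 0 0 - 1) * g.1 1 1 + g.1 0 1 * γ.1 1 0 * g.1 1 1
        - g.1 0 0 * γ.1 0 1 * g.1 1 0 - g.1 0 1 * (γ.1 1 1 - 1) * g.1 1 0 := by
      simp only [mul00, mul01, inv00, inv10]; linear_combination hdet
    rw [this]
    exact (((contP_aux f1 f4 a1).add (contP_aux f2 f4 a3)).sub (contP_aux f1 f3 a2)).sub
      (contP_aux f2 f3 a4)
  · have : (g * γ * g⁻¹).1 0 1 = - (g.1 0 0 * (γ.1 0 0 - 1) * g.1 0 1) - g.1 0 1 * γ.1 1 0 * g.1 0 1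
        + g.1 0 0 * γ.1 0 1 * g.1 0 0 + g.1 0 1 * (γ.1 1 1 - 1) * g.1 0 0 := by
      simp only [mul00, mul01, inv01, inv11]; ring
    rw [this]
    exact (((contP_aux f1 f2 a1).neg.sub (contP_aux f2 f2 a3)).add (contP_aux f1 f1 a2)).add
      (contP_aux f2 f1 a4)
  · have : (g * γ * g⁻¹).1 1 0 = g.1 1 0 * (γ.1 0 0 - 1) * g.1 1 1 + g.1 1 1 * γ.1 1 0 * g.1 1 1
        - g.1 1 0 * γ.1 0 1 * g.1 1 0 - g.1 1 1 * (γ.1 1 1 - 1) * g.1 1 0 := by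
      simp only [mul10, mul11, inv00, inv10]; ring
    rw [this]
    exact (((contP_aux f3 f4 a1).add (contP_aux f4 f4 a3)).sub (contP_aux f3 f3 a2)).sub
      (contP_aux f4 f3 a4)
  · have : (g * γ * g⁻¹).1 1 1 - 1 = - (g.1 1 0 * (γ.1 0 0 - 1) * g.1 0 1) - g.1 1 1 * γ.1 1 0 * g.1 0 1
        + g.1 1 0 * γ.1 0 1 * g.1 0 0 + g.1 1 1 * (γ.1 1 1 - 1) * g.1 0 0 := by
      simp only [mul10, mul11, inv01, inv11]; linear_combination hdet
    rw [this]
    exact (((contP_aux f3 f2 a1).neg.sub (contP_aux f4 f2 a3)).add (contP_aux f3 f1 a2)).add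
      (contP_aux f4 f1 a4)

end A3
end Vas

open NumberField

namespace Vas
section A5
variable {K : Type*} [Field K] [NumberField K]

/-- `O/s` is generated by the integers -/
def Nice (s : 𝓞 K) : Prop := s ≠ 0 ∧ ∀ x : 𝓞 K, ∃ m : ℤ, s ∣ x - m

lemma coe_int (z : ℤ) : ((z : 𝓞 K) : K) = z := map_intCast (algebraMap (𝓞 K) K) z

lemma exists_primitive : ∃ θ : 𝓞 K, ∀ φ ψ : K →ₐ[ℚ] ℂ, φ θ = ψ θ → φ = ψ := by
  obtain ⟨α, hα⟩ := Field.exists_primitive_element ℚ K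
  obtain ⟨y, hy0, hy⟩ := ((IsFractionRing.isAlgebraic_iff ℤ ℚ K).2
    (Algebra.IsAlgebraic.isAlgebraic (R := ℚ) α)).exists_integral_multiple
  refine ⟨⟨y • α, hy⟩, fun φ ψ h => ?_⟩
  have h1 := (Field.primitive_element_iff_algHom_eq_of_eval ℚ ℂ
    (fun x => IsAlgClosed.splits _) α φ).1 hα ψ
  apply h1
  have h2 : φ (y • α) = ψ (y • α) := h
  rw [map_zsmul, map_zsmul, zsmul_eq_mul, zsmul_eq_mul] at h2
  exact mul_left_cancel₀ (by exact_mod_cast hy0) h2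

lemma exists_int_adjoin {θ : 𝓞 K} (hθ : ∀ φ ψ : K →ₐ[ℚ] ℂ, φ θ = ψ θ → φ = ψ) :
    ∃ I : ℕ, I ≠ 0 ∧ ∀ x : 𝓞 K, ∃ P : Polynomial ℤ, (I : 𝓞 K) * x = Polynomial.aeval θ P := by
  let φ0 : K →ₐ[ℚ] ℂ := (Classical.choice (inferInstance : Nonempty (K →+* ℂ))).toRatAlgHom
  have htop : IntermediateField.adjoin ℚ {(θ : K)} = ⊤ :=
    (Field.primitive_element_iff_algHom_eq_of_eval ℚ ℂ
      (fun x => IsAlgClosed.splits _) (θ : K) φ0).2 (hθ φ0)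
  have halg : Algebra.adjoin ℚ {(θ : K)} = ⊤ := by
    have h1 := IntermediateField.adjoin_simple_toSubalgebra_of_isAlgebraic (F := ℚ) (α := (θ : K))
      (Algebra.IsAlgebraic.isAlgebraic _)
    rw [htop] at h1
    rw [← h1]; rfl
  let B : PowerBasis ℚ K := PowerBasis.ofAdjoinEqTop (Algebra.IsIntegral.isIntegral _) halg
  have hgen : B.gen = (θ : K) := PowerBasis.ofAdjoinEqTop_gen _ _
  have hIntg : IsIntegral ℤ B.gen := by rw [hgen]; exact θ.2
  have hd : IsIntegral ℤ (Algebra.discr ℚ B.basis) := by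
    apply Algebra.discr_isIntegral
    intro i
    rw [B.basis_eq_pow]; exact hIntg.pow _
  obtain ⟨D, hD⟩ := IsIntegrallyClosed.isIntegral_iff.1 hd
  have hD0 : D ≠ 0 := by
    rintro rfl
    apply Algebra.discr_not_zero_of_basis ℚ B.basis
    rw [← hD]; simp
  refine ⟨D.natAbs, by simpa using hD0, fun x => ?_⟩
  have h1 := Algebra.discr_mul_isIntegral_mem_adjoin ℚ (B := B) hIntg (z := (x : K)) x.2
  rw [hgen, Algebra.adjoin_singleton_eq_range_aeval] at h1
  obtain ⟨P, hP⟩ := h1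
  rw [← hD] at hP
  have hP2 : Polynomial.aeval θ P = (D : 𝓞 K) * x := by
    apply RingOfIntegers.ext
    have h3 : algebraMap (𝓞 K) K (Polynomial.aeval θ P) = Polynomial.aeval (θ : K) P := by
      rw [← Polynomial.aeval_algebraMap_apply]
    have h4 : (Polynomial.aeval (θ : K)) P = (D : K) * x := by
      have h5 : (Polynomial.aeval (θ : K)) P = ((algebraMap ℤ ℚ) D) • (x : K) := hP
      rw [h5, Algebra.smul_def]; congr 1; simp
    have h6 : algebraMap (𝓞 K) K ((D : 𝓞 K) * x) = (D : K) * x := by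
      rw [map_mul, map_intCast]
    exact h3.trans (h4.trans h6.symm)
  rcases Int.natAbs_eq D with h | h
  · refine ⟨P, ?_⟩
    rw [hP2]; congr 1; rw [← Int.cast_natCast, ← h]
  · refine ⟨-P, ?_⟩
    rw [map_neg, hP2, ← neg_mul]; congr 1; rw [← Int.cast_natCast, ← Int.cast_neg]; congr 1; omega

/-- the conjugate embedding -/
noncomputable def cj (φ : K →ₐ[ℚ] ℂ) : K →ₐ[ℚ] ℂ := (Complex.conjAe.toAlgHom.restrictScalars ℚ).comp φ
lemma cj_apply (φ : K →ₐ[ℚ] ℂ) (x : K) : cj φ x = (starRingEnd ℂ) (φ x) := rfl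
lemma cj_cj (φ : K →ₐ[ℚ] ℂ) : cj (cj φ) = φ := by ext x; simp [cj_apply]

lemma norm_neg {θ : 𝓞 K} (hreal : Nonempty (K →+* ℝ)) {c : ℝ} (hc : 0 < c)
    (hθ : ∀ φ ψ : K →ₐ[ℚ] ℂ, φ ≠ ψ → c < ‖φ θ - ψ θ‖) :
    ∃ r : ℝ, ∀ (y : ℕ) (k : ℤ), 0 < y → -(k : ℝ) / y ∈ Set.Ioc r (r + c) →
      Algebra.norm ℤ ((y : 𝓞 K) * θ + k) < 0 := by
  classical
  let R : Finset (K →ₐ[ℚ] ℂ) := Finset.univ.filter (fun φ => (φ θ).im = 0)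
  have hR : R.Nonempty := by
    obtain ⟨ρ⟩ := hreal
    refine ⟨(Complex.ofRealHom.comp ρ).toRatAlgHom, ?_⟩
    simp [R]
  obtain ⟨φ₁, h1, h2⟩ := Finset.exists_min_image R (fun φ => (φ θ).re) hR
  have h1' : (φ₁ θ).im = 0 := by simpa [R] using h1
  refine ⟨(φ₁ θ).re, fun y k hy hk => ?_⟩
  set a : 𝓞 K := (y : 𝓞 K) * θ + k with ha
  have hy' : (0 : ℝ) < y := by exact_mod_cast hy
  have haφ : ∀ φ : K →ₐ[ℚ] ℂ, φ a = y * φ θ + k := by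
    intro φ
    rw [ha]
    have : (((y : 𝓞 K) * θ + k : 𝓞 K) : K) = (y : K) * θ + k := by
      change algebraMap (𝓞 K) K _ = _
      rw [map_add, map_mul, map_natCast, map_intCast]
    rw [this, map_add, map_mul, map_natCast, map_intCast]
  have hre : ∀ φ ∈ R, φ a = ((y * (φ θ).re + k : ℝ) : ℂ) := by
    intro φ hφ
    have hφ' : (φ θ).im = 0 := by simpa [R] using hφ
    rw [haφ]
    apply Complex.ext <;> simp [hφ']
  have hk1 : y * (φ₁ θ).re + k < 0 := by
    have := hk.1
    rw [lt_div_iff₀ hy'] at this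
    linarith
  have hk2 : ∀ φ ∈ R.erase φ₁, 0 < y * (φ θ).re + k := by
    intro φ hφ
    rw [Finset.mem_erase] at hφ
    have h3 := hθ φ φ₁ hφ.1
    have hφ' : (φ θ).im = 0 := by simpa [R] using hφ.2
    have h4 : φ θ - φ₁ θ = (((φ θ).re - (φ₁ θ).re : ℝ) : ℂ) := by
      apply Complex.ext <;> simp [hφ', h1']
    rw [h4, Complex.norm_real, Real.norm_eq_abs,
      abs_of_nonneg (sub_nonneg.2 (h2 φ hφ.2))] at h3
    have := hk.2
    rw [div_le_iff₀ hy'] at this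
    nlinarith
  have hnorm := Algebra.norm_eq_prod_embeddings ℚ ℂ (a : K)
  rw [← Algebra.coe_norm_int] at hnorm
  rw [← Finset.prod_filter_mul_prod_filter_not Finset.univ (fun φ : K →ₐ[ℚ] ℂ => (φ θ).im = 0)] at hnorm
  change _ = (∏ φ ∈ R, φ a) * _ at hnorm
  rw [← Finset.mul_prod_erase R (fun φ : K →ₐ[ℚ] ℂ => φ a) h1] at hnorm
  rw [← Finset.prod_filter_mul_prod_filter_not (Finset.univ.filter _)
    (fun φ : K →ₐ[ℚ] ℂ => 0 < (φ θ).im)] at hnorm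
  have hcj : ∏ φ ∈ (Finset.univ.filter (fun φ : K →ₐ[ℚ] ℂ => ¬ (φ θ).im = 0)).filter
      (fun φ => ¬ 0 < (φ θ).im), φ a = (starRingEnd ℂ) (∏ φ ∈ (Finset.univ.filter
      (fun φ : K →ₐ[ℚ] ℂ => ¬ (φ θ).im = 0)).filter (fun φ => 0 < (φ θ).im), φ a) := by
    rw [map_prod]
    symm
    refine Finset.prod_bij (fun φ _ => cj φ) ?_ ?_ ?_ ?_
    · intro φ hφ
      simp only [Finset.mem_filter, Finset.mem_univ, true_and] at hφ ⊢
      rw [cj_apply, Complex.conj_im]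
      exact ⟨by simpa using hφ.1, by linarith [hφ.2]⟩
    · intro φ _ ψ _ h
      rw [← cj_cj φ, h, cj_cj]
    · intro φ hφ
      refine ⟨cj φ, ?_, cj_cj φ⟩
      simp only [Finset.mem_filter, Finset.mem_univ, true_and] at hφ ⊢
      rw [cj_apply, Complex.conj_im]
      refine ⟨by simpa using hφ.1, ?_⟩
      rcases lt_or_gt_of_ne hφ.1 with h | h
      · linarith
      · exact absurd h hφ.2
    · intro φ _
      rfl
  rw [hcj, Complex.mul_conj, hre φ₁ h1, Finset.prod_congr rfl
    (fun φ hφ => hre φ (Finset.mem_of_mem_erase hφ)), ← Complex.ofReal_prod, ← Complex.ofReal_mul,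
    ← Complex.ofReal_mul] at hnorm
  have hnz : (∏ φ ∈ (Finset.univ.filter
      (fun φ : K →ₐ[ℚ] ℂ => ¬ (φ θ).im = 0)).filter (fun φ => 0 < (φ θ).im), φ a) ≠ 0 := by
    rw [Finset.prod_ne_zero_iff]
    intro φ hφ h0
    simp only [Finset.mem_filter, Finset.mem_univ, true_and] at hφ
    rw [haφ] at h0
    have := congrArg Complex.im h0
    simp at this
    rcases this with h | h
    · omega
    · exact hφ.1 h
  have hfin : ((Algebra.norm ℤ a : ℤ) : ℝ) = (y * (φ₁ θ).re + k) *
      (∏ φ ∈ R.erase φ₁, (y * (φ θ).re + k)) * Complex.normSq (∏ φ ∈ (Finset.univ.filter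
      (fun φ : K →ₐ[ℚ] ℂ => ¬ (φ θ).im = 0)).filter (fun φ => 0 < (φ θ).im), φ a) := by
    apply Complex.ofReal_injective
    refine Eq.trans ?_ hnorm
    simp
  have hneg : ((Algebra.norm ℤ a : ℤ) : ℝ) < 0 := by
    rw [hfin]
    refine mul_neg_of_neg_of_pos (mul_neg_of_neg_of_pos hk1 (Finset.prod_pos hk2)) ?_
    exact Complex.normSq_pos.2 hnz
  exact_mod_cast hneg

lemma exists_sep (a : 𝓞 K) (c : ℕ) (hc : 0 < c) : ∃ η : 𝓞 K, ∀ φ ψ : K →ₐ[ℚ] ℂ, φ ≠ ψ →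
    (c : ℝ) < ‖φ (a + c * η : 𝓞 K) - ψ (a + c * η : 𝓞 K)‖ := by
  obtain ⟨η, hη⟩ := exists_primitive (K := K)
  have key : ∀ φ ψ : K →ₐ[ℚ] ℂ, ∀ᶠ t : ℕ in Filter.atTop, φ ≠ ψ →
      (c : ℝ) < ‖φ (a + c * (t * η) : 𝓞 K) - ψ (a + c * (t * η) : 𝓞 K)‖ := by
    intro φ ψ
    by_cases h : φ = ψ
    · simp [h]
    have h0 : φ η ≠ ψ η := fun h' => h (hη _ _ h')
    have h1 : 0 < ‖φ η - ψ η‖ := norm_pos_iff.2 (sub_ne_zero.2 h0)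
    obtain ⟨T, hT⟩ := exists_nat_gt ((c + ‖φ a - ψ a‖) / ‖φ η - ψ η‖)
    filter_upwards [Filter.eventually_ge_atTop T] with t ht _
    have e : φ (a + c * (t * η) : 𝓞 K) - ψ (a + c * (t * η) : 𝓞 K) =
        (φ a - ψ a) + (c * t : ℕ) * (φ η - ψ η) := by
      have : ((a + c * (t * η) : 𝓞 K) : K) = a + c * (t * η) := by
        change algebraMap (𝓞 K) K _ = _
        rw [map_add, map_mul, map_mul, map_natCast, map_natCast]
      rw [this]; simp only [map_add, map_mul, map_natCast]; push_cast; ring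
    rw [e]
    have h2 : ‖((c * t : ℕ) : ℂ) * (φ η - ψ η)‖ = c * t * ‖φ η - ψ η‖ := by
      rw [norm_mul, Complex.norm_natCast]; push_cast; ring
    have h3 := norm_sub_le ((φ a - ψ a) + (c * t : ℕ) * (φ η - ψ η)) (φ a - ψ a)
    rw [add_sub_cancel_left, h2] at h3
    rw [div_lt_iff₀ h1] at hT
    have h4 : (T : ℝ) ≤ t := by exact_mod_cast ht
    have h5 : (1 : ℝ) ≤ c := by exact_mod_cast hc
    have h6 : (T : ℝ) ≤ c * t := by nlinarith [Nat.cast_nonneg (α := ℝ) t]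
    nlinarith
  have := Filter.eventually_all.2 (fun φ => Filter.eventually_all.2 (key φ))
  obtain ⟨t, ht⟩ := this.exists
  exact ⟨t * η, ht⟩

lemma cop_primes {a : 𝓞 K} (n : ℕ) (hn : n ≠ 0) (h : ∀ p : ℕ, p.Prime → p ∣ n → IsCoprime a (p : 𝓞 K)) :
    IsCoprime a (n : 𝓞 K) := by
  induction n using Nat.recOnMul with
  | zero => exact absurd rfl hn
  | one => simpa using isCoprime_one_right
  | prime p hp => exact h p hp dvd_rfl
  | mul x y hx hy =>
    push_cast
    have hx0 : x ≠ 0 := left_ne_zero_of_mul hn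
    have hy0 : y ≠ 0 := right_ne_zero_of_mul hn
    exact (hx hx0 (fun p hp hd => h p hp (hd.mul_right _))).mul_right
      (hy hy0 (fun p hp hd => h p hp (hd.mul_left _)))

lemma nice_of {θ : 𝓞 K} {I : ℕ} (hI : ∀ x : 𝓞 K, ∃ P : Polynomial ℤ, (I : 𝓞 K) * x = Polynomial.aeval θ P)
    {y : ℕ} {k : ℤ} (h0 : (y : 𝓞 K) * θ + (k : 𝓞 K) ≠ 0) (hy : IsCoprime ((y : 𝓞 K) * θ + (k : 𝓞 K)) (y : 𝓞 K))
    (hI' : IsCoprime ((y : 𝓞 K) * θ + (k : 𝓞 K)) (I : 𝓞 K)) : Nice ((y : 𝓞 K) * θ + (k : 𝓞 K)) := by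
  refine ⟨h0, fun x => ?_⟩
  set a := (y : 𝓞 K) * θ + k with ha
  have inv : ∀ n : ℕ, IsCoprime a (n : 𝓞 K) → ∃ n' : ℤ, a ∣ (n : 𝓞 K) * n' - 1 := by
    intro n hn
    refine ⟨(n : ℤ) ^ (lam a - 1), ?_⟩
    have h1 := lam_spec hn.symm
    have h2 : (n : 𝓞 K) ^ lam a = (n : 𝓞 K) * (((n : ℤ) ^ (lam a - 1) : ℤ) : 𝓞 K) := by
      push_cast
      rw [← pow_succ', Nat.sub_add_cancel (Nat.one_le_iff_ne_zero.2 (lam_ne_zero h0))]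
    rwa [h2] at h1
  obtain ⟨y', hy'⟩ := inv y hy
  obtain ⟨I', hI'⟩ := inv I hI'
  obtain ⟨P, hP⟩ := hI x
  have h1 : a ∣ θ - ((-k * y' : ℤ) : 𝓞 K) := by
    have : θ - ((-k * y' : ℤ) : 𝓞 K) = a * y' - ((y : 𝓞 K) * y' - 1) * θ := by
      rw [ha]; push_cast; ring
    rw [this]
    exact dvd_sub (dvd_mul_right _ _) (hy'.mul_right _)
  have h2 : a ∣ Polynomial.aeval θ P - ((P.eval (-k * y') : ℤ) : 𝓞 K) := by
    have h3 := Polynomial.sub_dvd_eval_sub θ ((-k * y' : ℤ) : 𝓞 K) (P.map (Int.castRingHom _))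
    rw [Polynomial.eval_intCast_map, Polynomial.eval_map] at h3
    exact h1.trans h3
  refine ⟨I' * P.eval (-k * y'), ?_⟩
  have : x - ((I' * P.eval (-k * y') : ℤ) : 𝓞 K) =
      (Polynomial.aeval θ P - ((P.eval (-k * y') : ℤ) : 𝓞 K)) * I' - ((I : 𝓞 K) * I' - 1) * x := by
    rw [← hP]; push_cast; ring
  rw [this]
  exact dvd_sub (h2.mul_right _) (hI'.mul_right _)

lemma exists_int_mul {c : 𝓞 K} (hc : c ≠ 0) : ∃ n : ℕ, n ≠ 0 ∧ c ∣ (n : 𝓞 K) := by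
  have := finite_quot hc
  refine ⟨Nat.card (𝓞 K ⧸ Ideal.span {c}), Nat.card_ne_zero.2 ⟨inferInstance, this⟩, ?_⟩
  rw [← mk_eq_zero', map_natCast]
  have h : ∀ x : 𝓞 K ⧸ Ideal.span {c}, Nat.card (𝓞 K ⧸ Ideal.span {c}) • x = 0 := fun x =>
    card_nsmul_eq_zero'
  simpa using h 1

theorem exists_nice (hreal : Nonempty (K →+* ℝ)) {a₀ c : 𝓞 K} (hac : IsCoprime a₀ c) (hc : c ≠ 0)
    {Q : ℕ} (hQ : Q ≠ 0) : ∃ a : 𝓞 K, Nice a ∧ c ∣ a - a₀ ∧ Algebra.norm ℤ a < 0 ∧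
      IsCoprime a (Q : 𝓞 K) ∧ IsCoprime a c := by
  obtain ⟨n, hn, hcn⟩ := exists_int_mul hc
  obtain ⟨C, hC⟩ : ∃ C : ℕ, C = Q * n := ⟨_, rfl⟩
  have hC0 : C ≠ 0 := by rw [hC]; exact mul_ne_zero hQ hn
  have hC0' : (C : 𝓞 K) ≠ 0 := by exact_mod_cast hC0
  obtain ⟨t, ht⟩ := exists_coprime hac hC0'
  set a₁ := a₀ + t * c with ha₁
  have hCpos : 0 < C := Nat.pos_of_ne_zero hC0
  obtain ⟨η, hη⟩ := exists_sep a₁ C hCpos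
  set θ := a₁ + C * η with hθ
  have hCr : (0 : ℝ) < C := by exact_mod_cast hCpos
  obtain ⟨r, hr⟩ := norm_neg hreal hCr hη
  obtain ⟨I, hI0, hI⟩ := exists_int_adjoin (θ := θ) (fun φ ψ h => by
    by_contra h'
    have := hη φ ψ h'
    rw [h, sub_self, norm_zero] at this
    linarith)
  -- the integer y
  obtain ⟨g, hg⟩ : ∃ g : ℕ, g = ∏ p ∈ I.primeFactors.filter (fun p => ¬ p ∣ C), p := ⟨_, rfl⟩
  have hgC : Nat.Coprime g C := by
    rw [hg]
    apply Nat.Coprime.prod_left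
    intro p hp
    simp only [Finset.mem_filter, Nat.mem_primeFactors] at hp
    exact (Nat.Prime.coprime_iff_not_dvd hp.1.1).2 hp.2
  have hgpos : 0 < g := by
    rw [hg]; apply Finset.prod_pos
    intro p hp
    simp only [Finset.mem_filter, Nat.mem_primeFactors] at hp
    exact hp.1.1.pos
  obtain ⟨y, hy⟩ : ∃ y : ℕ, y = g ^ C.totient := ⟨_, rfl⟩
  have hypos : 0 < y := by rw [hy]; positivity
  have hyC : (C : ℤ) ∣ y - 1 := by
    have := Nat.ModEq.pow_totient hgC
    rw [← hy] at this
    exact (Nat.modEq_iff_dvd.1 this.symm)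
  have hgy : g ∣ y := by rw [hy]; exact dvd_pow_self _ (Nat.totient_pos.2 hCpos).ne'
  have hcopyC : IsCoprime (y : ℤ) (C : ℤ) := by
    rw [Nat.isCoprime_iff_coprime, hy]; exact hgC.pow_left _
  obtain ⟨u, v, huv⟩ := hcopyC
  -- k ≡ 0 mod C, 1 mod y
  obtain ⟨s, hs, -⟩ := existsUnique_add_zsmul_mem_Ioc hCr (-((v * C : ℤ) : ℝ) / y) r
  obtain ⟨k, hk⟩ : ∃ k : ℤ, k = v * C - s * (C * y) := ⟨_, rfl⟩
  have hyr : (y : ℝ) ≠ 0 := by exact_mod_cast hypos.ne'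
  have hkr : -(k : ℝ) / y ∈ Set.Ioc r (r + C) := by
    convert hs using 1
    rw [hk]; push_cast; rw [zsmul_eq_mul]; field_simp; ring
  have hneg := hr y k hypos hkr
  set a := (y : 𝓞 K) * θ + k with ha
  have ha0 : a ≠ 0 := by
    intro h; rw [h] at hneg; simp at hneg
  have hay : IsCoprime a (y : 𝓞 K) := by
    refine ⟨1, u - θ + s * C, ?_⟩
    have : ((u * y + v * C : ℤ) : 𝓞 K) = 1 := by rw [huv]; simp
    push_cast at this
    rw [ha, hk]; push_cast
    linear_combination this
  have haC : (C : 𝓞 K) ∣ a - a₁ := by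
    obtain ⟨w, hw⟩ := hyC
    have : ((y - 1 : ℤ) : 𝓞 K) = ((C * w : ℤ) : 𝓞 K) := by rw [hw]
    push_cast at this
    refine ⟨w * θ + η + v - s * y, ?_⟩
    rw [ha, hk]; push_cast
    linear_combination θ * this + hθ
  have haC' : IsCoprime a (C : 𝓞 K) := by
    obtain ⟨w, hw⟩ := haC
    have : a = a₁ + w * C := by linear_combination hw
    rw [this]
    exact IsCoprime.add_mul_right_left ht w
  have haI : IsCoprime a (I : 𝓞 K) := by
    apply cop_primes I hI0
    intro p hp hpI
    by_cases hpC : p ∣ C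
    · exact haC'.of_isCoprime_of_dvd_right (by exact_mod_cast Nat.cast_dvd_cast hpC)
    · have : p ∣ g := by
        rw [hg]
        exact Finset.dvd_prod_of_mem (fun p => p)
          (by simp only [Finset.mem_filter, Nat.mem_primeFactors]; exact ⟨⟨hp, hpI, hI0⟩, hpC⟩)
      exact hay.of_isCoprime_of_dvd_right (by exact_mod_cast Nat.cast_dvd_cast (this.trans hgy))
  have hcC : c ∣ (C : 𝓞 K) := by rw [hC]; push_cast; exact hcn.mul_left _
  refine ⟨a, nice_of hI ha0 hay haI, ?_, hneg, ?_, haC'.of_isCoprime_of_dvd_right hcC⟩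
  · have : a - a₀ = (a - a₁) + t * c := by rw [ha₁]; ring
    rw [this]; exact dvd_add (hcC.trans haC) (dvd_mul_left _ _)
  · exact haC'.of_isCoprime_of_dvd_right (by rw [hC]; push_cast; exact dvd_mul_right _ _)

end A5
end Vas

open NumberField

namespace Vas

section arith

/-- `∏_{f=1}^d (x^f-1)` -/
def PI (d : ℕ) (x : ℤ) : ℤ := ∏ f ∈ Finset.Icc 1 d, (x ^ f - 1)

lemma PI_cong {d : ℕ} {x y m : ℤ} (h : m ∣ x - y) : m ∣ PI d x - PI d y := by
  rw [← Int.modEq_iff_dvd] at h ⊢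
  unfold PI
  exact Int.ModEq.prod (fun i _ => Int.ModEq.sub_right _ (h.pow _))

lemma PI_inv {d : ℕ} {x y m : ℤ} (h : m ∣ x * y - 1) : ∃ w : ℤ, ∃ w' : ℤ, m ∣ w * w' - 1 ∧ m ∣ PI d y - w * PI d x := by
  induction d with
  | zero => exact ⟨1, 1, by simp, by simp [PI]⟩
  | succ d ih =>
    obtain ⟨w, w', h1, h2⟩ := ih
    have e : ∀ z, PI (d + 1) z = PI d z * (z ^ (d + 1) - 1) := by
      intro z; unfold PI; rw [Finset.prod_Icc_succ_top (by omega)]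
    have h3 : m ∣ (x * y) ^ (d + 1) - 1 := h.trans (by simpa using sub_dvd_pow_sub_pow (x * y) 1 (d+1))
    refine ⟨-w * y ^ (d + 1), -w' * x ^ (d + 1), ?_, ?_⟩
    · have : -w * y ^ (d + 1) * (-w' * x ^ (d + 1)) - 1 = (w * w' - 1) * (x * y) ^ (d + 1) + ((x * y) ^ (d + 1) - 1) := by
        rw [mul_pow]; ring
      rw [this]; exact dvd_add (h1.mul_right _) h3
    · rw [e, e]
      have : PI d y * (y ^ (d + 1) - 1) - -w * y ^ (d + 1) * (PI d x * (x ^ (d + 1) - 1)) =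
        (PI d y - w * PI d x) * (y ^ (d + 1) - 1) + w * PI d x * ((x * y) ^ (d + 1) - 1) := by
        rw [mul_pow]; ring
      rw [this]; exact dvd_add (h2.mul_right _) (h3.mul_left _)

/-- The constant `C₀`. -/
def C0 (d : ℕ) : ℤ := PI d 2 * PI d 3

lemma PI_pos {d : ℕ} {x : ℤ} (hx : 2 ≤ x) : 0 < PI d x := by
  unfold PI
  apply Finset.prod_pos
  intro i hi
  have : 1 < x ^ i := one_lt_pow₀ (by omega) (by simp at hi; omega)
  omega

lemma C0_pos (d : ℕ) : 0 < C0 d := mul_pos (PI_pos (by norm_num)) (PI_pos (by norm_num))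

lemma crt_int {m n : ℤ} (h : IsCoprime m n) (x y : ℤ) : ∃ z, m ∣ z - x ∧ n ∣ z - y := by
  obtain ⟨u, v, e⟩ := h
  refine ⟨y * (u * m) + x * (v * n), ⟨(y - x) * u, ?_⟩, ⟨(x - y) * v, ?_⟩⟩
  · linear_combination x * e
  · linear_combination y * e

lemma isCoprime_of_dvd_sub {x y m : ℤ} (h : m ∣ x - y) (hy : IsCoprime y m) : IsCoprime x m := by
  obtain ⟨w, hw⟩ := h
  have : x = y + w * m := by linear_combination hw
  rw [this]; exact IsCoprime.add_mul_right_left hy w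

lemma exists_r (d : ℕ) {Q : ℤ} (hQ : 0 < Q) : ∃ r : ℤ, IsCoprime r Q ∧ ∀ g : ℤ, g ∣ Q → ∀ i : ℕ,
    g ∣ PI d r ^ i → g ∣ C0 d ^ i := by
  obtain ⟨Q', hQ', hQe⟩ := (Int.finiteMultiplicity_iff.2
    (show (2 : ℤ).natAbs ≠ 1 ∧ Q ≠ 0 from ⟨by norm_num, hQ.ne'⟩)).exists_eq_pow_mul_and_not_dvd
  generalize multiplicity 2 Q = e at hQ'
  have h2 : IsCoprime (2 : ℤ) Q' := by
    exact (Int.prime_two.coprime_iff_not_dvd).2 hQe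
  obtain ⟨r, h3, h4⟩ := crt_int (h2.pow_left (m := e)) 3 2
  refine ⟨r, ?_, ?_⟩
  · rw [hQ']
    refine (isCoprime_of_dvd_sub h3 ?_).mul_right (isCoprime_of_dvd_sub h4 h2)
    exact IsCoprime.pow_right ⟨1, -1, by norm_num⟩
  · intro g hg i hi
    rw [hQ'] at hg
    obtain ⟨g2, g', hg2, hg', rfl⟩ := exists_dvd_and_dvd_of_dvd_mul hg
    unfold C0
    rw [mul_pow, mul_comm (PI d 2 ^ i)]
    apply mul_dvd_mul
    · have : g2 ∣ PI d r ^ i - PI d 3 ^ i := (hg2.trans (PI_cong h3)).trans (sub_dvd_pow_sub_pow _ _ _)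
      exact (dvd_sub_right ((dvd_mul_right _ _).trans hi)).1 this
    · have : g' ∣ PI d r ^ i - PI d 2 ^ i := (hg'.trans (PI_cong h4)).trans (sub_dvd_pow_sub_pow _ _ _)
      exact (dvd_sub_right ((dvd_mul_left _ _).trans hi)).1 this

lemma dirichlet1 {Q : ℤ} (hQ : Q ≠ 0) {x : ℤ} (hx : IsCoprime x Q) (B : ℕ) :
    ∃ p : ℕ, p.Prime ∧ B < p ∧ Q ∣ p - x := by
  have hq : Q.natAbs ≠ 0 := by simpa using hQ
  have hpos : 0 < (Q.natAbs : ℤ) := by omega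
  have hx0 := Int.emod_nonneg x hpos.ne'
  have hcop : Nat.Coprime (x % Q.natAbs).toNat Q.natAbs := by
    rw [← Nat.isCoprime_iff_coprime, Int.toNat_of_nonneg hx0]
    have : IsCoprime x (Q.natAbs : ℤ) := by
      rw [Int.isCoprime_iff_gcd_eq_one] at hx ⊢
      rw [Int.gcd, Int.natAbs_natCast]; exact hx
    exact isCoprime_of_dvd_sub ⟨-(x / Q.natAbs), by have := Int.emod_add_mul_ediv x Q.natAbs; linear_combination this⟩ this
  obtain ⟨p, hp1, hp2, hp3⟩ := Nat.forall_exists_prime_gt_and_modEq B hq hcop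
  refine ⟨p, hp2, hp1, ?_⟩
  rw [← Int.natAbs_dvd]
  have := (Nat.modEq_iff_dvd.1 hp3.symm)
  rw [Int.toNat_of_nonneg hx0] at this
  have h2 : (p : ℤ) - x = (p - x % Q.natAbs) + (x % Q.natAbs - x) := by ring
  rw [h2]
  refine dvd_add this ⟨-(x / Q.natAbs), by have := Int.emod_add_mul_ediv x Q.natAbs; linear_combination this⟩

lemma dirichlet2 {Q N : ℤ} (hQ : Q ≠ 0) (hN : N ≠ 0) (hQN : IsCoprime Q N) {x y : ℤ}
    (hx : IsCoprime x Q) (hy : IsCoprime y N) (B : ℕ) :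
    ∃ p : ℕ, p.Prime ∧ B < p ∧ Q ∣ p - x ∧ N ∣ p - y := by
  obtain ⟨z, h1, h2⟩ := crt_int hQN x y
  obtain ⟨p, hp, hB, hd⟩ := dirichlet1 (mul_ne_zero hQ hN)
    ((isCoprime_of_dvd_sub h1 hx).mul_right (isCoprime_of_dvd_sub h2 hy)) B
  refine ⟨p, hp, hB, ?_, ?_⟩
  · have : (p : ℤ) - x = (p - z) + (z - x) := by ring
    rw [this]; exact dvd_add ((dvd_mul_right _ _).trans hd) h1
  · have : (p : ℤ) - y = (p - z) + (z - y) := by ring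
    rw [this]; exact dvd_add ((dvd_mul_left _ _).trans hd) h2

end arith

section A6
variable {K : Type*} [Field K] [NumberField K]

lemma exists_N {s : 𝓞 K} (hs : s ≠ 0) : ∃ N : ℕ, N ≠ 0 ∧ ∀ x : ℤ, s ∣ (x : 𝓞 K) ↔ (N : ℤ) ∣ x := by
  let I : Ideal ℤ := (Ideal.span {s}).comap (Int.castRingHom (𝓞 K))
  have hI : ∀ x : ℤ, x ∈ I ↔ s ∣ (x : 𝓞 K) := by
    intro x; simp [I, Ideal.mem_comap, Ideal.mem_span_singleton]
  obtain ⟨n, hn, hsn⟩ := exists_int_mul hs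
  let g := Submodule.IsPrincipal.generator I
  have hg : ∀ x : ℤ, x ∈ I ↔ g ∣ x := fun x => Submodule.IsPrincipal.mem_iff_generator_dvd I
  refine ⟨g.natAbs, ?_, fun x => ?_⟩
  · intro h
    have h1 : g ∣ (n : ℤ) := (hg _).1 ((hI _).2 (by simpa using hsn))
    rw [Int.natAbs_eq_zero.1 h, zero_dvd_iff] at h1
    exact hn (by exact_mod_cast h1)
  · rw [← hI, hg, Int.natAbs_dvd]

lemma N_coprime {s : 𝓞 K} {N : ℕ} (h : ∀ x : ℤ, s ∣ (x : 𝓞 K) ↔ (N : ℤ) ∣ x) (hs : s ≠ 0) {m : ℤ}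
    (hm : IsCoprime (m : 𝓞 K) s) : IsCoprime m N := by
  have h1 := lam_spec hm
  have h2 : (N : ℤ) ∣ m ^ lam s - 1 := by rw [← h]; push_cast; exact h1
  have h3 : IsCoprime (m ^ lam s) N := isCoprime_of_dvd_sub h2 isCoprime_one_left
  exact IsCoprime.of_isCoprime_of_dvd_left h3 (dvd_pow_self _ (lam_ne_zero hs))

lemma upow {p : ℕ} (hp : p.Prime) {u : 𝓞 K} (hu : IsCoprime u (p : 𝓞 K)) :
    ∃ j : ℕ, (p : 𝓞 K) ∣ u ^ ((PI (Module.finrank ℚ K) p).toNat * p ^ j) - 1 := by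
  have hp0 : (p : 𝓞 K) ≠ 0 := by exact_mod_cast hp.ne_zero
  set P := (PI (Module.finrank ℚ K) p).toNat with hP
  have hPP : (P : ℤ) = PI (Module.finrank ℚ K) p :=
    Int.toNat_of_nonneg (PI_pos (by exact_mod_cast hp.two_le)).le
  have hrad : u ^ P - 1 ∈ (Ideal.span {(p : 𝓞 K)}).radical := by
    rw [Ideal.radical_eq_sInf, Ideal.mem_sInf]
    rintro J ⟨hJ, hJp⟩
    have hpJ : (p : 𝓞 K) ∈ J := hJ (Ideal.mem_span_singleton_self _)
    have hJ0 : J ≠ ⊥ := by rintro rfl; exact hp0 (by simpa using hpJ)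
    have hmax := hJp.isMaximal hJ0
    have hcard : Nat.card (𝓞 K ⧸ J) ∣ p ^ Module.finrank ℚ K := by
      have h1 := Ideal.absNorm_dvd_absNorm_of_le hJ
      rw [Ideal.absNorm_span_singleton] at h1
      have h2 : Algebra.norm ℤ (p : 𝓞 K) = (p : ℤ) ^ Module.finrank ℚ K := by
        have := Algebra.norm_algebraMap (R := ℤ) (S := 𝓞 K) (p : ℤ)
        rw [RingOfIntegers.rank] at this
        simpa using this
      rw [h2, Int.natAbs_pow, Int.natAbs_natCast] at h1
      exact h1
    obtain ⟨f, hf, hcf⟩ := (Nat.dvd_prime_pow hp).1 hcard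
    have hfin : Finite (𝓞 K ⧸ J) := Ring.HasFiniteQuotients.finiteQuotient hJ0
    have hf1 : 1 ≤ f := by
      by_contra h
      have h0 : f = 0 := by omega
      rw [h0, pow_zero] at hcf
      have := Finite.one_lt_card (α := 𝓞 K ⧸ J)
      omega
    have hdvd : p ^ f - 1 ∣ P := by
      have h1 : ((p : ℤ) ^ f - 1) ∣ PI (Module.finrank ℚ K) p :=
        Finset.dvd_prod_of_mem (fun f => (p : ℤ) ^ f - 1) (Finset.mem_Icc.2 ⟨hf1, hf⟩)
      rw [← hPP] at h1
      have h2 : ((p ^ f - 1 : ℕ) : ℤ) = (p : ℤ) ^ f - 1 := by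
        rw [Nat.cast_sub (Nat.one_le_pow _ _ hp.pos)]; push_cast; ring
      rw [← h2] at h1
      exact_mod_cast h1
    rw [← Ideal.Quotient.eq_zero_iff_mem, map_sub, map_pow, map_one, sub_eq_zero]
    letI := Ideal.Quotient.field J
    letI := Fintype.ofFinite (𝓞 K ⧸ J)
    have hu0 : Ideal.Quotient.mk J u ≠ 0 := by
      rw [Ne, Ideal.Quotient.eq_zero_iff_mem]
      exact cop_not_mem hu hJp hpJ
    obtain ⟨q, hq⟩ := hdvd
    rw [hq, pow_mul, ← hcf, Nat.card_eq_fintype_card, FiniteField.pow_card_sub_one_eq_one _ hu0, one_pow]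
  obtain ⟨m, hm⟩ := hrad
  refine ⟨m, ?_⟩
  rw [Ideal.mem_span_singleton] at hm
  have hm2 : (p : 𝓞 K) ∣ (u ^ P - 1) ^ (p ^ m) :=
    hm.trans (pow_dvd_pow _ (Nat.lt_pow_self hp.one_lt).le)
  have := Fact.mk hp
  have hchar : CharP (𝓞 K ⧸ Ideal.span {(p : 𝓞 K)}) p := by
    have hnt : Nontrivial (𝓞 K ⧸ Ideal.span {(p : 𝓞 K)}) := by
      rw [Ideal.Quotient.nontrivial_iff, Ne, Ideal.span_singleton_eq_top]
      intro hunit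
      have h1 := Int.isUnit_iff.1 ((hunit.map (Algebra.norm ℤ)))
      have h2 : Algebra.norm ℤ (p : 𝓞 K) = (p : ℤ) ^ Module.finrank ℚ K := by
        have := Algebra.norm_algebraMap (R := ℤ) (S := 𝓞 K) (p : ℤ)
        rw [RingOfIntegers.rank] at this
        simpa using this
      rw [h2] at h1
      have h3 : (1 : ℤ) < (p : ℤ) ^ Module.finrank ℚ K :=
        one_lt_pow₀ (by exact_mod_cast hp.one_lt) (Module.finrank_pos).ne'
      omega
    have h0 : ((p : ℕ) : 𝓞 K ⧸ Ideal.span {(p : 𝓞 K)}) = 0 := by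
      rw [← map_natCast (Ideal.Quotient.mk _), mk_eq_zero']
    have h1 := CharP.ringChar_of_prime_eq_zero hp h0
    exact ringChar.of_eq h1
  rw [← mk_eq_zero'] at hm2 ⊢
  rw [map_pow, map_sub, map_one, sub_pow_char_pow, one_pow] at hm2
  rw [pow_mul, map_sub, map_pow, map_one, hm2]

/-- torus conjugation preserves `EE` -/
lemma HH_EE {k m : 𝓞 K} (v : (𝓞 K)ˣ) {e : SL K} (he : e ∈ EE k m) :
    HH (uK v) * e * (HH (uK v))⁻¹ ∈ EE k m := by
  refine EE_conj _ ?_ ?_ he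
  · intro x hx
    rw [HH_conj_UU]
    exact UU_mem (inI.mull (by rw [uK_coe, pow_two]; exact (inI_coe _).mulr (inI_coe _)) hx)
  · intro x hx
    rw [HH_conj_LL]
    exact LL_mem (inI.mull (by rw [uK_coe, uK_inv_coe, pow_two]; exact (inI_coe _).mulr (inI_coe _)) hx)

lemma HH_EE' {k m : 𝓞 K} (v : (𝓞 K)ˣ) {e : SL K} (he : e ∈ EE k m) :
    (HH (uK v))⁻¹ * e * (HH (uK v)) ∈ EE k m := by
  have := HH_EE v⁻¹ he
  rw [uK_inv, HH_inv, inv_inv] at this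
  exact this

/-- the subgroup `T_γ` of units -/
def TT (μ : 𝓞 K) (γ : SL K) : Subgroup (𝓞 K)ˣ where
  carrier := {v | HH (uK v) * γ * (HH (uK v))⁻¹ * γ⁻¹ ∈ EE 1 μ}
  one_mem' := by
    have : uK (1 : (𝓞 K)ˣ) = 1 := by simp [uK]
    simp [this, HH_one]
  mul_mem' := by
    intro v w hv hw
    have hv' : HH (uK v) * γ * (HH (uK v))⁻¹ * γ⁻¹ ∈ EE 1 μ := hv
    have hw' : HH (uK w) * γ * (HH (uK w))⁻¹ * γ⁻¹ ∈ EE 1 μ := hw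
    have := mul_mem (HH_EE v hw') hv'
    simp only [Set.mem_setOf_eq]
    rw [uK_mul, HH_mul]
    convert this using 1
    group
  inv_mem' := by
    intro v hv
    have hv' : HH (uK v) * γ * (HH (uK v))⁻¹ * γ⁻¹ ∈ EE 1 μ := hv
    have := HH_EE' v (inv_mem hv')
    simp only [Set.mem_setOf_eq]
    rw [uK_inv, HH_inv]
    convert this using 1
    group

lemma mem_TT {μ : 𝓞 K} {γ : SL K} {v : (𝓞 K)ˣ} :
    v ∈ TT μ γ ↔ HH (uK v) * γ * (HH (uK v))⁻¹ * γ⁻¹ ∈ EE 1 μ := Iff.rfl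

lemma TT_coset {μ : 𝓞 K} {γ e : SL K} (he : e ∈ EE 1 μ) {v : (𝓞 K)ˣ} (hv : v ∈ TT μ (e * γ)) :
    v ∈ TT μ γ := by
  rw [mem_TT] at hv ⊢
  have := mul_mem (mul_mem (HH_EE v (inv_mem he)) hv) he
  convert this using 1
  group

lemma T_step {μ n : 𝓞 K} {γ : SL K} {a b c : 𝓞 K} (ha : γ.1 0 0 = a) (hb : γ.1 0 1 = b)
    (hc : γ.1 1 0 = c) (hμ : μ ∣ c) (hn : n ∣ b) (ha0 : a ≠ 0) {v : (𝓞 K)ˣ}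
    (hv : a ∣ (v : 𝓞 K) - 1) (hγ : ∀ x, inI n x → γ * UU x * γ⁻¹ ∈ EE 1 μ) : v ∈ TT μ γ := by
  rw [mem_TT]
  have ha0' : (a : K) ≠ 0 := by exact_mod_cast ha0
  obtain ⟨z, hz⟩ := hv
  have hWi : ((v : 𝓞 K) : K) * (((v⁻¹ : (𝓞 K)ˣ) : 𝓞 K) : K) = 1 := by
    rw [← uK_inv_coe]; exact mul_inv_cancel₀ (by rw [← uK_coe]; exact Units.ne_zero _)
  have hz' : ((v : 𝓞 K) : K) - 1 = a * z := by exact_mod_cast congrArg (algebraMap (𝓞 K) K) hz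
  have hV : ((uK v : Kˣ) : K)⁻¹ = ((v⁻¹ : (𝓞 K)ˣ) : 𝓞 K) := by rw [uK_coe, uK_inv_coe]
  have h00 := HH_conj00 (uK v) γ
  have h01 := HH_conj01 (uK v) γ
  have h10 := HH_conj10 (uK v) γ
  have h11 := HH_conj11 (uK v) γ
  rw [hV] at h10
  rw [uK_coe] at h01
  obtain ⟨w, hw⟩ : ∃ w : 𝓞 K, w = ((v⁻¹ : (𝓞 K)ˣ) : 𝓞 K) := ⟨_, rfl⟩
  obtain ⟨V, hVV⟩ : ∃ V : 𝓞 K, V = (v : 𝓞 K) := ⟨_, rfl⟩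
  rw [← hw] at hWi h10
  rw [← hVV] at hWi hz' h01
  generalize HH (uK v) * γ * (HH (uK v))⁻¹ = H at *
  have hdet := det4 γ
  have hdet' := det4 H
  obtain ⟨X, hX⟩ : ∃ X : K, X = -((c : K) * z * (V + 1) * w ^ 2) := ⟨_, rfl⟩
  obtain ⟨Y, hY⟩ : ∃ Y : K, Y = (b : K) * z * (V + 1) := ⟨_, rfl⟩
  have e00 : H.1 0 0 = (LL X * γ * UU Y).1 0 0 := by
    simp only [mul00, mul01, mul10, mul11, UU00, UU01, UU10, UU11, LL00, LL01, LL10, LL11, h00]; ring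
  have e01 : H.1 0 1 = (LL X * γ * UU Y).1 0 1 := by
    simp only [mul00, mul01, mul10, mul11, UU00, UU01, UU10, UU11, LL00, LL01, LL10, LL11, h01, ha, hb]
    rw [hY]
    linear_combination ((b : K) * (V + 1)) * hz'
  have e10 : H.1 1 0 = (LL X * γ * UU Y).1 1 0 := by
    simp only [mul00, mul01, mul10, mul11, UU00, UU01, UU10, UU11, LL00, LL01, LL10, LL11, h10, ha, hc]
    rw [hX]
    linear_combination (-(c : K) * w ^ 2 * (V + 1)) * hz' + ((c : K) * (V * w + 1)) * hWi
  have e : H = LL X * γ * UU Y := by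
    have hd2 := det4 (LL X * γ * UU Y)
    refine ext4 e00 e01 e10 ?_
    rw [← e00, ← e01, ← e10] at hd2
    rw [h00, ha] at hd2 hdet'
    exact mul_left_cancel₀ ha0' (by linear_combination hdet' - hd2)
  rw [e]
  have : LL X * γ * UU Y * γ⁻¹ = LL X * (γ * UU Y * γ⁻¹) := by group
  rw [this]
  refine mul_mem (LL_mem ?_) (hγ _ ?_)
  · have : X = ((-(c * z * (V + 1) * w ^ 2) : 𝓞 K) : K) := by rw [hX]; push_cast; ring
    rw [this, inI_coe_iff, dvd_neg, mul_assoc, mul_assoc]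
    exact hμ.mul_right _
  · have : Y = ((b * z * (V + 1) : 𝓞 K) : K) := by rw [hY]; push_cast; ring
    rw [this, inI_coe_iff, mul_assoc]
    exact hn.mul_right _

lemma isCoprime_of_unit (u : (𝓞 K)ˣ) (a : 𝓞 K) : IsCoprime (u : 𝓞 K) a :=
  ⟨((u⁻¹ : (𝓞 K)ˣ) : 𝓞 K), 0, by simp⟩

lemma sub_one_dvd_pow_sub_one (x : 𝓞 K) (n : ℕ) : x - 1 ∣ x ^ n - 1 := by
  simpa using sub_dvd_pow_sub_pow x 1 n

lemma pow_of_gcd {G : Type*} [Group G] (H : Subgroup G) {x : G} {a b c : ℕ} (h : Nat.gcd a b ∣ c)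
    (ha : x ^ a ∈ H) (hb : x ^ b ∈ H) : x ^ c ∈ H := by
  obtain ⟨k, rfl⟩ := h
  rw [pow_mul]
  apply H.pow_mem
  rw [← zpow_natCast, Nat.gcd_eq_gcd_ab, zpow_add, zpow_mul, zpow_mul, zpow_natCast, zpow_natCast]
  exact H.mul_mem (H.zpow_mem ha _) (H.zpow_mem hb _)

lemma gcd_final {d : ℕ} {Q r r' p q g : ℤ} (hr : ∀ g : ℤ, g ∣ Q → ∀ i : ℕ, g ∣ PI d r ^ i → g ∣ C0 d ^ i)
    (hrr : Q ∣ r * r' - 1) (hp : Q ∣ p - r) (hq : Q ∣ q - r') (hgQ : g ∣ Q)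
    {i j : ℕ} (hg : g ∣ PI d p * p ^ i * (PI d q * q ^ j)) : g ∣ C0 d ^ 2 := by
  have h1 : IsCoprime r Q := by
    obtain ⟨z, hz⟩ := hrr
    exact ⟨r', -z, by linear_combination hz⟩
  have h2 : IsCoprime r' Q := by
    obtain ⟨z, hz⟩ := hrr
    exact ⟨r, -z, by linear_combination hz⟩
  have cp : IsCoprime g p := (IsCoprime.of_isCoprime_of_dvd_right (isCoprime_of_dvd_sub hp h1) hgQ).symm
  have cq : IsCoprime g q := (IsCoprime.of_isCoprime_of_dvd_right (isCoprime_of_dvd_sub hq h2) hgQ).symm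
  have h3 : g ∣ PI d p * PI d q := by
    have : PI d p * p ^ i * (PI d q * q ^ j) = (PI d p * PI d q) * (p ^ i * q ^ j) := by ring
    rw [this] at hg
    exact (IsCoprime.mul_right cp.pow_right cq.pow_right).dvd_of_dvd_mul_right hg
  obtain ⟨w, w', e1, e2⟩ := PI_inv (d := d) hrr
  have a1 := (hgQ.trans (PI_cong (d := d) hp))
  have a2 := (hgQ.trans (PI_cong (d := d) hq))
  have a3 := hgQ.trans e1
  have a4 := hgQ.trans e2
  apply hr g hgQ
  obtain ⟨x1, x1e⟩ := a1
  obtain ⟨x2, x2e⟩ := a2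
  obtain ⟨x3, x3e⟩ := a3
  obtain ⟨x4, x4e⟩ := a4
  obtain ⟨x5, x5e⟩ := h3
  have y1 : PI d r = PI d p - g * x1 := by linear_combination -x1e
  have y2 : w * PI d r = PI d q - g * x2 - g * x4 := by linear_combination -x2e-x4e
  have y3 : PI d r ^ 2 * (w * w') = PI d r * (w * PI d r) * w' := by ring
  have y4 : g ∣ PI d r ^ 2 * (w * w') := by
    rw [y3, y2, y1]
    refine ⟨(x5 - x1 * PI d q - (PI d p - g * x1) * (x2 + x4)) * w', ?_⟩
    linear_combination w' * x5e
  have y5 : PI d r ^ 2 = PI d r ^ 2 * (w * w') - g * (PI d r ^ 2 * x3) := by linear_combination (-PI d r ^ 2) * x3e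
  rw [y5]
  exact dvd_sub y4 (dvd_mul_right _ _)

theorem T (hdeg : 1 < Module.finrank ℚ K) (hreal : Nonempty (K →+* ℝ)) {μ : 𝓞 K} (hμ : μ ≠ 0)
    {γ : SL K} (hγ : γ ∈ GG μ) (u : (𝓞 K)ˣ) :
    u ^ (C0 (Module.finrank ℚ K) ^ 2).toNat ∈ TT μ γ := by
  set dd := Module.finrank ℚ K with hdd
  obtain ⟨n', hn'0, hn'⟩ := cont hreal hdeg γ hμ
  obtain ⟨n, hn0, hndvd⟩ := exists_int_mul (c := 2 * μ * n') (mul_ne_zero (mul_ne_zero two_ne_zero hμ) hn'0)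
  have hn0' : (n : 𝓞 K) ≠ 0 := by exact_mod_cast hn0
  have hμn : μ ∣ (n : 𝓞 K) := ((dvd_mul_left μ 2).mul_right n').trans hndvd
  have hn'n : n' ∣ (n : 𝓞 K) := (dvd_mul_left _ _).trans hndvd
  have h2n : (2 : 𝓞 K) ∣ (n : 𝓞 K) := ((dvd_mul_right 2 μ).mul_right n').trans hndvd
  have key : ∀ e ∈ EE 1 μ, ∀ x, inI (n : 𝓞 K) x → (e * γ) * UU x * (e * γ)⁻¹ ∈ EE 1 μ := by
    intro e he x hx
    have h1 : γ * UU x * γ⁻¹ ∈ EE 1 μ :=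
      EE_mono (one_dvd _) dvd_rfl (hn' _ (UU_mem (hx.mono hn'n)))
    have := mul_mem (mul_mem he h1) (inv_mem he)
    convert this using 1
    group
  obtain ⟨e₁, he₁, hP⟩ := approx (μ := μ) (ν := (n : 𝓞 K) ^ 3) (pow_ne_zero _ hn0')
    (hμn.trans (dvd_pow_self _ (by norm_num))) hγ
  have hG : e₁ * γ ∈ GG ((n : 𝓞 K) ^ 3) := hP.memGG dvd_rfl
  obtain ⟨a₁, b₁, c₁, d₁, ha, hb, hc, hd, hna, hnc, hnd, hdet⟩ := GG_lift hG
  have hnb : (n : 𝓞 K) ^ 3 ∣ b₁ := by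
    have := hP.2.1; rw [hb, inI_coe_iff] at this; exact this
  have ha0 : a₁ ≠ 0 := by
    rintro rfl
    have h1 : (n : 𝓞 K) ∣ 1 := by
      have := (dvd_pow_self (n : 𝓞 K) (by norm_num : (3 : ℕ) ≠ 0)).trans hna
      rwa [zero_sub, dvd_neg] at this
    have h2 : ((2 : ℤ) : 𝓞 K) ∣ ((1 : ℤ) : 𝓞 K) := by push_cast; exact h2n.trans h1
    obtain ⟨N2, hN20, hN2⟩ := exists_N (K := K) (s := 2) two_ne_zero
    have h3 : IsCoprime (2 : ℤ) (1 : ℤ) := isCoprime_one_right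
    have : Algebra.norm ℤ (2 : 𝓞 K) ∣ 1 := by
      obtain ⟨z, hz⟩ := h2n.trans h1
      exact ⟨Algebra.norm ℤ z, by rw [← map_mul, ← hz, map_one]⟩
    have e : Algebra.norm ℤ (2 : 𝓞 K) = 2 ^ dd := by
      have := Algebra.norm_algebraMap (R := ℤ) (S := 𝓞 K) 2
      rw [RingOfIntegers.rank] at this
      simpa using this
    rw [e] at this
    have h4 : (2 : ℤ) ∣ 1 := (dvd_pow_self 2 (by omega)).trans this
    norm_num at h4
  -- first exponent
  have hu1 : u ^ lam a₁ ∈ TT μ γ := by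
    apply TT_coset he₁
    refine T_step ha hb hc ?_ ?_ ha0 ?_ (key e₁ he₁)
    · exact (hμn.trans (dvd_pow_self _ (by norm_num))).trans hnc
    · exact (dvd_pow_self _ (by norm_num)).trans hnb
    · rw [Units.val_pow_eq_pow_val]
      exact lam_spec (isCoprime_of_unit u a₁)
  -- second representative
  obtain ⟨c₂, hc₂⟩ : (n : 𝓞 K) ^ 2 ∣ c₁ := (pow_dvd_pow _ (by norm_num)).trans hnc
  have hl0 : lam a₁ ≠ 0 := lam_ne_zero ha0
  have hcop : IsCoprime c₂ a₁ := ⟨-b₁ * n ^ 2, d₁, by rw [hc₂] at hdet; linear_combination hdet⟩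
  obtain ⟨s, hs, hsd, -, hsQ, hsa⟩ := exists_nice hreal hcop ha0 (Q := lam a₁ * n ^ 3) (mul_ne_zero hl0 (pow_ne_zero _ hn0))
  obtain ⟨s₁, hs₁⟩ := hsd
  obtain ⟨N, hN0, hN⟩ := exists_N hs.1
  obtain ⟨m, hm⟩ := hs.2 a₁
  set Q : ℤ := lam a₁ * n ^ 3 with hQ
  have hQ0 : 0 < Q := by positivity
  have hQs : IsCoprime (Q : 𝓞 K) s := by
    have : (Q : 𝓞 K) = ((lam a₁ * n ^ 3 : ℕ) : 𝓞 K) := by rw [hQ]; push_cast; ring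
    rw [this]; exact hsQ.symm
  have hQN : IsCoprime Q N := N_coprime hN hs.1 hQs
  have hmN : IsCoprime m N := by
    refine N_coprime hN hs.1 ?_
    obtain ⟨z, hz⟩ := hm
    have : (m : 𝓞 K) = a₁ + (-z) * s := by linear_combination -hz
    rw [this]
    exact IsCoprime.add_mul_right_left hsa.symm _
  obtain ⟨r, hrQ, hr⟩ := exists_r dd hQ0
  obtain ⟨r', z, hz⟩ := id hrQ
  have hrr : Q ∣ r * r' - 1 := ⟨-z, by linear_combination hz⟩
  have hr'Q : IsCoprime r' Q := ⟨r, z, by linear_combination hz⟩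
  have hN0' : (N : ℤ) ≠ 0 := by exact_mod_cast hN0
  obtain ⟨p, hp, -, hpQ, hpN⟩ := dirichlet2 hQ0.ne' hN0' hQN hrQ isCoprime_one_left 0
  obtain ⟨q, hq, hqp, hqQ, hqN⟩ := dirichlet2 hQ0.ne' hN0' hQN hr'Q hmN p
  have hnQ : (n : 𝓞 K) ^ 3 ∣ (Q : 𝓞 K) := by rw [hQ]; push_cast; exact dvd_mul_left _ _
  have e1 : (n : 𝓞 K) ^ 3 ∣ (p * q : 𝓞 K) - a₁ := by
    have h1 : Q ∣ (p * q : ℤ) - 1 := by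
      obtain ⟨x, hx⟩ := hpQ
      obtain ⟨y, hy⟩ := hqQ
      obtain ⟨w, hw⟩ := hrr
      exact ⟨x * q + r * y + w, by linear_combination (q : ℤ) * hx + r * hy + hw⟩
    have h2 : (Q : 𝓞 K) ∣ (p * q : 𝓞 K) - 1 := by
      have := map_dvd (Int.castRingHom (𝓞 K)) h1
      simpa using this
    have := dvd_sub (hnQ.trans h2) hna
    simpa using this
  have e2 : s ∣ (p * q : 𝓞 K) - a₁ := by
    have h1 : (N : ℤ) ∣ (p * q : ℤ) - m := by
      obtain ⟨x, hx⟩ := hpN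
      obtain ⟨y, hy⟩ := hqN
      exact ⟨x * q + y, by linear_combination (q : ℤ) * hx + hy⟩
    rw [← hN] at h1
    push_cast at h1
    have := dvd_sub h1 hm
    convert this using 1
    ring
  have hns : IsCoprime ((n : 𝓞 K) ^ 3) s := hQs.of_isCoprime_of_dvd_left hnQ
  obtain ⟨t, ht⟩ := hns.mul_dvd e1 e2
  set e₂ : SL K := UU ((n : K) * t) * LL ((n : K) ^ 2 * s₁) * e₁ with he₂
  have he₂m : e₂ ∈ EE 1 μ := by
    refine mul_mem (mul_mem (UU_mem ?_) (LL_mem ?_)) he₁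
    · have : ((n : K) * t) = ((n * t : 𝓞 K) : K) := by push_cast; ring
      rw [this]; exact inI_coe _
    · have : ((n : K) ^ 2 * s₁) = ((n ^ 2 * s₁ : 𝓞 K) : K) := by push_cast; ring
      rw [this, inI_coe_iff]; exact (hμn.trans (dvd_pow_self _ (by norm_num))).mul_right _
  have hs₁' : (s : K) - c₂ = a₁ * s₁ := by exact_mod_cast congrArg (algebraMap (𝓞 K) K) hs₁
  have hc₂' : (c₁ : K) = n ^ 2 * c₂ := by
    have := congrArg (algebraMap (𝓞 K) K) hc₂; rw [map_mul, map_pow, map_natCast] at this; exact this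
  have ht' : (p * q : K) - a₁ = (n : K) ^ 3 * s * t := by
    have := congrArg (algebraMap (𝓞 K) K) ht
    rw [map_sub, map_mul, map_mul, map_mul, map_pow, map_natCast, map_natCast, map_natCast] at this; exact this
  have f00 : (e₂ * γ).1 0 0 = ((p * q : 𝓞 K) : K) := by
    rw [he₂, mul_assoc]
    simp only [mul00, mul01, mul10, mul11, UU00, UU01, UU10, UU11, LL00, LL01, LL10, LL11] at ha hb hc hd ⊢
    rw [ha, hc]
    push_cast
    linear_combination -ht' + (n * t : K) * hc₂' - (n ^ 3 * t : K) * hs₁'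
  have f01 : (e₂ * γ).1 0 1 = ((b₁ + n * t * (d₁ + n ^ 2 * s₁ * b₁) : 𝓞 K) : K) := by
    rw [he₂, mul_assoc]
    simp only [mul00, mul01, mul10, mul11, UU00, UU01, UU10, UU11, LL00, LL01, LL10, LL11] at ha hb hc hd ⊢
    rw [hb, hd]
    push_cast
    ring
  have f10 : (e₂ * γ).1 1 0 = ((n ^ 2 * s : 𝓞 K) : K) := by
    rw [he₂, mul_assoc]
    simp only [mul00, mul01, mul10, mul11, UU00, UU01, UU10, UU11, LL00, LL01, LL10, LL11] at ha hb hc hd ⊢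
    rw [ha, hc]
    push_cast
    linear_combination hc₂' - (n ^ 2 : K) * hs₁'
  obtain ⟨i, hi⟩ := upow (K := K) hp (u := u) (isCoprime_of_unit u _)
  obtain ⟨j, hj⟩ := upow (K := K) hq (u := u) (isCoprime_of_unit u _)
  rw [← hdd] at hi hj
  set A := (PI dd p).toNat * p ^ i with hA
  set B := (PI dd q).toNat * q ^ j with hB
  have hu2 : u ^ (A * B) ∈ TT μ γ := by
    apply TT_coset he₂m
    refine T_step f00 f01 f10 ?_ ?_ ?_ ?_ (key e₂ he₂m)
    · exact (hμn.trans (dvd_pow_self _ (by norm_num))).mul_right _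
    · refine dvd_add ((dvd_pow_self _ (by norm_num)).trans hnb) ?_
      rw [mul_assoc]; exact dvd_mul_right _ _
    · have := hp.ne_zero
      have := hq.ne_zero
      exact_mod_cast mul_ne_zero hp.ne_zero hq.ne_zero
    · rw [Units.val_pow_eq_pow_val]
      have hpq : IsCoprime (p : 𝓞 K) (q : 𝓞 K) := by
        have : Nat.Coprime p q := (Nat.coprime_primes hp hq).2 hqp.ne
        have := (Nat.isCoprime_iff_coprime.2 this).map (Int.castRingHom (𝓞 K))
        simpa using this
      refine hpq.mul_dvd (hi.trans ?_) (hj.trans ?_)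
      · rw [pow_mul _ A B]; exact sub_one_dvd_pow_sub_one _ _
      · rw [mul_comm A B, pow_mul _ B A]; exact sub_one_dvd_pow_sub_one _ _
  refine pow_of_gcd _ ?_ hu1 hu2
  have hPp : 0 < PI dd p := PI_pos (by exact_mod_cast hp.two_le)
  have hPq : 0 < PI dd q := PI_pos (by exact_mod_cast hq.two_le)
  have hfin := gcd_final (g := (Nat.gcd (lam a₁) (A * B) : ℕ)) hr hrr hpQ hqQ ?_ (i := i) (j := j) ?_
  · have h5 : (0 : ℤ) ≤ C0 dd ^ 2 := sq_nonneg _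
    zify
    rw [Int.toNat_of_nonneg h5]
    exact hfin
  · rw [hQ]
    exact (Int.natCast_dvd_natCast.2 (Nat.gcd_dvd_left _ _)).mul_right _
  · have : (PI dd p * p ^ i * (PI dd q * q ^ j) : ℤ) = ((A * B : ℕ) : ℤ) := by
      rw [hA, hB]; push_cast; rw [Int.toNat_of_nonneg hPp.le, Int.toNat_of_nonneg hPq.le]
    rw [this]
    exact Int.natCast_dvd_natCast.2 (Nat.gcd_dvd_right _ _)

end A6
end Vas

open NumberField

namespace Vas
section A7
universe u
variable {K : Type u} [Field K]

/-- conjugation by `diag(t,1)` -/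
def DD (t : Kˣ) : SL K →* SL K := MonoidHom.mk'
  (fun g => mk4 (g.1 0 0) (t * g.1 0 1) ((t : K)⁻¹ * g.1 1 0) (g.1 1 1) (by
    have := det4 g
    have h0 : (t : K) ≠ 0 := t.ne_zero
    field_simp
    linear_combination this)) (by
  intro g h
  have h0 : (t : K) ≠ 0 := t.ne_zero
  apply ext4 <;> simp only [mk4_00, mk4_01, mk4_10, mk4_11, mul00, mul01, mul10, mul11] <;> field_simp)

@[simp] lemma DD00 (t : Kˣ) (g : SL K) : (DD t g).1 0 0 = g.1 0 0 := rfl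
@[simp] lemma DD01 (t : Kˣ) (g : SL K) : (DD t g).1 0 1 = t * g.1 0 1 := rfl
@[simp] lemma DD10 (t : Kˣ) (g : SL K) : (DD t g).1 1 0 = (t : K)⁻¹ * g.1 1 0 := rfl
@[simp] lemma DD11 (t : Kˣ) (g : SL K) : (DD t g).1 1 1 = g.1 1 1 := rfl

lemma DD_UU (t : Kˣ) (x : K) : DD t (UU x) = UU (t * x) := by apply ext4 <;> simp
lemma DD_LL (t : Kˣ) (x : K) : DD t (LL x) = LL ((t : K)⁻¹ * x) := by apply ext4 <;> simp
lemma DD_HH (t : Kˣ) (x : Kˣ) : DD t (HH x) = HH x := by apply ext4 <;> simp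
lemma DD_DD (t : Kˣ) (g : SL K) : DD t (DD t⁻¹ g) = g := by apply ext4 <;> simp

variable [NumberField K]

/-- elements commuting asymptotically with deep congruence subgroups modulo elementary matrices -/
def ZZ (hreal : Nonempty (K →+* ℝ)) (hdeg : 1 < Module.finrank ℚ K) : Subgroup (SL K) where
  carrier := {g | ∀ n : 𝓞 K, n ≠ 0 → ∃ n' : 𝓞 K, n' ≠ 0 ∧ ∀ γ, PP n' γ → g * γ * g⁻¹ * γ⁻¹ ∈ EE n n}
  one_mem' := by
    intro n hn
    exact ⟨n, hn, fun γ _ => by simp⟩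
  mul_mem' := by
    intro g h hg hh n hn
    obtain ⟨n1, h1, H1⟩ := cont hreal hdeg g hn
    obtain ⟨n2, h2, H2⟩ := hh n1 h1
    obtain ⟨n3, h3, H3⟩ := hg n hn
    refine ⟨n2 * n3, mul_ne_zero h2 h3, fun γ hγ => ?_⟩
    have := mul_mem (H1 _ (H2 γ (hγ.mono (dvd_mul_right _ _)))) (H3 γ (hγ.mono (dvd_mul_left _ _)))
    convert this using 1
    group
  inv_mem' := by
    intro g hg n hn
    obtain ⟨n1, h1, H1⟩ := cont hreal hdeg g⁻¹ hn
    obtain ⟨n2, h2, H2⟩ := hg n1 h1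
    refine ⟨n2, h2, fun γ hγ => ?_⟩
    have := H1 _ (inv_mem (H2 γ hγ))
    convert this using 1
    group

lemma ZZ_conj {hreal : Nonempty (K →+* ℝ)} {hdeg : 1 < Module.finrank ℚ K} {g : SL K}
    (hg : g ∈ ZZ hreal hdeg) (k : SL K) : k * g * k⁻¹ ∈ ZZ hreal hdeg := by
  intro n hn
  obtain ⟨n1, h1, H1⟩ := cont hreal hdeg k hn
  obtain ⟨n2, h2, H2⟩ := hg n1 h1
  obtain ⟨n3, h3, H3⟩ := contP k⁻¹ h2
  refine ⟨n3, h3, fun γ hγ => ?_⟩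
  have := H1 _ (H2 _ (H3 γ hγ))
  convert this using 1
  group

lemma DD_EE {n : 𝓞 K} (t : Kˣ) (ht : (t : K) = n) {e : SL K} (he : e ∈ EE 1 (n ^ 2)) :
    DD t e ∈ EE n n := by
  have h0 : (n : K) ≠ 0 := by rw [← ht]; exact t.ne_zero
  have : EE 1 (n ^ 2) ≤ (EE n n).comap (DD t) := by
    refine EE_le ?_ ?_
    · rintro x ⟨y, rfl⟩
      rw [Subgroup.mem_comap, DD_UU, ht]
      exact UU_mem ⟨y, by simp⟩
    · rintro x ⟨y, rfl⟩
      rw [Subgroup.mem_comap, DD_LL, ht]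
      exact LL_mem ⟨y, by push_cast; field_simp⟩
  exact this he

lemma ZZ_HH (hreal : Nonempty (K →+* ℝ)) (hdeg : 1 < Module.finrank ℚ K) (u : (𝓞 K)ˣ) :
    HH (uK (u ^ (C0 (Module.finrank ℚ K) ^ 2).toNat)) ∈ ZZ hreal hdeg := by
  intro n hn
  refine ⟨n ^ 2, pow_ne_zero _ hn, fun γ hγ => ?_⟩
  have h0 : (n : K) ≠ 0 := by exact_mod_cast hn
  set t : Kˣ := Units.mk0 (n : K) h0 with ht
  have hG : DD t⁻¹ γ ∈ GG (n ^ 2) := by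
    obtain ⟨h1, ⟨y, h2⟩, ⟨z, h3⟩, h4⟩ := hγ
    refine ⟨by simpa using h1, ?_, ?_, by simpa using h4⟩
    · rw [DD01, h2, Units.val_inv_eq_inv_val]
      exact ⟨n * y, by simp [ht]; field_simp⟩
    · rw [DD10, h3, Units.val_inv_eq_inv_val, inv_inv]
      exact ⟨n * z, by simp [ht]; ring⟩
  have := T hdeg hreal (pow_ne_zero 2 hn) hG u
  rw [mem_TT] at this
  have h2 := DD_EE t rfl this
  simpa only [map_mul, map_inv, DD_HH, DD_DD] using h2

theorem ZZ_top (hreal : Nonempty (K →+* ℝ)) (hdeg : 1 < Module.finrank ℚ K) (g : SL K) :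
    g ∈ ZZ hreal hdeg := by
  have hC : (C0 (Module.finrank ℚ K) ^ 2).toNat ≠ 0 := by
    have := C0_pos (Module.finrank ℚ K)
    have : 0 < C0 (Module.finrank ℚ K) ^ 2 := by positivity
    omega
  obtain ⟨u, hu⟩ := exists_unit hdeg hreal _ hC
  have hz := ZZ_HH hreal hdeg u
  generalize hv : uK (u ^ (C0 (Module.finrank ℚ K) ^ 2).toNat) = v at hz
  have hv1 : (v : K) ^ 2 - 1 ≠ 0 := by
    rw [← hv, uK_coe, Units.val_pow_eq_pow_val, sub_ne_zero]
    push_cast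
    exact hu
  have hv0 : (v : K) ≠ 0 := v.ne_zero
  have hv2 : ((v : K)⁻¹) ^ 2 - 1 ≠ 0 := by
    intro h
    apply hv1
    field_simp at h
    linear_combination -h
  have hU : ∀ x, UU x ∈ ZZ hreal hdeg := by
    intro x
    have h1 := mul_mem hz (ZZ_conj (inv_mem hz) (UU (x / ((v : K) ^ 2 - 1))))
    have : HH v * (UU (x / ((v : K) ^ 2 - 1)) * (HH v)⁻¹ * (UU (x / ((v : K) ^ 2 - 1)))⁻¹) = 
      (HH v * UU (x / ((v : K) ^ 2 - 1)) * (HH v)⁻¹) * (UU (x / ((v : K) ^ 2 - 1)))⁻¹ := by group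
    rw [this, HH_conj_UU, ← UU_neg, ← UU_add] at h1
    convert h1 using 2
    field_simp
    ring
  have hL : ∀ x, LL x ∈ ZZ hreal hdeg := by
    intro x
    have h1 := mul_mem hz (ZZ_conj (inv_mem hz) (LL (x / ((v : K)⁻¹ ^ 2 - 1))))
    have : HH v * (LL (x / ((v : K)⁻¹ ^ 2 - 1)) * (HH v)⁻¹ * (LL (x / ((v : K)⁻¹ ^ 2 - 1)))⁻¹) = 
      (HH v * LL (x / ((v : K)⁻¹ ^ 2 - 1)) * (HH v)⁻¹) * (LL (x / ((v : K)⁻¹ ^ 2 - 1)))⁻¹ := by group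
    rw [this, HH_conj_LL, ← LL_neg, ← LL_add] at h1
    have e : (v : K)⁻¹ ^ 2 * (x / ((v : K)⁻¹ ^ 2 - 1)) + -(x / ((v : K)⁻¹ ^ 2 - 1)) = x := by
      have : (v : K)⁻¹ ^ 2 * (x / ((v : K)⁻¹ ^ 2 - 1)) + -(x / ((v : K)⁻¹ ^ 2 - 1)) = 
        x / ((v : K)⁻¹ ^ 2 - 1) * ((v : K)⁻¹ ^ 2 - 1) := by ring
      rw [this, div_mul_cancel₀ _ hv2]
    rwa [e] at h1
  obtain ⟨w, x, y, z, rfl⟩ := factor g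
  exact mul_mem (mul_mem (mul_mem (hL _) (hU _)) (hL _)) (hU _)

theorem deep (hreal : Nonempty (K →+* ℝ)) (hdeg : 1 < Module.finrank ℚ K) (g : SL K) {n : 𝓞 K}
    (hn : n ≠ 0) : ∃ n' : 𝓞 K, n' ≠ 0 ∧ ∀ γ, PP n' γ → g * γ * g⁻¹ * γ⁻¹ ∈ EE n n :=
  ZZ_top hreal hdeg g n hn

/-- `γ = e γ''` with `γ''` deep -/
theorem split (hreal : Nonempty (K →+* ℝ)) (hdeg : 1 < Module.finrank ℚ K) (g : SL K) {n k : 𝓞 K}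
    (hn : n ≠ 0) (hk : k ≠ 0) {γ : SL K} (hγ : γ ∈ GG k) :
    ∃ e ∈ EE 1 k, ∃ δ : SL K, γ = e * δ ∧ PP k δ ∧ g * δ * g⁻¹ * δ⁻¹ ∈ EE n n := by
  obtain ⟨n', h', H⟩ := deep hreal hdeg g hn
  obtain ⟨e, he, hP⟩ := approx (mul_ne_zero hk h') (dvd_mul_right _ _) hγ
  exact ⟨e⁻¹, inv_mem he, e * γ, by group, hP.mono (dvd_mul_right _ _), H _ (hP.mono (dvd_mul_left _ _))⟩

theorem EE_normal (hreal : Nonempty (K →+* ℝ)) (hdeg : 1 < Module.finrank ℚ K) {M : 𝓞 K} (hM : M ≠ 0)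
    {e γ : SL K} (he : e ∈ EE 1 M) (hγ : γ ∈ GG M) : γ * e * γ⁻¹ ∈ EE 1 M := by
  obtain ⟨f, hf, δ, rfl, -, h⟩ := split hreal hdeg e hM hM hγ
  have h := EE_mono (one_dvd M) dvd_rfl h
  have := mul_mem (mul_mem hf (mul_mem (inv_mem h) he)) (inv_mem hf)
  convert this using 1
  group

theorem EE_comm (hreal : Nonempty (K →+* ℝ)) (hdeg : 1 < Module.finrank ℚ K) {M : 𝓞 K} (hM : M ≠ 0)
    {g γ : SL K} (hg : g ∈ GG M) (hγ : γ ∈ GG M) : g * γ * g⁻¹ * γ⁻¹ ∈ EE 1 M := by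
  obtain ⟨f, hf, δ, rfl, -, h⟩ := split hreal hdeg g hM hM hγ
  have h := EE_mono (one_dvd M) dvd_rfl h
  have h1 := EE_normal hreal hdeg hM hf hg
  have := mul_mem h1 (mul_mem (mul_mem hf h) (inv_mem (mul_mem hf hf)))
  have h2 := mul_mem (mul_mem h1 h) (inv_mem hf)
  convert h2 using 1
  group

theorem exists_quot (hreal : Nonempty (K →+* ℝ)) (hdeg : 1 < Module.finrank ℚ K) {M : 𝓞 K} (hM : M ≠ 0) :
    ∃ (C : Type u) (_ : CommGroup C) (π : GG M →* C), Function.Surjective π ∧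
      ∀ g : GG M, π g = 1 ↔ (g : SL K) ∈ EE 1 M := by
  let N := (EE 1 M).subgroupOf (GG M)
  have hN : N.Normal := ⟨fun n hn g => by
    rw [Subgroup.mem_subgroupOf] at hn ⊢
    push_cast
    exact EE_normal hreal hdeg hM hn g.2⟩
  refine ⟨GG M ⧸ N, { (inferInstance : Group (GG M ⧸ N)) with mul_comm := ?_ }, QuotientGroup.mk' N,
    QuotientGroup.mk'_surjective N, fun g => ?_⟩
  · intro a b
    obtain ⟨a, rfl⟩ := QuotientGroup.mk'_surjective N a
    obtain ⟨b, rfl⟩ := QuotientGroup.mk'_surjective N b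
    rw [← map_mul, ← map_mul]
    symm
    refine (QuotientGroup.mk'_eq_mk' N).2 ⟨(b * a)⁻¹ * (a * b), ?_, by group⟩
    rw [Subgroup.mem_subgroupOf]
    push_cast
    have := EE_comm hreal hdeg hM (inv_mem a.2) (inv_mem b.2)
    convert this using 1
    group
  · exact (QuotientGroup.eq_one_iff g)

end A7
end Vas

open NumberField

namespace Vas
section A8
universe u
variable {K : Type u} [Field K] [NumberField K]

/-- a Mennicke type symbol with the formal properties needed below -/
structure Sym (M : 𝓞 K) (C : Type u) [CommGroup C] where
  f : 𝓞 K → 𝓞 K → C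
  add1 : ∀ {a c : 𝓞 K} (t : 𝓞 K), M ∣ a - 1 → IsCoprime a c → f (a + t * M * c) c = f a c
  add2 : ∀ {a c : 𝓞 K} (s : 𝓞 K), M ∣ a - 1 → IsCoprime a c → f a (c + s * a) = f a c
  one : ∀ {a : 𝓞 K}, M ∣ a - 1 → f a 1 = 1
  sq : ∀ {a c t : 𝓞 K}, M ∣ a - 1 → IsCoprime a c → IsCoprime a t → f a (c * t ^ 2) = f a c * f a (t ^ 2)
  mulB : ∀ {a a' t : 𝓞 K}, M ∣ a - 1 → M ∣ a' - 1 → IsCoprime a t → IsCoprime a' t →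
    f (a * a') (t ^ 2) = f a (t ^ 2) * f a' (t ^ 2)
  inv : ∀ {a c d : 𝓞 K}, M ∣ a - 1 → IsCoprime a c → M * c ∣ a * d - 1 → f a c * f d (-c) = 1
  surj : ∀ x, ∃ a c, M ∣ a - 1 ∧ IsCoprime a c ∧ c ≠ 0 ∧ f a c = x

lemma exists_gamma {M a c : 𝓞 K} (ha : M ∣ a - 1) (hc : IsCoprime a c) :
    ∃ g : SL K, g ∈ GG M ∧ g.1 0 0 = a ∧ g.1 1 0 = M * c := by
  have h1 : IsCoprime a M := by
    obtain ⟨z, hz⟩ := ha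
    exact ⟨1, -z, by linear_combination hz⟩
  obtain ⟨d, b, hdb⟩ := h1.mul_right hc
  have hdet : (a : K) * d - (-b : K) * (M * c) = 1 := by
    have : ((d * a + b * (M * c) : 𝓞 K) : K) = 1 := by rw [hdb]; simp
    push_cast at this
    linear_combination this
  refine ⟨mk4 (a : K) (-b) (M * c) d hdet, ⟨?_, ?_, ?_, ?_⟩, by simp, by simp⟩
  · have : (mk4 (a : K) (-b) (M * c) d hdet).1 0 0 - 1 = ((a - 1 : 𝓞 K) : K) := by simp
    rw [this, inI_coe_iff]; exact ha
  · simp only [mk4_01]; exact (inI_coe b).neg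
  · simp only [mk4_10]; exact ⟨c, rfl⟩
  · have : (mk4 (a : K) (-b) (M * c) d hdet).1 1 1 - 1 = ((d - 1 : 𝓞 K) : K) := by simp
    rw [this, inI_coe_iff]
    obtain ⟨z, hz⟩ := ha
    exact ⟨-b * c - d * z, by linear_combination hdb - d * hz⟩

/-- the subgroup with lower left entry divisible by `t² M` -/
def Gt (M t : 𝓞 K) : Subgroup (SL K) where
  carrier := {g | g ∈ GG M ∧ inI (t ^ 2 * M) (g.1 1 0)}
  mul_mem' := by
    rintro g h ⟨g1, g2⟩ ⟨h1, h2⟩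
    refine ⟨mul_mem g1 h1, ?_⟩
    rw [mul10]
    exact (g2.mulr h1.1.of_sub_one).add (g1.2.2.2.of_sub_one.mull h2)
  one_mem' := ⟨one_mem _, by simp [inI_zero]⟩
  inv_mem' := by
    rintro g ⟨g1, g2⟩
    exact ⟨inv_mem g1, by simpa using g2.neg⟩

lemma Gt_conj {M t : 𝓞 K} (h0 : (t : K) ≠ 0) {g : SL K} (hg : g ∈ Gt M t) :
    HH (Units.mk0 (t : K) h0) * g * (HH (Units.mk0 (t : K) h0))⁻¹ ∈ GG M := by
  obtain ⟨⟨h1, h2, h3, h4⟩, ⟨y, hy⟩⟩ := hg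
  refine ⟨?_, ?_, ?_, ?_⟩
  · rw [HH_conj00]; exact h1
  · rw [HH_conj01, Units.val_mk0, pow_two]; exact ((inI_coe t).mulr (inI_coe t)).mulr h2
  · rw [HH_conj10, Units.val_mk0, hy]
    exact ⟨y, by push_cast; field_simp⟩
  · rw [HH_conj11]; exact h4

lemma t_conj_EE {M t : 𝓞 K} (h0 : (t : K) ≠ 0) {e : SL K} (he : e ∈ EE 1 (t ^ 2 * M)) :
    HH (Units.mk0 (t : K) h0) * e * (HH (Units.mk0 (t : K) h0))⁻¹ ∈ EE 1 M := by
  refine EE_conj _ ?_ ?_ he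
  · intro x hx
    rw [HH_conj_UU, Units.val_mk0, pow_two]
    exact UU_mem (((inI_coe t).mulr (inI_coe t)).mulr hx)
  · rintro x ⟨y, rfl⟩
    rw [HH_conj_LL, Units.val_mk0]
    exact LL_mem ⟨y, by push_cast; field_simp⟩

lemma phi_triv (hreal : Nonempty (K →+* ℝ)) (hdeg : 1 < Module.finrank ℚ K) {M t : 𝓞 K} (hM : M ≠ 0)
    (htM : IsCoprime t M) (h0 : (t : K) ≠ 0) {g : SL K} (hg : g ∈ Gt M t)
    (h1 : inI (t ^ 2) (g.1 0 0 - 1)) :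
    g * (HH (Units.mk0 (t : K) h0) * g * (HH (Units.mk0 (t : K) h0))⁻¹)⁻¹ ∈ EE 1 M := by
  have ht0 : t ≠ 0 := by rintro rfl; simp at h0
  have hk : t ^ 2 * M ≠ 0 := mul_ne_zero (pow_ne_zero _ ht0) hM
  have hG : g ∈ GG (t ^ 2 * M) := by
    obtain ⟨a, b, c, d, ha, hb, hc, hd, hma, hmc, hmd, hdet⟩ := GG_lift hg.1
    have e1 : t ^ 2 ∣ a - 1 := by
      rw [ha] at h1
      have : (a : K) - 1 = ((a - 1 : 𝓞 K) : K) := by simp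
      rw [this, inI_coe_iff] at h1
      exact h1
    have e2 : t ^ 2 * M ∣ c := by
      have := hg.2
      rw [hc, inI_coe_iff] at this
      exact this
    have e3 : t ^ 2 ∣ d - 1 := by
      obtain ⟨x, hx⟩ := e1
      obtain ⟨y, hy⟩ := e2
      exact ⟨b * M * y - x * d, by rw [hy] at hdet; linear_combination hdet - d * hx⟩
    have hcop : IsCoprime (t ^ 2) M := htM.pow_left
    refine ⟨?_, hg.1.2.1, hg.2, ?_⟩
    · have : g.1 0 0 - 1 = ((a - 1 : 𝓞 K) : K) := by rw [ha]; simp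
      rw [this, inI_coe_iff]; exact hcop.mul_dvd e1 hma
    · have : g.1 1 1 - 1 = ((d - 1 : 𝓞 K) : K) := by rw [hd]; simp
      rw [this, inI_coe_iff]; exact hcop.mul_dvd e3 hmd
  obtain ⟨e, he, δ, rfl, -, h⟩ := split hreal hdeg (HH (Units.mk0 (t : K) h0)) hM hk hG
  have h := EE_mono (one_dvd M) dvd_rfl h
  have h2 := t_conj_EE h0 he
  have h3 : e ∈ EE 1 M := EE_mono dvd_rfl (dvd_mul_left _ _) he
  have := mul_mem (mul_mem h3 (inv_mem h)) (inv_mem h2)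
  convert this using 1
  group

theorem exists_sym (hreal : Nonempty (K →+* ℝ)) (hdeg : 1 < Module.finrank ℚ K) {M : 𝓞 K} (hM : M ≠ 0)
    (hMu : ¬ IsUnit M) :
    ∃ (C : Type u) (_ : CommGroup C) (S : Sym M C), ((∀ x : C, x = 1) → GG M ≤ EE 1 M) := by
  classical
  obtain ⟨C, iC, π, hπ, hker⟩ := exists_quot hreal hdeg hM
  let P : SL K → C := fun g => if h : g ∈ GG M then π ⟨g, h⟩ else 1
  have hP : ∀ g (h : g ∈ GG M), P g = π ⟨g, h⟩ := fun g h => dif_pos h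
  have Pmul : ∀ g h, g ∈ GG M → h ∈ GG M → P (g * h) = P g * P h := by
    intro g h hg hh
    rw [hP _ hg, hP _ hh, hP _ (mul_mem hg hh), ← map_mul]; rfl
  have Pinv : ∀ g, g ∈ GG M → P g⁻¹ = (P g)⁻¹ := by
    intro g hg
    rw [hP _ hg, hP _ (inv_mem hg), ← map_inv]; rfl
  have PE : ∀ e, e ∈ EE 1 M → P e = 1 := by
    intro e he
    rw [hP _ (EE_le_GG _ he)]
    exact (hker _).2 he
  have Pcol : ∀ g h, g ∈ GG M → h ∈ GG M → g.1 0 0 = h.1 0 0 → g.1 1 0 = h.1 1 0 → P g = P h := by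
    intro g h hg hh e1 e2
    have := same_col e1 e2
    have hU : UU (h.1 1 1 * g.1 0 1 - h.1 0 1 * g.1 1 1) ∈ EE 1 M :=
      UU_mem ((hh.2.2.2.of_sub_one.mulr hg.2.1).sub (hh.2.1.mulr hg.2.2.2.of_sub_one))
    rw [this, Pmul _ _ hh (EE_le_GG _ hU), PE _ hU, mul_one]
  let f : 𝓞 K → 𝓞 K → C := fun a c =>
    if h : ∃ g : SL K, g ∈ GG M ∧ g.1 0 0 = a ∧ g.1 1 0 = M * c then P h.choose else 1
  have hf : ∀ (a c : 𝓞 K) (g : SL K), g ∈ GG M → g.1 0 0 = a → g.1 1 0 = M * c → f a c = P g := by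
    intro a c g h1 h2 h3
    have h : ∃ g : SL K, g ∈ GG M ∧ g.1 0 0 = a ∧ g.1 1 0 = M * c := ⟨g, h1, h2, h3⟩
    have : f a c = P h.choose := dif_pos h
    rw [this]
    obtain ⟨k1, k2, k3⟩ := h.choose_spec
    exact Pcol _ _ k1 h1 (k2.trans h2.symm) (k3.trans h3.symm)
  have add1 : ∀ {a c : 𝓞 K} (t : 𝓞 K), M ∣ a - 1 → IsCoprime a c → f (a + t * M * c) c = f a c := by
    intro a c t ha hc
    obtain ⟨g, g1, g2, g3⟩ := exists_gamma ha hc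
    have hU : UU (t : K) ∈ EE 1 M := UU_mem (inI_coe t)
    rw [hf a c g g1 g2 g3, hf _ c (UU (t : K) * g) (mul_mem (EE_le_GG _ hU) g1)
      (by simp [g2, g3]; ring) (by simp [g2, g3]), Pmul _ _ (EE_le_GG _ hU) g1, PE _ hU, one_mul]
  have add2 : ∀ {a c : 𝓞 K} (s : 𝓞 K), M ∣ a - 1 → IsCoprime a c → f a (c + s * a) = f a c := by
    intro a c s ha hc
    obtain ⟨g, g1, g2, g3⟩ := exists_gamma ha hc
    have hU : LL ((M : K) * s) ∈ EE 1 M := LL_mem ⟨s, rfl⟩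
    rw [hf a c g g1 g2 g3, hf a _ (LL ((M : K) * s) * g) (mul_mem (EE_le_GG _ hU) g1)
      (by simp [g2, g3]) (by simp [g2, g3]; ring), Pmul _ _ (EE_le_GG _ hU) g1, PE _ hU, one_mul]
  have one : ∀ {a : 𝓞 K}, M ∣ a - 1 → f a 1 = 1 := by
    rintro a ⟨k, hk⟩
    have hk' : (a : K) - 1 = M * k := by exact_mod_cast congrArg (algebraMap (𝓞 K) K) hk
    have hU : UU (k : K) * LL (M : K) ∈ EE 1 M := mul_mem (UU_mem (inI_coe k)) (LL_mem (inI_self M))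
    rw [hf a 1 _ (EE_le_GG _ hU) (by simp; linear_combination -hk') (by simp), PE _ hU]
  -- the homomorphism φ_t
  have phi : ∀ {t : 𝓞 K} (h0 : (t : K) ≠ 0), IsCoprime t M → ∀ g h, g ∈ Gt M t → h ∈ Gt M t →
      inI (t ^ 2) (g.1 0 0 - h.1 0 0) →
      P g * (P (HH (Units.mk0 (t : K) h0) * g * (HH (Units.mk0 (t : K) h0))⁻¹))⁻¹ =
      P h * (P (HH (Units.mk0 (t : K) h0) * h * (HH (Units.mk0 (t : K) h0))⁻¹))⁻¹ := by
    intro t h0 htM g h hg hh hgh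
    have hq := mul_mem hg (inv_mem hh)
    have h1 : inI (t ^ 2) ((g * h⁻¹).1 0 0 - 1) := by
      have hd := det4 h
      have : (g * h⁻¹).1 0 0 - 1 = (g.1 0 0 - h.1 0 0) * h.1 1 1 - (g.1 0 1 - h.1 0 1) * h.1 1 0 := by
        simp only [mul00, inv00, inv10]; linear_combination hd
      rw [this]
      exact (hgh.mulr hh.1.2.2.2.of_sub_one).sub
        ((hg.1.2.1.sub hh.1.2.1).mull (hh.2.mono (dvd_mul_right _ _)))
    have h2 := PE _ (phi_triv hreal hdeg hM htM h0 hq h1)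
    have h3 := Gt_conj h0 hq
    have h4 := Gt_conj h0 hg
    have h5 := Gt_conj h0 hh
    rw [Pmul _ _ hq.1 (inv_mem h3), Pinv _ h3] at h2
    have h6 : HH (Units.mk0 (t : K) h0) * (g * h⁻¹) * (HH (Units.mk0 (t : K) h0))⁻¹ = 
      (HH (Units.mk0 (t : K) h0) * g * (HH (Units.mk0 (t : K) h0))⁻¹) *
       (HH (Units.mk0 (t : K) h0) * h * (HH (Units.mk0 (t : K) h0))⁻¹)⁻¹ := by group
    rw [h6, Pmul _ _ h4 (inv_mem h5), Pinv _ h5, Pmul _ _ hg.1 (inv_mem hh.1), Pinv _ hh.1] at h2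
    generalize P g = x1 at *
    generalize P h = x2 at *
    generalize P (HH (Units.mk0 (t : K) h0) * g * (HH (Units.mk0 (t : K) h0))⁻¹) = x3 at *
    generalize P (HH (Units.mk0 (t : K) h0) * h * (HH (Units.mk0 (t : K) h0))⁻¹) = x4 at *
    rw [← mul_inv_eq_one, ← h2]
    simp only [mul_inv_rev, inv_inv]
    simp only [mul_comm, mul_left_comm, mul_assoc]
  -- f in terms of φ_t
  have fphi : ∀ {t : 𝓞 K} (h0 : (t : K) ≠ 0) (a c : 𝓞 K) (g : SL K), g ∈ GG M → g.1 0 0 = a →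
      g.1 1 0 = M * (c * t ^ 2 : 𝓞 K) → g ∈ Gt M t ∧ f a (c * t ^ 2) = P g ∧
      P (HH (Units.mk0 (t : K) h0) * g * (HH (Units.mk0 (t : K) h0))⁻¹) = f a c := by
    intro t h0 a c g h1 h2 h3
    have h4 : g ∈ Gt M t := ⟨h1, ⟨c, by rw [h3]; push_cast; ring⟩⟩
    refine ⟨h4, hf _ _ g h1 h2 h3, ?_⟩
    refine (hf _ _ _ (Gt_conj h0 h4) (by rw [HH_conj00, h2]) ?_).symm
    rw [HH_conj10, h3, Units.val_mk0]; push_cast; field_simp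
  have sq1 : ∀ {a c t : 𝓞 K}, M ∣ a - 1 → IsCoprime a c → IsCoprime a t → t ≠ 0 → IsCoprime t M →
      f a (c * t ^ 2) = f a c * f a (t ^ 2) := by
    intro a c t ha hc ht ht0 htM
    have h0 : (t : K) ≠ 0 := by exact_mod_cast ht0
    obtain ⟨g, g1, g2, g3⟩ := exists_gamma ha (hc.mul_right (ht.pow_right (n := 2)))
    obtain ⟨h, h1, h2, h3⟩ := exists_gamma ha (isCoprime_one_right.mul_right (ht.pow_right (n := 2)))
    obtain ⟨A1, A2, A3⟩ := fphi h0 a c g g1 g2 g3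
    obtain ⟨B1, B2, B3⟩ := fphi h0 a 1 h h1 h2 h3
    have := phi h0 htM g h A1 B1 (by rw [g2, h2, sub_self]; exact inI_zero _)
    rw [A3, B3, ← A2, ← B2, one ha, one_mul, inv_one, mul_one] at this
    rw [← this, mul_comm (f a c), inv_mul_cancel_right]
  have mul1 : ∀ {a a' t : 𝓞 K}, M ∣ a - 1 → M ∣ a' - 1 → IsCoprime a t → IsCoprime a' t → t ≠ 0 →
      IsCoprime t M → f (a * a') (t ^ 2) = f a (t ^ 2) * f a' (t ^ 2) := by
    intro a a' t ha ha' ht ht' ht0 htM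
    have h0 : (t : K) ≠ 0 := by exact_mod_cast ht0
    have haa : M ∣ a * a' - 1 := by
      obtain ⟨x, hx⟩ := ha
      obtain ⟨y, hy⟩ := ha'
      exact ⟨x * a' + y, by linear_combination a' * hx + hy⟩
    obtain ⟨g, g1, g2, g3⟩ := exists_gamma ha (isCoprime_one_right.mul_right (ht.pow_right (n := 2)))
    obtain ⟨h, h1, h2, h3⟩ := exists_gamma ha' (isCoprime_one_right.mul_right (ht'.pow_right (n := 2)))
    obtain ⟨k, k1, k2, k3⟩ := exists_gamma haa
      (isCoprime_one_right.mul_right ((ht.mul_left ht').pow_right (n := 2)))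
    obtain ⟨A1, A2, A3⟩ := fphi h0 a 1 g g1 g2 g3
    obtain ⟨B1, B2, B3⟩ := fphi h0 a' 1 h h1 h2 h3
    obtain ⟨D1, D2, D3⟩ := fphi h0 (a * a') 1 k k1 k2 k3
    have hgh : inI (t ^ 2) (k.1 0 0 - (g * h).1 0 0) := by
      rw [k2, mul00, g2, h2]
      have : ((a * a' : 𝓞 K) : K) - (a * a' + g.1 0 1 * h.1 1 0) = - (g.1 0 1 * h.1 1 0) := by
        push_cast; ring
      rw [this]
      exact (A1.1.2.1.mull (B1.2.mono (dvd_mul_right _ _))).neg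
    have := phi h0 htM k (g * h) D1 (mul_mem A1 B1) hgh
    have h6 : HH (Units.mk0 (t : K) h0) * (g * h) * (HH (Units.mk0 (t : K) h0))⁻¹ = 
      (HH (Units.mk0 (t : K) h0) * g * (HH (Units.mk0 (t : K) h0))⁻¹) *
       (HH (Units.mk0 (t : K) h0) * h * (HH (Units.mk0 (t : K) h0))⁻¹) := by group
    rw [h6, Pmul _ _ (Gt_conj h0 A1) (Gt_conj h0 B1), Pmul _ _ g1 h1, A3, B3, D3, ← A2, ← B2, ← D2,
      one ha, one ha', one haa] at this
    simpa using this
  -- change of t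
  have chg : ∀ a t : 𝓞 K, M ∣ a - 1 → IsCoprime a t → (t + (1 - t) * a) ≠ 0 ∧
      IsCoprime (t + (1 - t) * a) M ∧ IsCoprime a (t + (1 - t) * a) := by
    rintro a t ⟨z, hz⟩ hc
    have h1 : IsCoprime (t + (1 - t) * a) M := ⟨1, -(1 - t) * z, by linear_combination (1 - t) * hz⟩
    refine ⟨?_, h1, IsCoprime.add_mul_right_right hc _⟩
    intro h
    rw [h] at h1
    exact hMu (isCoprime_zero_left.1 h1)
  have chgf : ∀ a c t w : 𝓞 K, M ∣ a - 1 → IsCoprime a c → IsCoprime a t →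
      f a (c * (t + w * a) ^ 2) = f a (c * t ^ 2) := by
    intro a c t w ha hc ht
    rw [← add2 (a := a) (c := c * t ^ 2) (c * (2 * t * w + w ^ 2 * a)) ha (hc.mul_right ht.pow_right)]
    congr 1
    ring
  have sq : ∀ {a c t : 𝓞 K}, M ∣ a - 1 → IsCoprime a c → IsCoprime a t →
      f a (c * t ^ 2) = f a c * f a (t ^ 2) := by
    intro a c t ha hc ht
    obtain ⟨h1, h2, h3⟩ := chg a t ha ht
    have := sq1 ha hc h3 h1 h2
    rw [chgf _ _ _ _ ha hc ht] at this
    have h4 := chgf a 1 t (1 - t) ha isCoprime_one_right ht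
    rw [one_mul, one_mul] at h4
    rw [this, h4]
  have mulB : ∀ {a a' t : 𝓞 K}, M ∣ a - 1 → M ∣ a' - 1 → IsCoprime a t → IsCoprime a' t →
      f (a * a') (t ^ 2) = f a (t ^ 2) * f a' (t ^ 2) := by
    intro a a' t ha ha' ht ht'
    have haa : M ∣ a * a' - 1 := by
      obtain ⟨x, hx⟩ := ha
      obtain ⟨y, hy⟩ := ha'
      exact ⟨x * a' + y, by linear_combination a' * hx + hy⟩
    obtain ⟨h1, h2, h3⟩ := chg (a * a') t haa (ht.mul_left ht')
    have := mul1 ha ha' h3.of_mul_left_left h3.of_mul_left_right h1 h2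
    have h4 := chgf (a * a') 1 t (1 - t) haa isCoprime_one_right (ht.mul_left ht')
    have h5 := chgf a 1 t ((1 - t) * a') ha isCoprime_one_right ht
    have h6 := chgf a' 1 t ((1 - t) * a) ha' isCoprime_one_right ht'
    have e5 : (1 - t) * a' * a = (1 - t) * (a * a') := by ring
    have e6 : (1 - t) * a * a' = (1 - t) * (a * a') := by ring
    rw [e5] at h5
    rw [e6] at h6
    simp only [one_mul] at h4 h5 h6
    rw [h4, h5, h6] at this
    exact this
  refine ⟨C, iC, ⟨f, add1, add2, one, sq, mulB, ?_, ?_⟩, ?_⟩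
  · rintro a c d ha hc ⟨b, hb⟩
    have hb' : (a : K) * d - 1 = M * c * b := by
      have := congrArg (algebraMap (𝓞 K) K) hb
      rw [map_sub, map_mul, map_mul, map_mul, map_one] at this
      exact this
    have hdet : (a : K) * d - (b : K) * (M * c) = 1 := by linear_combination hb'
    have hG : mk4 (a : K) b (M * c) d hdet ∈ GG M := by
      refine ⟨?_, ?_, ?_, ?_⟩
      · have : (mk4 (a : K) b (M * c) d hdet).1 0 0 - 1 = ((a - 1 : 𝓞 K) : K) := by simp
        rw [this, inI_coe_iff]; exact ha
      · simp only [mk4_01]; exact inI_coe b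
      · simp only [mk4_10]; exact ⟨c, rfl⟩
      · have : (mk4 (a : K) b (M * c) d hdet).1 1 1 - 1 = ((d - 1 : 𝓞 K) : K) := by simp
        rw [this, inI_coe_iff]
        obtain ⟨z, hz⟩ := ha
        exact ⟨c * b - d * z, by linear_combination hb - d * hz⟩
    rw [hf a c _ hG (by simp) (by simp), hf d (-c) _ (inv_mem hG) (by simp) (by simp), Pinv _ hG,
      mul_inv_cancel]
  · intro x
    obtain ⟨g, rfl⟩ := hπ x
    obtain ⟨a, b, c, d, ha, hb, hc, hd, hma, ⟨c', hc'⟩, hmd, hdet⟩ := GG_lift g.2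
    have hcop : IsCoprime a c' := ⟨d, -b * M, by rw [hc'] at hdet; linear_combination hdet⟩
    have hfa : f a c' = π g := by
      rw [hf a c' g.1 g.2 ha (by rw [hc, hc']; simp), hP _ g.2]
    by_cases h : c' = 0
    · refine ⟨a, a, hma, ?_, ?_, ?_⟩
      · rw [h] at hcop
        exact IsCoprime.of_isCoprime_of_dvd_right isCoprime_one_right (isCoprime_zero_right.1 hcop).dvd
      · rintro rfl
        rw [h] at hcop
        have hu := isCoprime_zero_right.1 hcop
        exact not_isUnit_zero hu
      · rw [← hfa, ← add2 1 hma hcop, h]; congr 1; ring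
    · exact ⟨a, c', hma, hcop, h, hfa⟩
  · intro hx g hg
    exact (hker ⟨g, hg⟩).1 (hx _)

end A8
end Vas

open NumberField

namespace Vas
section N1
open Filter Topology UniqueFactorizationMonoid
open scoped ENNReal
variable {F : Type*} [Field F] [NumberField F]

/-- weight of an ideal -/
noncomputable def ww (s : ℝ) (I : Ideal (𝓞 F)) : ℝ≥0∞ := ENNReal.ofReal ((Ideal.absNorm I : ℝ) ^ (-s))

lemma ww_mul (s : ℝ) (I J : Ideal (𝓞 F)) : ww s (I * J) = ww s I * ww s J := by
  unfold ww
  rw [map_mul, Nat.cast_mul, Real.mul_rpow (by positivity) (by positivity),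
    ENNReal.ofReal_mul (by positivity)]

/-- nonzero ideals all of whose prime factors are in `S` -/
def supp (S : Set (Ideal (𝓞 F))) : Set (Ideal (𝓞 F)) :=
  {I | I ≠ 0 ∧ ∀ P ∈ normalizedFactors I, P ∈ S}

noncomputable def zS (S : Set (Ideal (𝓞 F))) (s : ℝ) : ℝ≥0∞ := ∑' I : supp S, ww s I.1

lemma nf_prod {I : Ideal (𝓞 F)} (h : I ≠ 0) : (normalizedFactors I).prod = I :=
  prod_normalizedFactors_eq_self h

lemma nf_of {m : Multiset (Ideal (𝓞 F))} (h : ∀ P ∈ m, Prime P) : normalizedFactors m.prod = m :=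
  normalizedFactors_prod_of_prime h

lemma prod_ne {m : Multiset (Ideal (𝓞 F))} (h : ∀ P ∈ m, Prime P) : m.prod ≠ 0 := by
  exact Multiset.prod_ne_zero (fun h0 => (h 0 h0).ne_zero rfl)

lemma prime_nf {I P : Ideal (𝓞 F)} (h : P ∈ normalizedFactors I) : Prime P :=
  prime_of_normalized_factor P h

open Classical in
lemma zS_split (S : Set (Ideal (𝓞 F))) (s : ℝ) : zS (F := F) Set.univ s ≤ zS S s * zS Sᶜ s := by
  unfold zS
  rw [← ENNReal.tsum_mul_right]
  simp_rw [← ENNReal.tsum_mul_left]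
  rw [← ENNReal.tsum_prod (f := fun (a : supp S) (b : supp Sᶜ) => ww s a.1 * ww s b.1)]
  let φ : supp (F := F) Set.univ → supp S × supp Sᶜ := fun I =>
    (⟨((normalizedFactors I.1).filter (· ∈ S)).prod, by
      have h : ∀ P ∈ (normalizedFactors I.1).filter (· ∈ S), Prime P := fun P hP =>
        prime_nf (Multiset.mem_filter.1 hP).1
      refine ⟨prod_ne h, ?_⟩
      rw [nf_of h]
      exact fun P hP => (Multiset.mem_filter.1 hP).2⟩,
     ⟨((normalizedFactors I.1).filter (fun P => ¬ P ∈ S)).prod, by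
      have h : ∀ P ∈ (normalizedFactors I.1).filter (fun P => ¬ P ∈ S), Prime P := fun P hP =>
        prime_nf (Multiset.mem_filter.1 hP).1
      refine ⟨prod_ne h, ?_⟩
      rw [nf_of h]
      exact fun P hP => (Multiset.mem_filter.1 hP).2⟩)
  have hφ : ∀ I, (φ I).1.1 * (φ I).2.1 = I.1 := by
    intro I
    change ((normalizedFactors I.1).filter (· ∈ S)).prod * ((normalizedFactors I.1).filter (fun P => ¬ P ∈ S)).prod = I.1
    rw [← Multiset.prod_add, Multiset.filter_add_not, nf_prod I.2.1]
  have inj : Function.Injective φ := fun I J h => Subtype.ext (by rw [← hφ I, ← hφ J, h])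
  refine le_trans (le_of_eq ?_) (ENNReal.tsum_comp_le_tsum_of_injective inj _)
  refine tsum_congr fun I => ?_
  rw [← ww_mul, hφ]

/-- Euler product bound, one prime -/
lemma zS_insert (T : Set (Ideal (𝓞 F))) (P : Ideal (𝓞 F)) (hP : Prime P) (s : ℝ) :
    zS (insert P T) s ≤ zS T s * ∑' j : ℕ, (ww s P) ^ j := by
  classical
  unfold zS
  rw [← ENNReal.tsum_mul_right]
  simp_rw [← ENNReal.tsum_mul_left]
  rw [← ENNReal.tsum_prod (f := fun (a : supp T) (j : ℕ) => ww s a.1 * (ww s P) ^ j)]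
  let φ : supp (insert P T) → supp T × ℕ := fun I =>
    (⟨((normalizedFactors I.1).filter (fun Q => ¬ P = Q)).prod, by
      have h : ∀ Q ∈ (normalizedFactors I.1).filter (fun Q => ¬ P = Q), Prime Q := fun P hP =>
        prime_nf (Multiset.mem_filter.1 hP).1
      refine ⟨prod_ne h, ?_⟩
      rw [nf_of h]
      intro Q hQ
      obtain ⟨h1, h2⟩ := Multiset.mem_filter.1 hQ
      rcases I.2.2 Q h1 with h3 | h3
      · exact absurd h3.symm h2
      · exact h3⟩, (normalizedFactors I.1).count P)
  have hφ : ∀ I, (φ I).1.1 * P ^ (φ I).2 = I.1 := by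
    intro I
    change ((normalizedFactors I.1).filter (fun Q => ¬ P = Q)).prod * P ^ ((normalizedFactors I.1).count P) = I.1
    rw [← Multiset.prod_replicate, ← Multiset.filter_eq, mul_comm, ← Multiset.prod_add,
      Multiset.filter_add_not, nf_prod I.2.1]
  have inj : Function.Injective φ := fun I J h => Subtype.ext (by rw [← hφ I, ← hφ J, h])
  refine le_trans (le_of_eq ?_) (ENNReal.tsum_comp_le_tsum_of_injective inj _)
  refine tsum_congr fun I => ?_
  have : (ww s P) ^ (φ I).2 = ww s (P ^ (φ I).2) := by
    induction (φ I).2 with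
    | zero => simp [ww]
    | succ n ih => rw [pow_succ, pow_succ, ww_mul, ih]
  rw [this, ← ww_mul, hφ]

lemma zS_pair {F' : Type*} [Field F'] [NumberField F'] (S : Set (Ideal (𝓞 F)))
    (p₁ p₂ : Ideal (𝓞 F) → Ideal (𝓞 F'))
    (h₁ : ∀ P ∈ S, Prime (p₁ P)) (h₂ : ∀ P ∈ S, Prime (p₂ P))
    (n₁ : ∀ P ∈ S, Ideal.absNorm (p₁ P) = Ideal.absNorm P)
    (n₂ : ∀ P ∈ S, Ideal.absNorm (p₂ P) = Ideal.absNorm P)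
    (i₁ : ∀ P ∈ S, ∀ Q ∈ S, p₁ P = p₁ Q → P = Q) (i₂ : ∀ P ∈ S, ∀ Q ∈ S, p₂ P = p₂ Q → P = Q)
    (i₃ : ∀ P ∈ S, ∀ Q ∈ S, p₁ P ≠ p₂ Q) (s : ℝ) :
    zS S s * zS S s ≤ zS (F := F') Set.univ s := by
  classical
  unfold zS
  rw [← ENNReal.tsum_mul_right]
  simp_rw [← ENNReal.tsum_mul_left]
  rw [← ENNReal.tsum_prod (f := fun (a : supp S) (b : supp S) => ww s a.1 * ww s b.1)]
  have hpr : ∀ I J : supp S, ∀ P ∈ (normalizedFactors I.1).map p₁ + (normalizedFactors J.1).map p₂, Prime P := by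
    intro I J P hP
    rw [Multiset.mem_add, Multiset.mem_map, Multiset.mem_map] at hP
    rcases hP with ⟨Q, hQ, rfl⟩ | ⟨Q, hQ, rfl⟩
    · exact h₁ _ (I.2.2 Q hQ)
    · exact h₂ _ (J.2.2 Q hQ)
  let φ : supp S × supp S → supp (F := F') Set.univ := fun x =>
    ⟨((normalizedFactors x.1.1).map p₁ + (normalizedFactors x.2.1).map p₂).prod,
      prod_ne (hpr x.1 x.2), fun _ _ => trivial⟩
  have winv : ∀ (m : Multiset (Ideal (𝓞 F))) (p : Ideal (𝓞 F) → Ideal (𝓞 F')),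
      (∀ P ∈ m, Ideal.absNorm (p P) = Ideal.absNorm P) → ww s (m.map p).prod = ww s m.prod := by
    intro m p hm
    unfold ww
    rw [map_multiset_prod, map_multiset_prod, Multiset.map_map]
    congr 4
    exact Multiset.map_congr rfl hm
  have inj : Function.Injective φ := by
    rintro ⟨I, J⟩ ⟨I', J'⟩ h
    have h' := congrArg (fun x : supp (F := F') Set.univ => normalizedFactors x.1) h
    simp only [φ] at h'
    rw [nf_of (hpr I J), nf_of (hpr I' J')] at h'
    have c1 : ∀ Q ∈ S, (normalizedFactors I.1).count Q = (normalizedFactors I'.1).count Q := by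
      intro Q hQ
      have := congrArg (Multiset.count (p₁ Q)) h'
      have e : ∀ I : supp S, Multiset.count (p₁ Q) ((normalizedFactors I.1).map p₁) =
        (normalizedFactors I.1).count Q := by
        intro I
        by_cases hm : Q ∈ normalizedFactors I.1
        · exact Multiset.count_map_eq_count p₁ _ (fun x hx y hy hxy => i₁ x (I.2.2 x hx) y (I.2.2 y hy) hxy) Q hm
        · rw [Multiset.count_eq_zero_of_notMem hm, Multiset.count_eq_zero]
          intro hc
          obtain ⟨R, hR, hRQ⟩ := Multiset.mem_map.1 hc
          rw [i₁ _ (I.2.2 R hR) _ hQ hRQ] at hR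
          exact hm hR
      have e2 : ∀ J : supp S, Multiset.count (p₁ Q) ((normalizedFactors J.1).map p₂) = 0 := by
        intro J
        rw [Multiset.count_eq_zero]
        intro hc
        obtain ⟨R, hR, hRQ⟩ := Multiset.mem_map.1 hc
        exact i₃ _ hQ _ (J.2.2 R hR) hRQ.symm
      simpa only [Multiset.count_add, e, e2, add_zero] using this
    have c2 : ∀ Q ∈ S, (normalizedFactors J.1).count Q = (normalizedFactors J'.1).count Q := by
      intro Q hQ
      have := congrArg (Multiset.count (p₂ Q)) h'
      have e : ∀ I : supp S, Multiset.count (p₂ Q) ((normalizedFactors I.1).map p₂) =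
        (normalizedFactors I.1).count Q := by
        intro I
        by_cases hm : Q ∈ normalizedFactors I.1
        · exact Multiset.count_map_eq_count p₂ _ (fun x hx y hy hxy => i₂ x (I.2.2 x hx) y (I.2.2 y hy) hxy) Q hm
        · rw [Multiset.count_eq_zero_of_notMem hm, Multiset.count_eq_zero]
          intro hc
          obtain ⟨R, hR, hRQ⟩ := Multiset.mem_map.1 hc
          rw [i₂ _ (I.2.2 R hR) _ hQ hRQ] at hR
          exact hm hR
      have e2 : ∀ J : supp S, Multiset.count (p₂ Q) ((normalizedFactors J.1).map p₁) = 0 := by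
        intro J
        rw [Multiset.count_eq_zero]
        intro hc
        obtain ⟨R, hR, hRQ⟩ := Multiset.mem_map.1 hc
        exact i₃ _ (J.2.2 R hR) _ hQ hRQ
      simpa only [Multiset.count_add, e, e2, zero_add] using this
    have fin : ∀ I I' : supp S, (∀ Q ∈ S, (normalizedFactors I.1).count Q = (normalizedFactors I'.1).count Q) →
        I = I' := by
      intro I I' hc
      apply Subtype.ext
      rw [← nf_prod I.2.1, ← nf_prod I'.2.1]
      congr 1
      ext Q
      by_cases hQ : Q ∈ S
      · exact hc Q hQ
      · rw [Multiset.count_eq_zero_of_notMem (fun h => hQ (I.2.2 Q h)),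
          Multiset.count_eq_zero_of_notMem (fun h => hQ (I'.2.2 Q h))]
    rw [fin I I' c1, fin J J' c2]
  refine le_trans (le_of_eq ?_) (ENNReal.tsum_comp_le_tsum_of_injective inj _)
  refine tsum_congr fun x => ?_
  change _ = ww s ((normalizedFactors x.1.1).map p₁ + (normalizedFactors x.2.1).map p₂).prod
  rw [Multiset.prod_add, ww_mul, winv _ _ (fun P hP => n₁ P (x.1.2.2 P hP)),
    winv _ _ (fun P hP => n₂ P (x.2.2.2 P hP)), nf_prod x.1.2.1, nf_prod x.2.2.1]

end N1
end Vas

open NumberField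

namespace Vas
section N2
open Filter Topology UniqueFactorizationMonoid
open scoped ENNReal
variable {F : Type*} [Field F] [NumberField F]

lemma zS_univ_eq {s : ℝ} (hs : 0 < s) (h : dedekindZeta F s ≠ 0) :
    zS (F := F) Set.univ s = ENNReal.ofReal ‖dedekindZeta F s‖ := by
  have e1 : zS (F := F) Set.univ s = ∑' I : Ideal (𝓞 F), ww s I := by
    unfold zS
    rw [tsum_subtype (supp (F := F) Set.univ) (ww s)]
    refine tsum_congr fun I => ?_
    by_cases hI : I = 0
    · subst hI
      rw [Set.indicator_of_notMem (fun h => h.1 rfl)]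
      unfold ww
      rw [show Ideal.absNorm (0 : Ideal (𝓞 F)) = 0 from Ideal.absNorm_bot]
      rw [Nat.cast_zero, Real.zero_rpow (by linarith), ENNReal.ofReal_zero]
    · exact Set.indicator_of_mem (s := supp (F := F) Set.univ) ⟨hI, fun _ _ => trivial⟩ _
  let c : ℕ → ℝ := fun n => if n = 0 then 0 else (Nat.card {I : Ideal (𝓞 F) // Ideal.absNorm I = n} : ℝ) * (n : ℝ) ^ (-s)
  have c0 : ∀ n, 0 ≤ c n := by
    intro n; simp only [c]; split_ifs <;> positivity
  have hterm : ∀ n, LSeries.term (fun n ↦ (Nat.card {I : Ideal (𝓞 F) // Ideal.absNorm I = n} : ℂ)) (s : ℂ) n = ((c n : ℝ) : ℂ) := by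
    intro n
    rw [LSeries.term_def]
    simp only [c]
    split_ifs with hn
    · simp
    · rw [Real.rpow_neg (by positivity)]
      push_cast
      rw [Complex.ofReal_cpow (by positivity)]
      simp [div_eq_mul_inv]
  have hz : dedekindZeta F s = ((∑' n, c n : ℝ) : ℂ) := by
    unfold dedekindZeta LSeries
    rw [Complex.ofReal_tsum]
    exact tsum_congr hterm
  have hsum : Summable c := by
    by_contra hc
    rw [tsum_eq_zero_of_not_summable hc] at hz
    exact h (by simpa using hz)
  rw [e1, hz, Complex.norm_real, Real.norm_of_nonneg (tsum_nonneg c0), ENNReal.ofReal_tsum_of_nonneg c0 hsum,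
    ← ENNReal.tsum_fiberwise _ (fun I : Ideal (𝓞 F) => Ideal.absNorm I)]
  refine tsum_congr fun n => ?_
  have : ∀ I : ((fun I : Ideal (𝓞 F) => Ideal.absNorm I) ⁻¹' {n}), ww s I.1 = ENNReal.ofReal ((n : ℝ) ^ (-s)) := by
    rintro ⟨I, hI⟩
    simp only [Set.mem_preimage, Set.mem_singleton_iff] at hI
    simp [ww, hI]
  rw [tsum_congr this]
  have hf : Finite ((fun I : Ideal (𝓞 F) => Ideal.absNorm I) ⁻¹' {n}) := Ideal.finite_setOfPred_absNorm_eq n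
  rw [ENNReal.tsum_const]
  simp only [c]
  split_ifs with hn
  · subst hn
    rw [Nat.cast_zero, Real.zero_rpow (by linarith)]
    simp
  · rw [ENNReal.ofReal_mul (by positivity), ENNReal.ofReal_natCast]
    congr 1
    rw [ENat.card_eq_coe_natCard]
    rfl

/-- primes of large prime norm -/
def SB (B : ℕ) : Set (Ideal (𝓞 F)) := {P | ∃ p : ℕ, p.Prime ∧ B < p ∧ Ideal.absNorm P = p ∧ Prime P}

lemma absNorm_ge {P : Ideal (𝓞 F)} (hP : Prime P) : ∃ p : ℕ, p.Prime ∧ (p : 𝓞 F) ∈ P ∧ ∃ f, f ≠ 0 ∧ Ideal.absNorm P = p ^ f := by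
  have hp : P.IsPrime := Ideal.isPrime_of_prime hP
  have hb : P ≠ ⊥ := hP.ne_zero
  have h0 : Ideal.absNorm P ≠ 0 := by rwa [Ne, Ideal.absNorm_eq_zero_iff]
  obtain ⟨p, hpp, hpP⟩ : ∃ p : ℕ, p.Prime ∧ (p : 𝓞 F) ∈ P := by
    have hm : ((Ideal.absNorm P : ℕ) : 𝓞 F) ∈ P := Ideal.absNorm_mem P
    have h1 : Ideal.absNorm P ≠ 1 := by rw [Ne, Ideal.absNorm_eq_one_iff]; exact hp.ne_top
    generalize Ideal.absNorm P = n at *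
    induction n using Nat.recOnMul with
    | zero => exact absurd rfl h0
    | one => exact absurd rfl h1
    | prime p hp => exact ⟨p, hp, hm⟩
    | mul a b ha hb =>
      rw [Nat.cast_mul] at hm
      by_cases ha1 : a = 1
      · subst ha1
        rw [one_mul] at h1
        exact hb (by rintro rfl; exact h0 rfl) (by simpa using hm) h1
      by_cases hb1 : b = 1
      · subst hb1
        exact ha (by rintro rfl; exact h0 rfl) (by simpa using hm) ha1
      rcases hp.mem_or_mem hm with h | h
      · exact ha (by rintro rfl; simp at h0) h ha1
      · exact hb (by rintro rfl; simp at h0) h hb1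
  refine ⟨p, hpp, hpP, ?_⟩
  have hd : Ideal.absNorm P ∣ p ^ Module.finrank ℤ (𝓞 F) := by
    have := Ideal.absNorm_dvd_norm_of_mem hpP
    rw [show ((p : ℕ) : 𝓞 F) = algebraMap ℤ (𝓞 F) p by simp, Algebra.norm_algebraMap] at this
    exact_mod_cast this
  obtain ⟨f, -, hf⟩ := (Nat.dvd_prime_pow hpp).1 hd
  refine ⟨f, ?_, hf⟩
  rintro rfl
  rw [pow_zero, Ideal.absNorm_eq_one_iff] at hf
  exact hp.ne_top hf

lemma exists_bound (B : ℕ) : ∃ c : ℝ, ∀ A : Finset (Ideal (𝓞 F)), (∀ P ∈ A, Prime P ∧ P ∉ SB B) →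
    ∑ P ∈ A, ((Ideal.absNorm P : ℝ))⁻¹ ≤ c := by
  classical
  choose! p hp hpP f hf hn using fun (P : Ideal (𝓞 F)) (hP : Prime P) => absNorm_ge hP
  let g : ℕ → ℝ := fun n => (Module.finrank ℚ F : ℝ) * ((B + 1 : ℝ) ^ 2 * ((n : ℝ) ^ 2)⁻¹)
  have hg : Summable g := ((Real.summable_nat_pow_inv.2 (by norm_num)).mul_left _).mul_left _
  have g0 : ∀ n, 0 ≤ g n := fun n => by simp only [g]; positivity
  refine ⟨∑' n, g n, fun A hA => ?_⟩
  have h1 : ∀ P ∈ A, ((Ideal.absNorm P : ℝ))⁻¹ ≤ (B + 1 : ℝ) ^ 2 * ((p P : ℝ) ^ 2)⁻¹ := by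
    intro P hP
    obtain ⟨hP1, hP2⟩ := hA P hP
    have hpos : (0 : ℝ) < p P := by exact_mod_cast (hp P hP1).pos
    have hp1 : (1 : ℝ) ≤ p P := by exact_mod_cast (hp P hP1).one_le
    by_cases h2 : f P = 1
    · have hle : p P ≤ B := by
        by_contra hc
        exact hP2 ⟨p P, hp P hP1, by omega, by rw [hn P hP1, h2, pow_one], hP1⟩
      have hle' : (p P : ℝ) ≤ B + 1 := by have : (p P : ℝ) ≤ B := by exact_mod_cast hle
                                          linarith
      rw [hn P hP1, h2, pow_one, ← div_eq_mul_inv, ← div_pow]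
      have : 1 ≤ ((B + 1 : ℝ) / p P) := by rw [le_div_iff₀ hpos]; linarith
      calc ((p P : ℕ) : ℝ)⁻¹ ≤ 1 := inv_le_one_of_one_le₀ hp1
        _ ≤ _ := one_le_pow₀ this
    · have h3 : 2 ≤ f P := by have := hf P hP1; omega
      rw [hn P hP1]
      push_cast
      calc ((p P : ℝ) ^ f P)⁻¹ ≤ ((p P : ℝ) ^ 2)⁻¹ := by
            apply inv_anti₀ (by positivity)
            exact pow_le_pow_right₀ hp1 h3
        _ ≤ _ := by
            have : (1 : ℝ) ≤ (B + 1) ^ 2 := one_le_pow₀ (by linarith [Nat.cast_nonneg (α := ℝ) B])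
            exact le_mul_of_one_le_left (by positivity) this
  refine (Finset.sum_le_sum h1).trans ?_
  rw [Finset.sum_comp (fun n : ℕ => (B + 1 : ℝ) ^ 2 * ((n : ℝ) ^ 2)⁻¹) p]
  refine le_trans (Finset.sum_le_sum fun n hn' => ?_) (hg.sum_le_tsum (A.image p) (fun n _ => g0 n))
  simp only [g, nsmul_eq_mul]
  refine mul_le_mul_of_nonneg_right ?_ (by positivity)
  obtain ⟨P₀, hP₀, rfl⟩ := Finset.mem_image.1 hn'
  have hq := hp P₀ (hA P₀ hP₀).1
  set q := p P₀
  have : Fact q.Prime := ⟨hq⟩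
  have hmax : (Ideal.span {(q : ℤ)}).IsMaximal :=
    PrincipalIdealRing.isMaximal_of_irreducible (Nat.prime_iff_prime_int.1 hq).irreducible
  have hbot : Ideal.span {(q : ℤ)} ≠ ⊥ := by simp [hq.ne_zero]
  have hle := Ideal.card_primesOverFinset_le_finrank (𝓞 F) ℚ F hbot
  refine Nat.cast_le.2 (le_trans (Finset.card_le_card fun P hP => ?_) hle)
  obtain ⟨hPA, hPq⟩ := Finset.mem_filter.1 hP
  rw [IsDedekindDomain.mem_primesOverFinset_iff hbot]
  have hprime : P.IsPrime := Ideal.isPrime_of_prime (hA P hPA).1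
  refine ⟨hprime, ⟨?_⟩⟩
  refine hmax.eq_of_le (Ideal.IsPrime.ne_top (Ideal.IsPrime.under ℤ P)) ?_
  rw [Ideal.span_singleton_le_iff_mem, Ideal.mem_comap]
  have := hpP P (hA P hPA).1
  rw [hPq] at this
  simpa using this

lemma zS_finset (A : Finset (Ideal (𝓞 F))) (hA : ∀ P ∈ A, Prime P) {s : ℝ} (hs : 1 ≤ s) :
    zS (F := F) (A : Set _) s ≤ ENNReal.ofReal (Real.exp (2 * ∑ P ∈ A, ((Ideal.absNorm P : ℝ))⁻¹)) := by
  classical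
  induction A using Finset.induction_on with
  | empty =>
    unfold zS
    have hsub : Subsingleton (supp (F := F) ((∅ : Finset (Ideal (𝓞 F))) : Set _)) := by
      constructor
      have : ∀ I : supp (F := F) ((∅ : Finset (Ideal (𝓞 F))) : Set _), I.1 = 1 := by
        intro I
        rw [← nf_prod I.2.1]
        have : normalizedFactors I.1 = 0 := Multiset.eq_zero_of_forall_notMem fun P hP => by
          simpa using I.2.2 P hP
        rw [this, Multiset.prod_zero]
      intro I J
      exact Subtype.ext ((this I).trans (this J).symm)
    have hone : (1 : Ideal (𝓞 F)) ∈ supp (F := F) ((∅ : Finset (Ideal (𝓞 F))) : Set _) := by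
      refine ⟨one_ne_zero, fun P hP => ?_⟩
      rw [normalizedFactors_one] at hP
      simp at hP
    rw [tsum_eq_single (⟨1, hone⟩ : supp (F := F) ((∅ : Finset (Ideal (𝓞 F))) : Set _))
      (fun b hb => absurd (Subsingleton.elim _ _) hb)]
    simp [ww]
  | insert P A hPA ih =>
    rw [Finset.coe_insert, Finset.sum_insert hPA]
    refine (zS_insert _ P (hA P (Finset.mem_insert_self _ _)) s).trans ?_
    have ih' := ih fun Q hQ => hA Q (Finset.mem_insert_of_mem hQ)
    have hP := hA P (Finset.mem_insert_self _ _)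
    obtain ⟨p, hp, -, f, hf, hn⟩ := absNorm_ge hP
    have h2 : 2 ≤ Ideal.absNorm P := by
      rw [hn]
      exact hp.two_le.trans (Nat.le_self_pow hf p)
    set N := (Ideal.absNorm P : ℝ) with hN
    have h2' : (2 : ℝ) ≤ N := by rw [hN]; exact_mod_cast h2
    have hx : N ^ (-s) ≤ N⁻¹ := by
      rw [← Real.rpow_neg_one]
      exact Real.rpow_le_rpow_of_exponent_le (by linarith) (by linarith)
    have hx0 : 0 ≤ N ^ (-s) := by positivity
    have hx2 : N⁻¹ ≤ 1 / 2 := by rw [one_div]; exact inv_anti₀ (by norm_num) h2'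
    have : ∑' j : ℕ, (ww s P) ^ j ≤ ENNReal.ofReal (Real.exp (2 * N⁻¹)) := by
      have e : ∀ j : ℕ, (ww s P) ^ j = ENNReal.ofReal ((N ^ (-s)) ^ j) := fun j => by
        rw [ww, ENNReal.ofReal_pow hx0]
      rw [tsum_congr e, ← ENNReal.ofReal_tsum_of_nonneg (fun j => by positivity)
        (summable_geometric_of_lt_one hx0 (by linarith)), tsum_geometric_of_lt_one hx0 (by linarith)]
      apply ENNReal.ofReal_le_ofReal
      have h3 : (1 - N ^ (-s))⁻¹ ≤ 1 + 2 * N ^ (-s) := by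
        rw [inv_le_iff_one_le_mul₀ (by linarith)]
        nlinarith
      have := Real.add_one_le_exp (2 * N⁻¹)
      linarith
    calc _ ≤ ENNReal.ofReal (Real.exp (2 * ∑ P ∈ A, ((Ideal.absNorm P : ℝ))⁻¹)) * ENNReal.ofReal (Real.exp (2 * N⁻¹)) :=
          mul_le_mul' ih' this
      _ = _ := by
        rw [← ENNReal.ofReal_mul (by positivity), ← Real.exp_add]
        congr 2; ring

lemma zS_bound (B : ℕ) : ∃ c : ℝ, 0 ≤ c ∧ ∀ s : ℝ, 1 ≤ s → zS (F := F) (SB B)ᶜ s ≤ ENNReal.ofReal c := by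
  classical
  obtain ⟨c, hc⟩ := exists_bound (F := F) B
  refine ⟨Real.exp (2 * c), by positivity, fun s hs => ?_⟩
  unfold zS
  rw [ENNReal.tsum_eq_iSup_sum]
  refine iSup_le fun A => ?_
  let T : Finset (Ideal (𝓞 F)) := A.biUnion fun I => (normalizedFactors I.1).toFinset
  have hT : ∀ P ∈ T, Prime P ∧ P ∉ SB B := by
    intro P hP
    obtain ⟨I, hI, hPI⟩ := Finset.mem_biUnion.1 hP
    rw [Multiset.mem_toFinset] at hPI
    exact ⟨prime_nf hPI, I.2.2 P hPI⟩
  let φ : A → supp (F := F) (T : Set _) := fun I => ⟨I.1.1, I.1.2.1, fun P hP =>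
    Finset.mem_coe.2 (Finset.mem_biUnion.2 ⟨I.1, I.2, Multiset.mem_toFinset.2 hP⟩)⟩
  have inj : Function.Injective φ := by
    intro I J h
    have := congrArg (fun x => x.1) h
    exact Subtype.ext (Subtype.ext this)
  calc ∑ I ∈ A, ww s I.1 = ∑' I : A, ww s (φ I).1 := by
        rw [tsum_fintype, ← Finset.sum_coe_sort]
    _ ≤ zS (F := F) (T : Set _) s := ENNReal.tsum_comp_le_tsum_of_injective inj (fun I => ww s I.1)
    _ ≤ _ := zS_finset T (fun P hP => (hT P hP).1) hs
    _ ≤ _ := by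
      apply ENNReal.ofReal_le_ofReal
      apply Real.exp_le_exp.2
      have := hc T hT
      linarith

theorem zeta_lemma {F' : Type*} [Field F'] [NumberField F'] (B : ℕ)
    (p₁ p₂ : Ideal (𝓞 F) → Ideal (𝓞 F'))
    (h₁ : ∀ P ∈ SB B, Prime (p₁ P)) (h₂ : ∀ P ∈ SB B, Prime (p₂ P))
    (n₁ : ∀ P ∈ SB B, Ideal.absNorm (p₁ P) = Ideal.absNorm P)
    (n₂ : ∀ P ∈ SB B, Ideal.absNorm (p₂ P) = Ideal.absNorm P)
    (i₁ : ∀ P ∈ SB B, ∀ Q ∈ SB B, p₁ P = p₁ Q → P = Q) (i₂ : ∀ P ∈ SB B, ∀ Q ∈ SB B, p₂ P = p₂ Q → P = Q)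
    (i₃ : ∀ P ∈ SB B, ∀ Q ∈ SB B, p₁ P ≠ p₂ Q) : False := by
  obtain ⟨c, hc0, hc⟩ := zS_bound (F := F) B
  have t1 := (tendsto_sub_one_mul_dedekindZeta_nhdsGT F).norm
  have t2 := (tendsto_sub_one_mul_dedekindZeta_nhdsGT F').norm
  have k1 : 0 < ‖(dedekindZeta_residue F : ℂ)‖ := by
    simpa using (dedekindZeta_residue_pos F).ne'
  have k2 : 0 < ‖(dedekindZeta_residue F' : ℂ)‖ := by
    simpa using (dedekindZeta_residue_pos F').ne'
  have t3 : Tendsto (fun s : ℝ => c ^ 2 * (s - 1) * ‖((s : ℂ) - 1) * dedekindZeta F' s‖) (𝓝[>] 1)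
      (𝓝 (c ^ 2 * (1 - 1) * ‖(dedekindZeta_residue F' : ℂ)‖)) := by
    refine Tendsto.mul (Tendsto.mul tendsto_const_nhds ?_) t2
    exact ((continuous_id.sub continuous_const).tendsto (1 : ℝ)).mono_left nhdsWithin_le_nhds
  have key : ∀ᶠ s : ℝ in 𝓝[>] 1, ‖((s : ℂ) - 1) * dedekindZeta F s‖ ^ 2 ≤
      c ^ 2 * (s - 1) * ‖((s : ℂ) - 1) * dedekindZeta F' s‖ := by
    filter_upwards [t1.eventually (lt_mem_nhds k1), t2.eventually (lt_mem_nhds k2), self_mem_nhdsWithin] with s hs1 hs2 hs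
    have hs : 1 < s := hs
    have z1 : dedekindZeta F s ≠ 0 := by
      intro h; rw [h] at hs1; simp at hs1
    have z2 : dedekindZeta F' s ≠ 0 := by
      intro h; rw [h] at hs2; simp at hs2
    have e1 := zS_univ_eq (F := F) (by linarith) z1
    have e2 := zS_univ_eq (F := F') (by linarith) z2
    have a1 := zS_split (F := F) (SB B) s
    have a2 := zS_pair (SB B) p₁ p₂ h₁ h₂ n₁ n₂ i₁ i₂ i₃ s
    have a3 : zS (F := F) Set.univ s * zS (F := F) Set.univ s ≤
        (ENNReal.ofReal c * ENNReal.ofReal c) * zS (F := F') Set.univ s := by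
      have a4 : zS (F := F) Set.univ s ≤ ENNReal.ofReal c * zS (F := F) (SB B) s := by
        rw [mul_comm]
        exact a1.trans (mul_le_mul' le_rfl (hc s hs.le))
      calc _ ≤ (ENNReal.ofReal c * zS (F := F) (SB B) s) * (ENNReal.ofReal c * zS (F := F) (SB B) s) := mul_le_mul' a4 a4
        _ = (ENNReal.ofReal c * ENNReal.ofReal c) * (zS (F := F) (SB B) s * zS (F := F) (SB B) s) := by ring
        _ ≤ _ := mul_le_mul' le_rfl a2
    rw [e1, e2, ← ENNReal.ofReal_mul (by positivity), ← ENNReal.ofReal_mul hc0,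
      ← ENNReal.ofReal_mul (by positivity), ENNReal.ofReal_le_ofReal_iff (by positivity)] at a3
    rw [norm_mul, norm_mul, show ((s : ℂ) - 1) = ((s - 1 : ℝ) : ℂ) by push_cast; rfl, Complex.norm_real,
      Real.norm_of_nonneg (by linarith)]
    have : 0 ≤ (s - 1) ^ 2 := by positivity
    nlinarith [mul_le_mul_of_nonneg_left a3 this]
  have := le_of_tendsto_of_tendsto (t1.pow 2) t3 key
  have h4 := pow_pos k1 2
  simp only [sub_self, mul_zero, zero_mul] at this
  linarith

end N2
end Vas

open NumberField

namespace Vas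
section N3

lemma int_in_prime {S : Type*} [CommRing S] {Q : Ideal S} (hQ : Q.IsPrime) {p : ℕ} (hp : p.Prime)
    (hpQ : (p : S) ∈ Q) {n : ℤ} (hn : (n : S) ∈ Q) : (p : ℤ) ∣ n := by
  by_contra hc
  have h1 : IsCoprime (p : ℤ) n := (Nat.prime_iff_prime_int.1 hp).coprime_iff_not_dvd.2 hc
  obtain ⟨u, v, huv⟩ := h1
  apply hQ.ne_top
  rw [Ideal.eq_top_iff_one]
  have : (1 : S) = u * p + v * n := by exact_mod_cast congrArg (Int.cast (R := S)) huv.symm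
  rw [this]
  exact Q.add_mem (Q.mul_mem_left _ hpQ) (Q.mul_mem_left _ hn)

lemma prime_field {T : Type*} [CommRing T] [IsDomain T] {p : ℕ} [Fact p.Prime] [CharP T p] {x : T}
    (hx : x ^ p = x) : ∃ a : ZMod p, x = ZMod.castHom (dvd_refl p) T a := by
  have hinj := IsFractionRing.injective T (FractionRing T)
  haveI : CharP (FractionRing T) p := charP_of_injective_algebraMap hinj p
  have h1 : algebraMap T (FractionRing T) x ∈ (⊥ : Subfield (FractionRing T)) := by
    exact (Subfield.mem_bot_iff_pow_eq_self (FractionRing T) p).2 (by rw [← map_pow, hx])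
  rw [← ZMod.fieldRange_castHom_eq_bot p] at h1
  obtain ⟨a, ha⟩ := h1
  refine ⟨a, hinj ?_⟩
  rw [← ha, ← RingHom.comp_apply]
  exact congrArg (fun f : ZMod p →+* FractionRing T => f a) (RingHom.ext_zmod _ _)

lemma charP_quot {S : Type*} [CommRing S] {Q : Ideal S} (hQ : Q.IsPrime) {p : ℕ} (hp : p.Prime)
    (hpQ : (p : S) ∈ Q) : CharP (S ⧸ Q) p := by
  have : (p : S ⧸ Q) = 0 := by
    rw [← map_natCast (Ideal.Quotient.mk Q)]
    exact Ideal.Quotient.eq_zero_iff_mem.2 hpQ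
  exact (CharP.charP_iff_prime_eq_zero hp).2 this

lemma frob_int {S : Type*} [CommRing S] {Q : Ideal S} (hQ : Q.IsPrime) {p : ℕ} (hp : p.Prime)
    (hpQ : (p : S) ∈ Q) {x : S} (hx : x ^ p - x ∈ Q) : ∃ k : ℤ, x - k ∈ Q := by
  have : Fact p.Prime := ⟨hp⟩
  have hc := charP_quot hQ hp hpQ
  obtain ⟨a, ha⟩ := prime_field (T := S ⧸ Q) (p := p) (x := Ideal.Quotient.mk Q x) (by
    rw [← map_pow, Ideal.Quotient.eq]; exact hx)
  refine ⟨(a.val : ℤ), ?_⟩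
  rw [← Ideal.Quotient.eq, ha]
  conv_lhs => rw [← ZMod.natCast_zmod_val a]
  rw [map_natCast, Int.cast_natCast, map_natCast]

lemma card_le_of_pow {T : Type*} [CommRing T] [IsDomain T] {p : ℕ} [Fact p.Prime] [CharP T p]
    (h : ∀ x : T, x ^ p = x) : Nat.card T ≤ p := by
  calc Nat.card T ≤ Nat.card (ZMod p) := Nat.card_le_card_of_surjective (ZMod.castHom (dvd_refl p) T)
        (fun x => by obtain ⟨a, ha⟩ := prime_field (p := p) (h x); exact ⟨a, ha.symm⟩)
    _ = p := by simp

lemma comap_norm {F L : Type*} [Field F] [NumberField F] [Field L] [NumberField L]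
    (ρ : 𝓞 F →+* 𝓞 L) {Q : Ideal (𝓞 L)} (hQ : Q.IsPrime) {p : ℕ} (hp : p.Prime) (hpQ : (p : 𝓞 L) ∈ Q)
    (h : ∀ x, ρ x ^ p - ρ x ∈ Q) : Prime (Q.comap ρ) ∧ Ideal.absNorm (Q.comap ρ) = p := by
  have hpr : (Q.comap ρ).IsPrime := Ideal.IsPrime.comap ρ
  have hpm : (p : 𝓞 F) ∈ Q.comap ρ := by rw [Ideal.mem_comap, map_natCast]; exact hpQ
  have hne : Q.comap ρ ≠ ⊥ := by
    intro h0
    rw [h0, Ideal.mem_bot] at hpm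
    exact hp.ne_zero (by exact_mod_cast hpm)
  have hprime : Prime (Q.comap ρ) := Ideal.prime_of_isPrime hne hpr
  refine ⟨hprime, ?_⟩
  obtain ⟨q, hq, hqm, f, hf, hn⟩ := absNorm_ge hprime
  have hpq : p = q := by
    have := int_in_prime hpr hp hpm (n := (q : ℤ)) (by exact_mod_cast hqm)
    exact (Nat.prime_dvd_prime_iff_eq hp hq).1 (by exact_mod_cast this)
  subst hpq
  have hle : Ideal.absNorm (Q.comap ρ) ≤ p := by
    have : Fact p.Prime := ⟨hp⟩
    have hc := charP_quot hpr hp hpm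
    rw [Ideal.absNorm_apply, Submodule.cardQuot_apply]
    refine card_le_of_pow (T := 𝓞 F ⧸ Q.comap ρ) (p := p) fun x => ?_
    obtain ⟨y, rfl⟩ := Ideal.Quotient.mk_surjective x
    rw [← map_pow, Ideal.Quotient.eq, Ideal.mem_comap, map_sub, map_pow]
    exact h y
  rw [hn] at hle ⊢
  have : p ^ f ≤ p ^ 1 := by rwa [pow_one]
  have := (Nat.pow_le_pow_iff_right hp.one_lt).1 this
  rw [show f = 1 by omega, pow_one]

lemma dvd_norm {L : Type*} [Field L] [NumberField L] (δ : 𝓞 L) : δ ∣ ((Algebra.norm ℤ δ : ℤ) : 𝓞 L) := by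
  have := Ideal.absNorm_mem (Ideal.span {δ})
  rw [Ideal.absNorm_span_singleton, Ideal.mem_span_singleton] at this
  rcases Int.natAbs_eq (Algebra.norm ℤ δ) with h | h
  · rw [h, Int.cast_natCast]; exact this
  · rw [h, Int.cast_neg, dvd_neg, Int.cast_natCast]; exact this

theorem AL {L : Type*} [Field L] [NumberField L] [IsGalois ℚ L] (H' H : Subgroup (L ≃ₐ[ℚ] L))
    (hle : H' ≤ H) (h : L ≃ₐ[ℚ] L) (hH : h ∈ H) (hH' : h ∉ H') (B : ℕ) :
    ∃ p : ℕ, p.Prime ∧ B < p ∧ ∃ Q : Ideal (𝓞 L), Q.IsPrime ∧ (p : 𝓞 L) ∈ Q ∧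
      ∃ φ ∈ H, φ ∉ H' ∧ ∀ x : 𝓞 L, φ • x - x ^ p ∈ Q := by
  by_contra hneg
  push Not at hneg
  let F := IntermediateField.fixedField H
  let F' := IntermediateField.fixedField H'
  have hFF : F ≤ F' := IntermediateField.fixedField_le hle
  have hfix : ∀ g ∈ H, ∀ y : F, g y = y := fun g hg y => y.2 ⟨g, hg⟩
  have hfix' : ∀ g ∈ H', ∀ y : F', g y = y := fun g hg y => y.2 ⟨g, hg⟩
  have fixO : ∀ g ∈ H, ∀ y : 𝓞 F, g • algebraMap (𝓞 F) (𝓞 L) y = algebraMap (𝓞 F) (𝓞 L) y :=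
    fun g hg y => RingOfIntegers.ext (hfix g hg y)
  have fixO' : ∀ g ∈ H', ∀ y : 𝓞 F', g • algebraMap (𝓞 F') (𝓞 L) y = algebraMap (𝓞 F') (𝓞 L) y :=
    fun g hg y => RingOfIntegers.ext (hfix' g hg y)
  haveI : SMulCommClass H (𝓞 F) (𝓞 L) := ⟨fun g y x => by
    rw [Algebra.smul_def, Algebra.smul_def, smul_mul']
    congr 1
    exact fixO g.1 g.2 y⟩
  haveI : Algebra.IsInvariant (𝓞 F) (𝓞 L) H := ⟨fun b hb => by
    have : (b : L) ∈ F := by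
      rintro ⟨g, hg⟩
      exact congrArg (algebraMap (𝓞 L) L) (hb ⟨g, hg⟩)
    have hIntg : IsIntegral ℤ (⟨(b : L), this⟩ : F) := by
      have h1 := RingOfIntegers.isIntegral_coe b
      exact (isIntegral_algHom_iff ((IntermediateField.val F).restrictScalars ℤ) (IntermediateField.val F).injective).1 h1
    exact ⟨⟨_, hIntg⟩, RingOfIntegers.ext rfl⟩⟩
  obtain ⟨θ, hθ⟩ : ∃ θ : 𝓞 F', h • algebraMap (𝓞 F') (𝓞 L) θ ≠ algebraMap (𝓞 F') (𝓞 L) θ := by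
    by_contra hc
    push Not at hc
    apply hH'
    rw [← IntermediateField.fixingSubgroup_fixedField H']
    rw [IntermediateField.mem_fixingSubgroup_iff]
    intro x hx
    obtain ⟨y, z, hz, hyz⟩ := IsFractionRing.div_surjective (A := 𝓞 F') (⟨x, hx⟩ : F')
    have hy' : h ((y : F') : L) = ((y : F') : L) := congrArg (algebraMap (𝓞 L) L) (hc y)
    have hz' : h ((z : F') : L) = ((z : F') : L) := congrArg (algebraMap (𝓞 L) L) (hc z)
    have hx' : x = ((y : F') : L) / ((z : F') : L) := by
      have := congrArg (algebraMap F' L) hyz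
      rw [map_div₀] at this
      exact this.symm
    rw [hx', map_div₀, hy', hz']
  let ι : 𝓞 F →+* 𝓞 F' := RingOfIntegers.mapRingHom (IntermediateField.inclusion hFF)
  have hι : ∀ y, algebraMap (𝓞 F') (𝓞 L) (ι y) = algebraMap (𝓞 F) (𝓞 L) y := fun y =>
    RingOfIntegers.ext rfl
  let ρ₁ : 𝓞 F' →+* 𝓞 L := algebraMap (𝓞 F') (𝓞 L)
  let ρ₂ : 𝓞 F' →+* 𝓞 L := (MulSemiringAction.toRingHom (L ≃ₐ[ℚ] L) (𝓞 L) h).comp ρ₁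
  have hρ₂ : ∀ x, ρ₂ x = h • ρ₁ x := fun x => rfl
  let δ : 𝓞 L := h • ρ₁ θ - ρ₁ θ
  have hδ : δ ≠ 0 := sub_ne_zero.2 hθ
  let n₀ := Algebra.norm ℤ δ
  have hn₀ : n₀ ≠ 0 := Algebra.norm_ne_zero_iff.2 hδ
  let B' := max B n₀.natAbs
  have key : ∀ P ∈ SB (F := F) B', ∃ Q : Ideal (𝓞 L), Q.IsPrime ∧ Q.comap (algebraMap (𝓞 F) (𝓞 L)) = P ∧
      (Prime (Q.comap ρ₁) ∧ Ideal.absNorm (Q.comap ρ₁) = Ideal.absNorm P) ∧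
      (Prime (Q.comap ρ₂) ∧ Ideal.absNorm (Q.comap ρ₂) = Ideal.absNorm P) ∧ Q.comap ρ₁ ≠ Q.comap ρ₂ := by
    rintro P ⟨p, hp, hBp, hPn, hP⟩
    have hPp : P.IsPrime := Ideal.isPrime_of_prime hP
    obtain ⟨Q, -, hQ, hQP⟩ := Ideal.exists_ideal_over_prime_of_isIntegral (S := 𝓞 L) P ⊥ (by
      rw [← RingHom.ker_eq_comap_bot, (RingHom.injective_iff_ker_eq_bot _).1
        (FaithfulSMul.algebraMap_injective (𝓞 F) (𝓞 L))]
      exact bot_le)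
    have hpQ : (p : 𝓞 L) ∈ Q := by
      have : (p : 𝓞 F) ∈ P := by rw [← hPn]; exact Ideal.absNorm_mem P
      rw [← hQP, Ideal.mem_comap, map_natCast] at this
      exact this
    have hQb : Q ≠ ⊥ := by
      intro h0
      rw [h0, Ideal.mem_bot] at hpQ
      exact hp.ne_zero (by exact_mod_cast hpQ)
    have : Finite (𝓞 L ⧸ Q) := Ideal.finiteQuotientOfFreeOfNeBot _ hQb
    obtain ⟨φ, hφ⟩ := IsArithFrobAt.exists_of_isInvariant (𝓞 F) H Q
    have hφ2 : ∀ x : 𝓞 L, φ.1 • x - x ^ p ∈ Q := by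
      intro x
      have := hφ x
      have hcard : Nat.card (𝓞 F ⧸ Q.under (𝓞 F)) = p := by
        rw [← hPn, ← hQP, Ideal.absNorm_apply, Submodule.cardQuot_apply]
      rw [hcard] at this
      exact this
    have hBp1 : B < p := lt_of_le_of_lt (le_max_left _ _) hBp
    have hφH' : φ.1 ∈ H' := by
      by_contra hc
      obtain ⟨x, hx⟩ := hneg p hp hBp1 Q hQ hpQ φ.1 φ.2 hc
      exact hx (hφ2 x)
    have hψH' : h⁻¹ * φ.1 * h ∈ H' := by
      by_contra hc
      let τ := MulSemiringAction.toRingHom (L ≃ₐ[ℚ] L) (𝓞 L) h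
      have hQ' : (Q.comap τ).IsPrime := Ideal.IsPrime.comap τ
      obtain ⟨x, hx⟩ := hneg p hp hBp1 (Q.comap τ) hQ' (by rw [Ideal.mem_comap, map_natCast]; exact hpQ)
        (h⁻¹ * φ.1 * h) (H.mul_mem (H.mul_mem (H.inv_mem hH) φ.2) hH) hc
      apply hx
      rw [Ideal.mem_comap]
      change h • ((h⁻¹ * φ.1 * h) • x - x ^ p) ∈ Q
      rw [smul_sub, smul_pow', smul_smul, ← mul_assoc, ← mul_assoc, mul_inv_cancel, one_mul, mul_smul]
      exact hφ2 (h • x)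
    have f1 : ∀ x, ρ₁ x ^ p - ρ₁ x ∈ Q := by
      intro x
      have := hφ2 (ρ₁ x)
      rw [fixO' _ hφH' x] at this
      rw [← neg_sub]
      exact Q.neg_mem this
    have f2 : ∀ x, ρ₂ x ^ p - ρ₂ x ∈ Q := by
      intro x
      have := hφ2 (ρ₂ x)
      have e : φ.1 • ρ₂ x = ρ₂ x := by
        rw [hρ₂]
        conv_rhs => rw [show ρ₁ x = (h⁻¹ * φ.1 * h) • ρ₁ x from (fixO' _ hψH' x).symm]
        rw [smul_smul, smul_smul]
        congr 1
        group
      rw [e] at this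
      rw [← neg_sub]
      exact Q.neg_mem this
    obtain ⟨c1, c2⟩ := comap_norm ρ₁ hQ hp hpQ f1
    obtain ⟨c3, c4⟩ := comap_norm ρ₂ hQ hp hpQ f2
    refine ⟨Q, hQ, hQP, ⟨c1, c2.trans hPn.symm⟩, ⟨c3, c4.trans hPn.symm⟩, fun heq => ?_⟩
    obtain ⟨k, hk⟩ := frob_int hQ hp hpQ (f1 θ)
    have m1 : θ - (k : 𝓞 F') ∈ Q.comap ρ₁ := by
      rw [Ideal.mem_comap, map_sub, map_intCast]; exact hk
    have m2 := m1
    rw [heq, Ideal.mem_comap, map_sub, map_intCast] at m2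
    have m3 : δ ∈ Q := by
      have := Q.sub_mem m2 hk
      rwa [sub_sub_sub_cancel_right] at this
    have m4 : ((n₀ : ℤ) : 𝓞 L) ∈ Q := by
      exact Ideal.mem_of_dvd _ (dvd_norm δ) m3
    have := int_in_prime hQ hp hpQ m4
    have h5 := Int.natAbs_dvd_natAbs.2 this
    have h6 := Nat.le_of_dvd (Int.natAbs_pos.2 hn₀) h5
    have : n₀.natAbs < p := lt_of_le_of_lt (le_max_right _ _) hBp
    simp at h6
    omega
  choose! q hq hqP h1 h2 h3 using key
  have r1 : ∀ P ∈ SB (F := F) B', ((q P).comap ρ₁).comap ι = P := by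
    intro P hP
    conv_rhs => rw [← hqP P hP]
    ext y
    rw [Ideal.mem_comap, Ideal.mem_comap, Ideal.mem_comap, ← hι]
  have r2 : ∀ P ∈ SB (F := F) B', ((q P).comap ρ₂).comap ι = P := by
    intro P hP
    conv_rhs => rw [← hqP P hP]
    ext y
    rw [Ideal.mem_comap, Ideal.mem_comap, Ideal.mem_comap, hρ₂]
    change h • algebraMap (𝓞 F') (𝓞 L) (ι y) ∈ _ ↔ _
    rw [hι, fixO h hH]
  refine zeta_lemma (F := F) (F' := F') B' (fun P => (q P).comap ρ₁) (fun P => (q P).comap ρ₂)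
    (fun P hP => (h1 P hP).1) (fun P hP => (h2 P hP).1) (fun P hP => (h1 P hP).2) (fun P hP => (h2 P hP).2)
    ?_ ?_ ?_
  · intro P hP P' hP' e
    have := congrArg (Ideal.comap ι) e
    simp only [r1 P hP, r1 P' hP'] at this
    exact this
  · intro P hP P' hP' e
    have := congrArg (Ideal.comap ι) e
    simp only [r2 P hP, r2 P' hP'] at this
    exact this
  · intro P hP P' hP' e
    have := congrArg (Ideal.comap ι) e
    simp only [r1 P hP, r2 P' hP'] at this
    subst this
    exact h3 P hP e

end N3
end Vas

open NumberField

namespace Vas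
section N4
open IntermediateField

theorem IL {L : Type*} [Field L] [NumberField L] [IsGalois ℚ L] {q : ℕ} (hq : q.Prime) (k : ℕ) {ζ : L}
    (hζ : IsPrimitiveRoot ζ (q ^ (k + 1))) {Q : Ideal (𝓞 L)} (hQ : Q.IsPrime) (hqQ : (q : 𝓞 L) ∈ Q)
    (u : (ZMod (q ^ (k + 1)))ˣ) :
    ∃ σ : L ≃ₐ[ℚ] L, (∀ x : 𝓞 L, σ • x - x ∈ Q) ∧
      (haveI : NeZero (q ^ (k + 1)) := ⟨pow_ne_zero _ hq.ne_zero⟩; hζ.autToPow ℚ σ = u) := by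
  haveI : Fact q.Prime := ⟨hq⟩
  haveI hne : NeZero (q ^ (k + 1)) := ⟨pow_ne_zero _ hq.ne_zero⟩
  let F : IntermediateField ℚ L := adjoin ℚ {ζ}
  haveI : IsCyclotomicExtension {q ^ (k + 1)} ℚ F := hζ.intermediateField_adjoin_isCyclotomicExtension ℚ
  have hmax : (Ideal.span {(q : ℤ)}).IsMaximal :=
    PrincipalIdealRing.isMaximal_of_irreducible (Nat.prime_iff_prime_int.1 hq).irreducible
  haveI : (Ideal.span {(q : ℤ)}).IsPrime := hmax.isPrime
  have hbot : Ideal.span {(q : ℤ)} ≠ ⊥ := by simp [hq.ne_zero]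
  haveI : Q.LiesOver (Ideal.span {(q : ℤ)}) := ⟨by
    refine hmax.eq_of_le (Ideal.IsPrime.ne_top (Ideal.IsPrime.under ℤ Q)) ?_
    rw [Ideal.span_singleton_le_iff_mem, Ideal.mem_comap]
    simpa using hqQ⟩
  let P := Q.under (𝓞 F)
  haveI : P.IsPrime := Ideal.IsPrime.under (𝓞 F) Q
  haveI : P.LiesOver (Ideal.span {(q : ℤ)}) := inferInstance
  haveI : IsGalois ℚ F := IsCyclotomicExtension.isGalois {q ^ (k + 1)} ℚ F
  have hPbot : P ≠ ⊥ := Ideal.ne_bot_of_liesOver_of_ne_bot hbot P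
  haveI : P.IsMaximal := Ideal.IsPrime.isMaximal inferInstance hPbot
  have e1 := Ideal.ramificationIdxIn_mul_ramificationIdxIn (p := Ideal.span {(q : ℤ)}) P Gal(F/ℚ) (𝓞 L) Gal(L/ℚ) Gal(L/F)
  rw [IsCyclotomicExtension.Rat.ramificationIdxIn_eq_of_prime_pow q k F] at e1
  haveI : Finite (ℤ ⧸ Ideal.span {(q : ℤ)}) := Ideal.finiteQuotientOfFreeOfNeBot _ hbot
  haveI : Finite (𝓞 F ⧸ P) := Ideal.finiteQuotientOfFreeOfNeBot _ hPbot
  have e2 := Ideal.card_inertia_eq_ramificationIdxIn (G := Gal(L/ℚ)) (Ideal.span {(q : ℤ)}) Q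
  have e3 := Ideal.card_inertia_eq_ramificationIdxIn (G := Gal(L/F)) P Q
  rw [← e2, ← e3] at e1
  let χ : Q.inertia Gal(L/ℚ) →* (ZMod (q ^ (k + 1)))ˣ := (hζ.autToPow ℚ).comp (Subgroup.subtype _)
  have hker : Nat.card χ.ker ≤ Nat.card (Q.inertia Gal(L/F)) := by
    have hfix : ∀ σ : χ.ker, ∀ y : F, σ.1.1 (y : L) = y := by
      rintro ⟨⟨σ, hσ⟩, hσ2⟩ y
      have hsp := hζ.autToPow_spec ℚ σ
      rw [show hζ.autToPow ℚ σ = 1 from hσ2] at hsp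
      have : F ≤ fixedField (Subgroup.zpowers σ) := by
        refine adjoin_le_iff.2 ?_
        rw [Set.singleton_subset_iff]
        rintro ⟨g, hg⟩
        have hs : σ ζ = ζ := by
          rw [← hsp]
          rcases Nat.lt_or_ge 1 (q ^ (k + 1)) with h1 | h1
          · rw [Units.val_one, ZMod.val_one'' h1.ne', pow_one]
          · exact absurd (Nat.one_lt_pow (Nat.succ_ne_zero k) hq.one_lt) (not_lt.2 h1)
        obtain ⟨n, rfl⟩ := Subgroup.mem_zpowers_iff.1 hg
        have : σ ∈ MulAction.stabilizer (L ≃ₐ[ℚ] L) ζ := hs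
        exact (MulAction.stabilizer (L ≃ₐ[ℚ] L) ζ).zpow_mem this n
      exact this y.2 ⟨σ, Subgroup.mem_zpowers σ⟩
    let f : χ.ker → Q.inertia Gal(L/F) := fun σ =>
      ⟨{ σ.1.1 with commutes' := fun y => hfix σ y }, fun x => σ.1.2 x⟩
    refine Nat.card_le_card_of_injective f ?_
    intro σ τ h
    have h2 : ∀ x : L, σ.1.1 x = τ.1.1 x := fun x =>
      congrArg (fun g : Q.inertia Gal(L/F) => g.1 x) h
    exact Subtype.ext (Subtype.ext (AlgEquiv.ext h2))
  have hsurj : Function.Surjective χ := by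
    rw [← MonoidHom.range_eq_top]
    apply Subgroup.eq_top_of_le_card
    rw [Nat.card_eq_fintype_card, ZMod.card_units_eq_totient, Nat.totient_prime_pow_succ hq]
    have e4 := Subgroup.card_mul_index χ.ker
    rw [Subgroup.index_ker] at e4
    rw [← e4] at e1
    have hpos : 0 < Nat.card χ.ker := Nat.card_pos
    have h5 : q ^ k * (q - 1) * Nat.card χ.ker ≤ Nat.card χ.range * Nat.card χ.ker := by
      calc _ ≤ q ^ k * (q - 1) * Nat.card (Q.inertia Gal(L/F)) := Nat.mul_le_mul_left _ hker
        _ = _ := by rw [e1, mul_comm]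
    exact Nat.le_of_mul_le_mul_right h5 hpos
  obtain ⟨σ, hσ⟩ := hsurj u
  exact ⟨σ.1, fun x => σ.2 x, hσ⟩

end N4
end Vas

open NumberField

namespace Vas
section N5
variable {K : Type*} [Field K] [NumberField K]
variable {L : Type*} [Field L] [NumberField L]

/-- Restriction of an embedding to the rings of integers. -/
def tO (τ : K →ₐ[ℚ] L) : 𝓞 K →+* 𝓞 L := RingOfIntegers.mapRingHom τ.toRingHom

lemma tO_coe (τ : K →ₐ[ℚ] L) (x : 𝓞 K) : ((tO τ x : 𝓞 L) : L) = τ (x : K) := rfl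

lemma smul_tO (σ : L ≃ₐ[ℚ] L) (τ : K →ₐ[ℚ] L) (x : 𝓞 K) :
    σ • tO τ x = tO (σ.toAlgHom.comp τ) x := rfl

lemma exists_primitive_tO : ∃ θ : 𝓞 K, ∀ (L : Type) [Field L] [NumberField L] (τ τ' : K →ₐ[ℚ] L),
    tO τ θ = tO τ' θ → τ = τ' := by
  obtain ⟨θ, hθ⟩ := exists_primitive (K := K)
  refine ⟨θ, fun L _ _ τ τ' h => ?_⟩
  obtain ⟨ι⟩ : Nonempty (L →+* ℂ) := inferInstance
  have h2 : ι.toRatAlgHom.comp τ = ι.toRatAlgHom.comp τ' := by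
    apply hθ
    have := congrArg (fun x : 𝓞 L => ι (x : L)) h
    exact this
  ext x
  have := DFunLike.congr_fun h2 x
  exact ι.injective this

lemma sepD : ∃ θ : 𝓞 K, ∃ D : ℤ, D ≠ 0 ∧ ∀ (L : Type) [Field L] [NumberField L] (τ τ' : K →ₐ[ℚ] L),
    τ ≠ τ' → (tO τ θ - tO τ' θ) ∣ ((D : ℤ) : 𝓞 L) := by
  obtain ⟨θ, hθ⟩ := exists_primitive_tO (K := K)
  set f := minpoly ℤ θ with hf
  have hIntg : IsIntegral ℤ θ := RingOfIntegers.isIntegral θ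
  set δ := Polynomial.aeval θ (Polynomial.derivative f) with hδ
  have hδ0 : δ ≠ 0 := by
    intro h0
    have h1 : (minpoly ℚ (θ : K)) = f.map (algebraMap ℤ ℚ) := by
      rw [hf]
      have := minpoly.isIntegrallyClosed_eq_field_fractions (R := ℤ) ℚ K hIntg
      exact this
    have h2 : (minpoly ℚ (θ : K)).Separable :=
      (minpoly.irreducible (Algebra.IsIntegral.isIntegral (θ:K))).separable
    have h3 := h2.aeval_derivative_ne_zero (minpoly.aeval ℚ (θ : K))
    rw [h1, Polynomial.derivative_map, Polynomial.aeval_map_algebraMap] at h3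
    apply h3
    have := congrArg (algebraMap (𝓞 K) K) h0
    rw [hδ, map_zero, ← Polynomial.aeval_algebraMap_apply] at this
    exact this
  refine ⟨θ, Algebra.norm ℤ δ, by rwa [Ne, Algebra.norm_eq_zero_iff], fun L _ _ τ τ' hne => ?_⟩
  have h1 : tO τ δ ∣ ((Algebra.norm ℤ δ : ℤ) : 𝓞 L) := by
    have := map_dvd (tO τ) (dvd_norm δ)
    rwa [map_intCast] at this
  refine dvd_trans ?_ h1
  set x := tO τ θ
  set y := tO τ' θ
  have hxy : y ≠ x := fun h => hne (hθ L _ _ h.symm)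
  set F := f.map (algebraMap ℤ (𝓞 L)) with hF
  have ev : ∀ (ρ : K →ₐ[ℚ] L) (g : Polynomial ℤ), (g.map (algebraMap ℤ (𝓞 L))).eval (tO ρ θ) = tO ρ (Polynomial.aeval θ g) := by
    intro ρ g
    rw [Polynomial.aeval_def, Polynomial.hom_eval₂, Polynomial.eval_map]
    congr 1
    exact RingHom.ext_int _ _
  have hx : F.IsRoot x := by
    rw [Polynomial.IsRoot, hF, ev, hf, minpoly.aeval, map_zero]
  have hy : F.IsRoot y := by
    rw [Polynomial.IsRoot, hF, ev, hf, minpoly.aeval, map_zero]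
  obtain ⟨g, hg⟩ := Polynomial.dvd_iff_isRoot.2 hx
  have hgy : g.eval y = 0 := by
    rw [Polynomial.IsRoot, hg, Polynomial.eval_mul] at hy
    rcases mul_eq_zero.1 hy with h | h
    · simp [sub_eq_zero] at h; exact absurd h hxy
    · exact h
  have hgx : tO τ δ = g.eval x := by
    rw [hδ, ← ev, ← Polynomial.derivative_map, ← hF, hg]
    simp [Polynomial.derivative_mul]
    simp [x]
  rw [hgx]
  have := Polynomial.sub_dvd_eval_sub x y g
  rwa [hgy, sub_zero] at this

lemma root_cong {S : Type*} [CommRing S] [IsDomain S] {Q : Ideal S} (hQ : Q.IsPrime) {x y : S} {k : ℕ}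
    (h : x ^ k = y ^ k) (hxy : x - y ∈ Q) (hx : x ∉ Q) (hk : (k : S) ∉ Q) : x = y := by
  by_contra hne
  have h1 := (Commute.all x y).geom_sum₂_mul k
  rw [h, sub_self, mul_eq_zero] at h1
  rcases h1 with h1 | h1
  · have h2 : Ideal.Quotient.mk Q y = Ideal.Quotient.mk Q x := by
      rw [eq_comm, ← sub_eq_zero, ← map_sub, Ideal.Quotient.eq_zero_iff_mem]; exact hxy
    have h3 := congrArg (Ideal.Quotient.mk Q) h1
    rw [map_sum, map_zero] at h3
    have h4 : ∀ i ∈ Finset.range k, Ideal.Quotient.mk Q (x ^ i * y ^ (k - 1 - i)) = Ideal.Quotient.mk Q (x ^ (k - 1)) := by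
      intro i hi
      rw [map_mul, map_pow, map_pow, h2, ← pow_add, ← map_pow]
      congr 2
      have := Finset.mem_range.1 hi; omega
    rw [Finset.sum_congr rfl h4, Finset.sum_const, Finset.card_range, nsmul_eq_mul, ← map_natCast (Ideal.Quotient.mk Q), ← map_mul,
      Ideal.Quotient.eq_zero_iff_mem] at h3
    rcases hQ.mem_or_mem h3 with h5 | h5
    · exact hk h5
    · exact hx (hQ.mem_of_pow_mem _ h5)
  · exact hne (sub_eq_zero.1 h1)

/-- The Galois closure used in the arguments. -/
structure Setup (a : 𝓞 K) (l n : ℕ) (L : Type) [Field L] [NumberField L] where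
  ι : L →ₐ[ℚ] AlgebraicClosure ℚ
  surj : ∀ φ : K →ₐ[ℚ] AlgebraicClosure ℚ, ∃ τ : K →ₐ[ℚ] L, ι.comp τ = φ
  α : (K →ₐ[ℚ] L) → 𝓞 L
  hα : ∀ τ, α τ ^ l = tO τ a
  ζ : 𝓞 L
  hζ : IsPrimitiveRoot ζ n
  ω : 𝓞 L
  hω : IsPrimitiveRoot ω l

lemma exists_setup (a : 𝓞 K) {l n : ℕ} (hl : l ≠ 0) (hn : n ≠ 0) :
    ∃ (L : Type) (_ : Field L) (_ : NumberField L) (_ : IsGalois ℚ L), Nonempty (Setup a l n L) := by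
  haveI : NeZero l := ⟨hl⟩
  haveI : NeZero n := ⟨hn⟩
  let Ω := AlgebraicClosure ℚ
  haveI hΩa : Algebra.IsAlgebraic ℚ Ω := by
    have h0 : @Algebra.IsAlgebraic ℚ (AlgebraicClosure ℚ) _ _ (AlgebraicClosure.instAlgebra (k := ℚ)) := AlgebraicClosure.isAlgebraic ℚ
    convert h0; exact Subsingleton.elim _ _
  haveI : Algebra.IsIntegral ℚ Ω := Algebra.IsAlgebraic.isIntegral
  haveI : IsAlgClosure ℚ Ω := ⟨inferInstance, hΩa⟩
  haveI : Normal ℚ Ω := IsAlgClosure.normal ℚ Ω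
  obtain ⟨z, hz⟩ := HasEnoughRootsOfUnity.exists_primitiveRoot Ω n
  obtain ⟨w, hw⟩ := HasEnoughRootsOfUnity.exists_primitiveRoot Ω l
  have hr : ∀ φ : K →ₐ[ℚ] Ω, ∃ x : Ω, x ^ l = φ (a : K) := fun φ =>
    IsAlgClosed.exists_pow_nat_eq _ (Nat.pos_of_ne_zero hl)
  choose r hr using hr
  let T : Set Ω := {z, w} ∪ Set.range r
  haveI : Finite (K →ₐ[ℚ] Ω) := inferInstance
  have hTf : T.Finite := ((Set.finite_singleton w).insert z).union (Set.finite_range r)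
  haveI := hTf.to_subtype
  let F0 : IntermediateField ℚ Ω := IntermediateField.adjoin ℚ T
  haveI : FiniteDimensional ℚ F0 := IntermediateField.finiteDimensional_adjoin (fun x _ => Algebra.IsIntegral.isIntegral x)
  let F : IntermediateField ℚ Ω := F0 ⊔ ⨆ φ : K →ₐ[ℚ] Ω, φ.fieldRange
  haveI : ∀ φ : K →ₐ[ℚ] Ω, FiniteDimensional ℚ φ.fieldRange := fun φ =>
    LinearEquiv.finiteDimensional (AlgEquiv.ofInjectiveField φ).toLinearEquiv
  haveI : FiniteDimensional ℚ ↥(⨆ φ : K →ₐ[ℚ] Ω, φ.fieldRange) := IntermediateField.finiteDimensional_iSup_of_finite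
  haveI : FiniteDimensional ℚ F := IntermediateField.finiteDimensional_sup _ _
  let L : IntermediateField ℚ Ω := IntermediateField.normalClosure ℚ F Ω
  have hFL : F ≤ L := IntermediateField.le_normalClosure F
  haveI : Normal ℚ L := normalClosure.normal ℚ F Ω
  haveI : FiniteDimensional ℚ L := normalClosure.is_finiteDimensional ℚ F Ω
  haveI : NumberField L := { to_charZero := inferInstance, to_finiteDimensional := inferInstance }
  haveI : IsGalois ℚ L := {}
  have hT : ∀ x ∈ T, x ∈ L := fun x hx => hFL ((le_sup_left : F0 ≤ F) (IntermediateField.subset_adjoin ℚ T hx))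
  have hK : ∀ (φ : K →ₐ[ℚ] Ω) (x : K), φ x ∈ L := fun φ x =>
    hFL ((le_sup_right : _ ≤ F) ((le_iSup (fun φ : K →ₐ[ℚ] Ω => φ.fieldRange) φ) ⟨x, rfl⟩))
  have hzL : z ∈ L := hT z (by simp [T])
  have hwL : w ∈ L := hT w (by simp [T])
  have hrL : ∀ φ, r φ ∈ L := fun φ => hT _ (by simp [T])
  have hz' : IsPrimitiveRoot (⟨z, hzL⟩ : L) n := IsPrimitiveRoot.of_map_of_injective (f := L.val) hz L.val.injective
  have hw' : IsPrimitiveRoot (⟨w, hwL⟩ : L) l := IsPrimitiveRoot.of_map_of_injective (f := L.val) hw L.val.injective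
  have hinj : Function.Injective (algebraMap (𝓞 L) L) := RingOfIntegers.coe_injective
  let αL : (K →ₐ[ℚ] L) → L := fun τ => ⟨r (L.val.comp τ), hrL _⟩
  have hαL : ∀ τ, αL τ ^ l = τ (a : K) := fun τ => Subtype.ext (hr (L.val.comp τ))
  have hαi : ∀ τ, IsIntegral ℤ (αL τ) := by
    intro τ
    apply IsIntegral.of_pow (Nat.pos_of_ne_zero hl)
    rw [hαL]
    exact (tO τ a).2
  refine ⟨L, inferInstance, inferInstance, inferInstance, ⟨?_⟩⟩
  exact
  { ι := L.val
    surj := fun φ => ⟨{ toFun := fun x => ⟨φ x, hK φ x⟩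
                        map_one' := Subtype.ext (map_one φ)
                        map_mul' := fun x y => Subtype.ext (map_mul φ x y)
                        map_zero' := Subtype.ext (map_zero φ)
                        map_add' := fun x y => Subtype.ext (map_add φ x y)
                        commutes' := fun q => Subtype.ext (φ.commutes q) }, by ext; rfl⟩
    α := fun τ => ⟨αL τ, hαi τ⟩
    hα := fun τ => RingOfIntegers.ext (hαL τ)
    ζ := ⟨_, hz'.isIntegral (Nat.pos_of_ne_zero hn)⟩
    hζ := IsPrimitiveRoot.of_map_of_injective (f := algebraMap (𝓞 L) L) hz' hinj
    ω := ⟨_, hw'.isIntegral (Nat.pos_of_ne_zero hl)⟩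
    hω := IsPrimitiveRoot.of_map_of_injective (f := algebraMap (𝓞 L) L) hw' hinj }

end N5
end Vas

open NumberField

namespace Vas
section N6
variable {K : Type*} [Field K] [NumberField K]
variable {L : Type} [Field L] [NumberField L] {a : 𝓞 K} {l n : ℕ}

lemma Setup.bij (S : Setup a l n L) : Function.Bijective (fun τ : K →ₐ[ℚ] L => S.ι.comp τ) := by
  refine ⟨fun τ τ' h => ?_, fun φ => S.surj φ⟩
  ext x
  exact S.ι.injective (DFunLike.congr_fun h x)

lemma coe_int_L (z : ℤ) : (((z : 𝓞 L)) : L) = ((z : ℚ) : L) := by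
  simp

lemma trace_sum (S : Setup a l n L) (y : 𝓞 K) :
    ((Algebra.trace ℤ (𝓞 K) y : ℤ) : 𝓞 L) = ∑ τ : K →ₐ[ℚ] L, tO τ y := by
  apply RingOfIntegers.ext
  apply S.ι.injective
  have h1 := trace_eq_sum_embeddings (K := ℚ) (L := K) (AlgebraicClosure ℚ) (x := (y : K))
  rw [← Algebra.coe_trace_int] at h1
  have h2 : (((Algebra.trace ℤ (𝓞 K) y : ℤ) : 𝓞 L) : L) = algebraMap ℚ L ((Algebra.trace ℤ (𝓞 K) y : ℤ) : ℚ) := by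
    simp
  rw [h2]
  refine (S.ι.commutes _).trans (h1.trans ?_)
  have h3 : ((∑ τ : K →ₐ[ℚ] L, tO τ y : 𝓞 L) : L) = ∑ τ : K →ₐ[ℚ] L, τ (y : K) :=
    map_sum (algebraMap (𝓞 L) L) _ _
  rw [h3, map_sum]
  exact (Fintype.sum_bijective _ S.bij _ _ (fun τ => rfl)).symm

lemma norm_prod (S : Setup a l n L) (y : 𝓞 K) :
    ((Algebra.norm ℤ y : ℤ) : 𝓞 L) = ∏ τ : K →ₐ[ℚ] L, tO τ y := by
  apply RingOfIntegers.ext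
  apply S.ι.injective
  have h1 := Algebra.norm_eq_prod_embeddings ℚ (AlgebraicClosure ℚ) (y : K)
  rw [← Algebra.coe_norm_int] at h1
  have h2 : (((Algebra.norm ℤ y : ℤ) : 𝓞 L) : L) = algebraMap ℚ L ((Algebra.norm ℤ y : ℤ) : ℚ) := by
    simp
  rw [h2]
  refine (S.ι.commutes _).trans (h1.trans ?_)
  have h3 : ((∏ τ : K →ₐ[ℚ] L, tO τ y : 𝓞 L) : L) = ∏ τ : K →ₐ[ℚ] L, τ (y : K) :=
    map_prod (algebraMap (𝓞 L) L) _ _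
  rw [h3, map_prod]
  exact (Fintype.prod_bijective _ S.bij _ _ (fun τ => rfl)).symm

lemma trace_dvd (S : Setup a l n L) {p : ℕ} (hp : p.Prime) (hpd : (NumberField.discr K).natAbs < p)
    {Q : Ideal (𝓞 L)} (hQ : Q.IsPrime) (hpQ : (p : 𝓞 L) ∈ Q) {y : 𝓞 K}
    (hy : ∀ τ : K →ₐ[ℚ] L, tO τ y ∈ Q) : (p : 𝓞 K) ∣ y := by
  classical
  set b := RingOfIntegers.basis K with hb
  have h1 : ∀ i, (p : ℤ) ∣ Algebra.trace ℤ (𝓞 K) (y * b i) := by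
    intro i
    refine int_in_prime hQ hp hpQ ?_
    rw [trace_sum S]
    refine Ideal.sum_mem _ (fun τ _ => ?_)
    rw [map_mul]
    exact Ideal.mul_mem_right _ _ (hy τ)
  set T := Algebra.traceMatrix ℤ b with hT
  have hTm := Algebra.traceMatrix_of_basis_mulVec b y
  have hdet : T.det = NumberField.discr K := by
    rw [hT, ← Algebra.discr_def]
    first | done | exact (NumberField.discr_eq_discr K b)
  have h2 : ∀ i, (p : ℤ) ∣ NumberField.discr K * b.equivFun y i := by
    intro i
    have h3 : (T.adjugate.mulVec (T.mulVec (b.equivFun y))) i = NumberField.discr K * b.equivFun y i := by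
      rw [Matrix.mulVec_mulVec, Matrix.adjugate_mul, hdet, Matrix.smul_mulVec, Matrix.one_mulVec]
      rfl
    rw [← h3, hTm]
    simp only [Matrix.mulVec, dotProduct]
    exact Finset.dvd_sum (fun j _ => Dvd.dvd.mul_left (h1 j) _)
  have h4 : ∀ i, (p : ℤ) ∣ b.equivFun y i := by
    intro i
    rcases (Nat.prime_iff_prime_int.1 hp).dvd_or_dvd (h2 i) with h | h
    · exfalso
      have := Int.natCast_dvd.1 h
      exact absurd (Nat.le_of_dvd (Int.natAbs_pos.2 (NumberField.discr_ne_zero K)) this) (not_le.2 hpd)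
    · exact h
  rw [← b.sum_equivFun y]
  refine Finset.dvd_sum (fun i _ => ?_)
  obtain ⟨k, hk⟩ := h4 i
  rw [hk, zsmul_eq_mul]
  push_cast
  exact ⟨k * b i, by ring⟩

lemma Setup.hζL (S : Setup a l n L) : IsPrimitiveRoot (S.ζ : L) n :=
  IsPrimitiveRoot.map_of_injective (f := algebraMap (𝓞 L) L) S.hζ RingOfIntegers.coe_injective

/-- The cyclotomic character. -/
noncomputable def Setup.cyc [NeZero n] (S : Setup a l n L) : (L ≃ₐ[ℚ] L) →* (ZMod n)ˣ := S.hζL.autToPow ℚ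

lemma Setup.cyc_spec [NeZero n] (S : Setup a l n L) (σ : L ≃ₐ[ℚ] L) :
    σ • S.ζ = S.ζ ^ (S.cyc σ : ZMod n).val := by
  apply RingOfIntegers.ext
  have := S.hζL.autToPow_spec ℚ σ
  rw [show (((σ • S.ζ : 𝓞 L)) : L) = σ (S.ζ : L) from rfl, ← this]
  exact (map_pow (algebraMap (𝓞 L) L) _ _).symm

lemma Setup.cyc_eq [NeZero n] (S : Setup a l n L) {σ : L ≃ₐ[ℚ] L} {k : ℕ}
    (h : σ • S.ζ = S.ζ ^ k) : (S.cyc σ : ZMod n) = k := by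
  rw [S.cyc_spec] at h
  have hk : S.ζ ^ k = S.ζ ^ (k % n) := by
    conv_lhs => rw [← Nat.div_add_mod k n, pow_add, pow_mul, S.hζ.pow_eq_one, one_pow, one_mul]
  rw [hk] at h
  have h2 := S.hζ.pow_inj (ZMod.val_lt _) (Nat.mod_lt _ (Nat.pos_of_ne_zero (NeZero.ne n))) h
  have : (S.cyc σ : ZMod n).val % n = k % n := by rw [h2, Nat.mod_mod]
  rw [← ZMod.natCast_zmod_val (S.cyc σ : ZMod n)]
  exact (ZMod.natCast_eq_natCast_iff' _ _ _).2 this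

lemma nat_not_mem {Q : Ideal (𝓞 L)} (hQ : Q.IsPrime) {p : ℕ} (hp : p.Prime)
    (hpQ : (p : 𝓞 L) ∈ Q) {k : ℕ} (h0 : k ≠ 0) (hk : k < p) : (k : 𝓞 L) ∉ Q := by
  intro h
  have := int_in_prime hQ hp hpQ (n := (k : ℤ)) (by simpa using h)
  exact absurd (Nat.le_of_dvd (Nat.pos_of_ne_zero h0) (Int.natCast_dvd_natCast.1 this)) (not_le.2 hk)

lemma Setup.ζ_notMem (S : Setup a l n L) (hn : n ≠ 0) {Q : Ideal (𝓞 L)} (hQ : Q.IsPrime) : S.ζ ∉ Q := by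
  intro h
  apply hQ.ne_top
  rw [Ideal.eq_top_iff_one, ← S.hζ.pow_eq_one]
  exact Ideal.pow_mem_of_mem _ h _ (Nat.pos_of_ne_zero hn)

/-- fixing group -/
def fixA [NeZero n] (S : Setup a l n L) (A : Subgroup (ZMod n)ˣ) : Subgroup (L ≃ₐ[ℚ] L) where
  carrier := {σ | (∀ τ : K →ₐ[ℚ] L, ∀ x : K, σ (τ x) = τ x) ∧ (∀ τ, σ • S.α τ = S.α τ) ∧ S.cyc σ ∈ A}
  one_mem' := ⟨fun _ _ => rfl, fun _ => one_smul _ _, by rw [map_one]; exact A.one_mem⟩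
  mul_mem' := by
    rintro σ ρ ⟨h1, h2, h3⟩ ⟨k1, k2, k3⟩
    refine ⟨fun τ x => ?_, fun τ => ?_, ?_⟩
    · rw [AlgEquiv.mul_apply, k1, h1]
    · rw [mul_smul, k2, h2]
    · rw [map_mul]; exact A.mul_mem h3 k3
  inv_mem' := by
    rintro σ ⟨h1, h2, h3⟩
    refine ⟨fun τ x => ?_, fun τ => ?_, ?_⟩
    · conv_lhs => rw [← h1 τ x]
      rw [← AlgEquiv.mul_apply, inv_mul_cancel]; rfl
    · rw [inv_smul_eq_iff, h2]
    · rw [map_inv]; exact A.inv_mem h3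

theorem CL [NeZero n] [IsGalois ℚ L] (S : Setup a l n L) {σ : L ≃ₐ[ℚ] L}
    (hτ : ∀ τ : K →ₐ[ℚ] L, ∀ x : K, σ (τ x) = τ x) (hα : ∀ τ, σ • S.α τ = S.α τ)
    (A' A : Subgroup (ZMod n)ˣ) (hle : A' ≤ A) (hA : S.cyc σ ∈ A) (hA' : S.cyc σ ∉ A') (B : ℕ) :
    ∃ p : ℕ, p.Prime ∧ B < p ∧ (∃ u ∈ A, u ∉ A' ∧ (u : ZMod n) = p) ∧ ∃ z : 𝓞 K, (p : 𝓞 K) ∣ a - z ^ l := by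
  classical
  obtain ⟨θ, D, hD, hsep⟩ := sepD (K := K)
  obtain ⟨p, hp, hBp, Q, hQ, hpQ, φ, hφ, hφ', hfrob⟩ := AL (fixA S A') (fixA S A)
    (fun g hg => ⟨hg.1, hg.2.1, hle hg.2.2⟩) σ ⟨hτ, hα, hA⟩ (fun h => hA' h.2.2)
    (B + n + D.natAbs + (NumberField.discr K).natAbs)
  have hn : n ≠ 0 := NeZero.ne n
  refine ⟨p, hp, by omega, ⟨S.cyc φ, hφ.2.2, fun h => hφ' ⟨hφ.1, hφ.2.1, h⟩, ?_⟩, ?_⟩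
  · apply S.cyc_eq
    refine root_cong (k := n) hQ ?_ (hfrob S.ζ) ?_ (nat_not_mem hQ hp hpQ hn (by omega))
    · rw [← smul_pow', S.hζ.pow_eq_one, smul_one, ← pow_mul, mul_comm, pow_mul, S.hζ.pow_eq_one, one_pow]
    · rw [S.cyc_spec]
      intro h
      exact S.ζ_notMem hn hQ (hQ.mem_of_pow_mem _ h)
  · have hk : ∀ τ, ∃ k : ℤ, S.α τ - (k : 𝓞 L) ∈ Q := by
      intro τ
      apply frob_int hQ hp hpQ
      have := Q.neg_mem (hfrob (S.α τ))
      rwa [hφ.2.1 τ, neg_sub] at this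
    choose k hk using hk
    let I : (K →ₐ[ℚ] L) → Ideal (𝓞 K) := fun τ => Q.comap (tO τ)
    haveI hIp : ∀ τ, (I τ).IsPrime := fun τ => Ideal.IsPrime.comap (tO τ)
    have hpI : ∀ τ, (p : 𝓞 K) ∈ I τ := fun τ => by
      rw [Ideal.mem_comap, map_natCast]; exact hpQ
    have hIm : ∀ τ, (I τ).IsMaximal := fun τ => (hIp τ).isMaximal (by
      intro h
      have := hpI τ
      rw [h, Ideal.mem_bot] at this
      exact hp.ne_zero (by exact_mod_cast this))
    have hIne : Pairwise (fun τ τ' => IsCoprime (I τ) (I τ')) := by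
      intro τ τ' hne
      have := hIm τ
      have := hIm τ'
      apply Ideal.isCoprime_of_isMaximal
      intro heq
      have h1 : ∃ k : ℤ, tO τ θ - (k : 𝓞 L) ∈ Q := by
        apply frob_int hQ hp hpQ
        have h2 := Q.neg_mem (hfrob (tO τ θ))
        have h3 : φ • tO τ θ = tO τ θ := RingOfIntegers.ext (hφ.1 τ θ)
        rwa [h3, neg_sub] at h2
      obtain ⟨k, hk⟩ := h1
      have h4 : θ - (k : 𝓞 K) ∈ I τ := by
        rw [Ideal.mem_comap, map_sub, map_intCast]; exact hk
      rw [heq, Ideal.mem_comap, map_sub, map_intCast] at h4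
      have h5 : tO τ θ - tO τ' θ ∈ Q := by
        have := Q.sub_mem hk h4
        rwa [sub_sub_sub_cancel_right] at this
      have h6 : ((D : ℤ) : 𝓞 L) ∈ Q := Q.mem_of_dvd (hsep L τ τ' hne) h5
      have h7 := Int.natCast_dvd.1 (int_in_prime hQ hp hpQ h6)
      have := Nat.le_of_dvd (Int.natAbs_pos.2 hD) h7
      omega
    obtain ⟨z, hz⟩ := Ideal.exists_forall_sub_mem_ideal (I := I)
      (fun i j hij => hIne hij) (fun τ => ((k τ : ℤ) : 𝓞 K))
    refine ⟨z, trace_dvd S hp (by omega) hQ hpQ (fun τ => ?_)⟩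
    have h1 := hz τ
    rw [Ideal.mem_comap, map_sub, map_intCast] at h1
    have h2 : S.α τ - tO τ z ∈ Q := by
      have := Q.sub_mem (hk τ) h1
      rwa [sub_sub_sub_cancel_right] at this
    rw [map_sub, map_pow, ← S.hα]
    exact Q.mem_of_dvd (sub_dvd_pow_sub_pow _ _ l) h2

end N6
end Vas

open NumberField

namespace Vas
section N7
variable {K : Type*} [Field K] [NumberField K]
variable {L : Type} [Field L] [NumberField L] {a : 𝓞 K} {l n : ℕ}

lemma prim_modeq {S : Type*} [CommMonoid S] {z : S} {k : ℕ} (hk : k ≠ 0) (hz : IsPrimitiveRoot z k) {i j : ℕ} :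
    z ^ i = z ^ j ↔ i ≡ j [MOD k] := by
  have hr : ∀ i, z ^ i = z ^ (i % k) := fun i => by
    conv_lhs => rw [← Nat.div_add_mod i k, pow_add, pow_mul, hz.pow_eq_one, one_pow, one_mul]
  constructor
  · intro h
    rw [hr i, hr j] at h
    exact hz.pow_inj (Nat.mod_lt _ (Nat.pos_of_ne_zero hk)) (Nat.mod_lt _ (Nat.pos_of_ne_zero hk)) h
  · intro h
    rw [hr i, hr j, h]

lemma units_gen_aux (n : ℕ) [NeZero n] (P : Subgroup (ZMod n)ˣ)
    (h : ∀ q k m : ℕ, q.Prime → ∀ (hn : n = q ^ (k + 1) * m), Nat.Coprime (q ^ (k + 1)) m →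
      ∀ u : (ZMod n)ˣ, ZMod.unitsMap (⟨q ^ (k + 1), by rw [hn, mul_comm]⟩ : m ∣ n) u = 1 → u ∈ P) :
    ∀ d : ℕ, ∀ m : ℕ, ∀ (hn : n = d * m), Nat.Coprime d m →
      ∀ u : (ZMod n)ˣ, ZMod.unitsMap (⟨d, by rw [hn, mul_comm]⟩ : m ∣ n) u = 1 → u ∈ P := by
  have key : ∀ (m : ℕ) (hm : m ∣ n) (u : (ZMod n)ˣ), ZMod.unitsMap hm u = 1 ↔ (u : ZMod n).val ≡ 1 [MOD m] := by
    intro m hm u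
    rw [← Units.val_inj, ZMod.unitsMap_val, ← ZMod.natCast_eq_natCast_iff, ZMod.cast_eq_val]
    simp
  intro d
  induction d using Nat.recOnPosPrimePosCoprime with
  | zero => intro m hn; exact absurd hn (by rw [zero_mul]; exact NeZero.ne n)
  | one =>
    intro m hn hc u hu
    rw [key] at hu
    have : u = 1 := by
      rw [← Units.val_inj, ← ZMod.natCast_zmod_val (u : ZMod n)]
      have h2 : n = m := by omega
      rw [← h2, ← ZMod.natCast_eq_natCast_iff] at hu
      rw [hu]; simp
    rw [this]; exact P.one_mem
  | prime_pow q k hq hk =>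
    intro m hn hc u hu
    obtain ⟨k, rfl⟩ : ∃ k', k = k' + 1 := ⟨k - 1, by omega⟩
    exact h q k m hq hn hc u hu
  | coprime d1 d2 h1 h2 hc ih1 ih2 =>
    intro m hn hc' u hu
    rw [key] at hu
    have hc1 : Nat.Coprime d1 m := Nat.Coprime.coprime_mul_right hc'
    have hc2 : Nat.Coprime d2 m := Nat.Coprime.coprime_mul_left hc'
    have hcc : Nat.Coprime d1 (d2 * m) := Nat.Coprime.mul_right hc hc1
    obtain ⟨x, hx1, hx2⟩ := Nat.chineseRemainder hcc ((u : ZMod n).val) 1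
    have hux : Nat.Coprime x n := by
      have e1 : Nat.Coprime ((u : ZMod n).val) n := ZMod.val_coe_unit_coprime u
      rw [hn, mul_assoc]
      refine Nat.Coprime.mul_right ?_ ?_
      · rw [Nat.Coprime, hx1.gcd_eq]
        exact Nat.Coprime.coprime_dvd_right ⟨d2 * m, by rw [hn, mul_assoc]⟩ e1
      · rw [Nat.Coprime, hx2.gcd_eq]; simp
    set v := ZMod.unitOfCoprime x hux with hv
    have hvval : ∀ e, e ∣ n → (v : ZMod n).val ≡ x [MOD e] := by
      intro e he
      rw [hv, ZMod.coe_unitOfCoprime, ZMod.val_natCast]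
      exact (Nat.mod_modEq x n).of_dvd he
    have hvP : v ∈ P := ih1 (d2 * m) (by rw [hn, mul_assoc]) hcc v (by
      rw [key]; exact (hvval _ ⟨d1, by rw [hn]; ring⟩).trans hx2)
    have hwP : u * v⁻¹ ∈ P := by
      refine ih2 (d1 * m) (by rw [hn]; ring) (Nat.Coprime.mul_right hc.symm hc2) _ ?_
      rw [map_mul, map_inv, mul_inv_eq_one, ← Units.val_inj, ZMod.unitsMap_val, ZMod.unitsMap_val,
        ZMod.cast_eq_val, ZMod.cast_eq_val, ZMod.natCast_eq_natCast_iff]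
      refine Nat.ModEq.symm ?_
      refine (hvval _ ⟨d2, by rw [hn]; ring⟩).trans ?_
      refine (Nat.modEq_and_modEq_iff_modEq_mul hc1).1 ⟨hx1, ?_⟩
      exact (hx2.of_dvd (Dvd.intro_left _ rfl)).trans hu.symm
    have := P.mul_mem hwP hvP
    rwa [inv_mul_cancel_right] at this

lemma units_gen (n : ℕ) [NeZero n] (P : Subgroup (ZMod n)ˣ)
    (h : ∀ q k m : ℕ, q.Prime → ∀ (hn : n = q ^ (k + 1) * m), Nat.Coprime (q ^ (k + 1)) m →
      ∀ u : (ZMod n)ˣ, ZMod.unitsMap (⟨q ^ (k + 1), by rw [hn, mul_comm]⟩ : m ∣ n) u = 1 → u ∈ P) :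
    P = ⊤ := by
  rw [eq_top_iff]
  intro u _
  exact units_gen_aux n P h n 1 (by simp) (by simp) u (Subsingleton.elim _ _)

lemma exists_above {q : ℕ} (hq : q.Prime) : ∃ Q : Ideal (𝓞 L), Q.IsPrime ∧ (q : 𝓞 L) ∈ Q := by
  have : (q : 𝓞 L) ∈ nonunits (𝓞 L) := by
    intro h
    have h1 := h.map (Algebra.norm ℤ)
    have h2 : Algebra.norm ℤ ((q : 𝓞 L)) = (q : ℤ) ^ Module.finrank ℤ (𝓞 L) := by
      have := Algebra.norm_algebraMap (R := ℤ) (S := 𝓞 L) (q : ℤ)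
      simpa using this
    rw [h2, isUnit_pow_iff, Int.isUnit_iff] at h1
    · have := hq.two_le; omega
    · exact (Module.finrank_pos).ne'
  obtain ⟨Q, hQ, hm⟩ := exists_max_ideal_of_mem_nonunits this
  exact ⟨Q, hQ.isPrime, hm⟩

/-- Separating element data. -/
def SepD (θ : 𝓞 K) (D : ℤ) : Prop := D ≠ 0 ∧ ∀ (L : Type) [Field L] [NumberField L] (τ τ' : K →ₐ[ℚ] L),
    τ ≠ τ' → (tO τ θ - tO τ' θ) ∣ ((D : ℤ) : 𝓞 L)

lemma sep_of {θ : 𝓞 K} {D : ℤ} (hD : SepD θ D) {q : ℕ} (hq : q.Prime) (hqD : ¬ (q : ℤ) ∣ D)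
    {Q : Ideal (𝓞 L)} (hQ : Q.IsPrime) (hqQ : (q : 𝓞 L) ∈ Q) {τ τ' : K →ₐ[ℚ] L}
    (h : tO τ θ - tO τ' θ ∈ Q) : τ = τ' := by
  by_contra hne
  exact hqD (int_in_prime hQ hq hqQ (Q.mem_of_dvd (hD.2 L τ τ' hne) h))

lemma inert_tau {θ : 𝓞 K} {D : ℤ} (hD : SepD θ D) {q : ℕ} (hq : q.Prime) (hqD : ¬ (q : ℤ) ∣ D)
    {Q : Ideal (𝓞 L)} (hQ : Q.IsPrime) (hqQ : (q : 𝓞 L) ∈ Q) {σ : L ≃ₐ[ℚ] L}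
    (hσ : ∀ x : 𝓞 L, σ • x - x ∈ Q) (τ : K →ₐ[ℚ] L) (x : K) : σ (τ x) = τ x := by
  have : σ.toAlgHom.comp τ = τ := sep_of hD hq hqD hQ hqQ (hσ (tO τ θ))
  exact DFunLike.congr_fun this x

lemma exists_tauq (S : Setup a l n L) (ha : Nice a) (hn : n = (Algebra.norm ℤ a).natAbs)
    {θ : 𝓞 K} {D : ℤ} (hD : SepD θ D) {q : ℕ} (hq : q.Prime) (hqD : ¬ (q : ℤ) ∣ D) (hqn : q ∣ n)
    {Q : Ideal (𝓞 L)} (hQ : Q.IsPrime) (hqQ : (q : 𝓞 L) ∈ Q) :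
    ∃ τ₁ : K →ₐ[ℚ] L, ∀ τ, τ ≠ τ₁ → tO τ a ∉ Q := by
  have h1 : ((Algebra.norm ℤ a : ℤ) : 𝓞 L) ∈ Q := by
    have : (q : ℤ) ∣ Algebra.norm ℤ a := Int.natCast_dvd.2 (hn ▸ hqn)
    have h2 := map_dvd (Int.castRingHom (𝓞 L)) this
    exact Q.mem_of_dvd h2 (by simpa using hqQ)
  rw [norm_prod S, hQ.prod_mem_iff] at h1
  obtain ⟨τ₁, -, h1⟩ := h1
  refine ⟨τ₁, fun τ hne h2 => hne ?_⟩
  obtain ⟨m, hm⟩ := ha.2 θ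
  have e : ∀ ρ : K →ₐ[ℚ] L, tO ρ a ∈ Q → tO ρ θ - (m : 𝓞 L) ∈ Q := by
    intro ρ h
    have := map_dvd (tO ρ) hm
    rw [map_sub, map_intCast] at this
    exact Q.mem_of_dvd this h
  apply sep_of hD hq hqD hQ hqQ
  have := Q.sub_mem (e τ h2) (e τ₁ h1)
  rwa [sub_sub_sub_cancel_right] at this

lemma inert_root {q : ℕ} (hq : q.Prime) {Q : Ideal (𝓞 L)} (hQ : Q.IsPrime) (hqQ : (q : 𝓞 L) ∈ Q)
    {σ : L ≃ₐ[ℚ] L} (hσ : ∀ x : 𝓞 L, σ • x - x ∈ Q) {x : 𝓞 L} {k : ℕ} (hk : ¬ q ∣ k)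
    (hx : x ∉ Q) (hfix : σ • (x ^ k) = x ^ k) : σ • x = x := by
  refine root_cong (k := k) hQ (by rw [← smul_pow', hfix]) (hσ x) ?_ ?_
  · intro h
    have := Q.sub_mem h (hσ x)
    rw [sub_sub_cancel] at this
    exact hx this
  · intro h
    apply hk
    have := int_in_prime hQ hq hqQ (n := (k : ℤ)) (by simpa using h)
    exact Int.natCast_dvd_natCast.1 this

lemma inert_cyc [NeZero n] [IsGalois ℚ L] (S : Setup a l n L) {q k m : ℕ} (hq : q.Prime)
    (hn : n = q ^ (k + 1) * m) (hc : Nat.Coprime (q ^ (k + 1)) m)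
    {Q : Ideal (𝓞 L)} (hQ : Q.IsPrime) (hqQ : (q : 𝓞 L) ∈ Q) (u : (ZMod n)ˣ)
    (hu : ZMod.unitsMap (⟨q ^ (k + 1), by rw [hn, mul_comm]⟩ : m ∣ n) u = 1) :
    ∃ σ : L ≃ₐ[ℚ] L, (∀ x : 𝓞 L, σ • x - x ∈ Q) ∧ S.cyc σ = u := by
  have hn0 : n ≠ 0 := NeZero.ne n
  haveI : NeZero (q ^ (k + 1)) := ⟨pow_ne_zero _ hq.ne_zero⟩
  have hq0 : q ^ (k + 1) ≠ 0 := pow_ne_zero _ hq.ne_zero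
  have hm0 : m ≠ 0 := by rintro rfl; simp at hn; exact hn0 hn
  have hqn : q ^ (k + 1) ∣ n := ⟨m, hn⟩
  have hp1 : IsPrimitiveRoot ((S.ζ : L) ^ m) (q ^ (k + 1)) :=
    S.hζL.pow (Nat.pos_of_ne_zero hn0) (by rw [hn, mul_comm])
  have hp2 : IsPrimitiveRoot (S.ζ ^ q ^ (k + 1)) m := S.hζ.pow (Nat.pos_of_ne_zero hn0) hn
  obtain ⟨σ, hσ, hσ2⟩ := IL hq k hp1 hQ hqQ (ZMod.unitsMap hqn u)
  refine ⟨σ, hσ, ?_⟩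
  have hsp := S.cyc_spec σ
  set c := (S.cyc σ : ZMod n).val with hcdef
  have hu' : (u : ZMod n).val ≡ 1 [MOD m] := by
    rw [← Units.val_inj, ZMod.unitsMap_val, ZMod.cast_eq_val] at hu
    rw [← ZMod.natCast_eq_natCast_iff, hu]; simp
  have e1 : c ≡ 1 [MOD m] := by
    rw [← prim_modeq hm0 hp2]
    have h1 : σ • (S.ζ ^ q ^ (k + 1)) = S.ζ ^ q ^ (k + 1) := by
      refine inert_root hq hQ hqQ hσ (k := m) ?_ ?_ ?_
      · intro h
        have := hc.coprime_dvd_left (dvd_pow_self q (Nat.succ_ne_zero k))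
        exact (Nat.Prime.coprime_iff_not_dvd hq).1 this h
      · intro h; exact S.ζ_notMem hn0 hQ (hQ.mem_of_pow_mem _ h)
      · rw [← pow_mul, ← hn, S.hζ.pow_eq_one, smul_one]
    rw [smul_pow', hsp] at h1
    rw [pow_one, ← pow_mul, mul_comm, pow_mul, h1]
  have e2 : c ≡ (u : ZMod n).val [MOD q ^ (k + 1)] := by
    rw [← prim_modeq hq0 hp1]
    have h1 := hp1.autToPow_spec ℚ σ
    rw [hσ2, ZMod.unitsMap_val, ZMod.cast_eq_val, ZMod.val_natCast] at h1
    have h2 : ((S.ζ : L) ^ m) ^ ((u : ZMod n).val % q ^ (k + 1)) = ((S.ζ : L) ^ m) ^ ((u : ZMod n).val) :=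
      (prim_modeq hq0 hp1).2 (Nat.mod_modEq _ _)
    have h3 : σ (S.ζ : L) = (S.ζ : L) ^ c := by
      have := congrArg (algebraMap (𝓞 L) L) hsp
      rw [map_pow] at this
      exact this
    rw [← h2, h1, map_pow, h3, ← pow_mul, ← pow_mul, mul_comm]
  have e3 : c ≡ (u : ZMod n).val [MOD n] := by
    have := (Nat.modEq_and_modEq_iff_modEq_mul hc).1 ⟨e2, e1.trans hu'.symm⟩
    exact this.of_dvd ⟨1, by rw [mul_one]; exact hn.symm⟩
  rw [← Units.val_inj, ← ZMod.natCast_zmod_val (S.cyc σ : ZMod n), ← ZMod.natCast_zmod_val (u : ZMod n)]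
  exact (ZMod.natCast_eq_natCast_iff _ _ _).2 e3

end N7
end Vas

open NumberField

namespace Vas
section N8
variable {K : Type*} [Field K] [NumberField K]
variable {L : Type} [Field L] [NumberField L] {a : 𝓞 K} {l n : ℕ}

lemma tO_ne_zero {a : 𝓞 K} (ha : a ≠ 0) (τ : K →ₐ[ℚ] L) : tO τ a ≠ 0 := by
  intro h
  apply ha
  have h1 : τ (a : K) = 0 := congrArg (algebraMap (𝓞 L) L) h
  have h2 : (a : K) = 0 := (map_eq_zero τ).1 h1
  exact RingOfIntegers.ext h2

lemma Setup.α_ne (S : Setup a l n L) (ha : a ≠ 0) (hl : l ≠ 0) (τ) : S.α τ ≠ 0 := by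
  intro h
  have := S.hα τ
  rw [h, zero_pow hl] at this
  exact tO_ne_zero ha τ this.symm

lemma Setup.root_eq (S : Setup a l n L) (hl : l ≠ 0) {x y : 𝓞 L} (hy : y ≠ 0) (h : x ^ l = y ^ l) :
    ∃ j : ℕ, x = S.ω ^ j * y := by
  haveI : NeZero l := ⟨hl⟩
  have hωL : IsPrimitiveRoot (S.ω : L) l :=
    IsPrimitiveRoot.map_of_injective (f := algebraMap (𝓞 L) L) S.hω RingOfIntegers.coe_injective
  have hyL : (y : L) ≠ 0 := fun h => hy (RingOfIntegers.ext h)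
  have hL : (x : L) ^ l = (y : L) ^ l := by
    have := congrArg (algebraMap (𝓞 L) L) h
    rwa [map_pow, map_pow] at this
  have h1 : ((x : L) / y) ^ l = 1 := by
    rw [div_pow, hL, div_self (pow_ne_zero _ hyL)]
  obtain ⟨j, -, hj⟩ := hωL.eq_pow_of_pow_eq_one h1
  refine ⟨j, RingOfIntegers.ext ?_⟩
  have h2 : ((S.ω ^ j * y : 𝓞 L) : L) = (S.ω : L) ^ j * y := by
    exact (map_mul (algebraMap (𝓞 L) L) _ _).trans (by rw [map_pow])
  rw [h2]
  rw [hj, div_mul_cancel₀ _ hyL]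

lemma Setup.smul_alpha (S : Setup a l n L) (ha : a ≠ 0) (hl : l ≠ 0) (h : L ≃ₐ[ℚ] L) (τ : K →ₐ[ℚ] L) :
    ∃ j : ℕ, h • S.α τ = S.ω ^ j * S.α (h.toAlgHom.comp τ) := by
  apply S.root_eq hl (S.α_ne ha hl _)
  rw [← smul_pow', S.hα, S.hα, smul_tO]

lemma fix_conj (S : Setup a l n L) (ha : a ≠ 0) (hl : l ≠ 0) {σ h : L ≃ₐ[ℚ] L} {τ₁ τ₀ : K →ₐ[ℚ] L}
    (hτ : ∀ τ : K →ₐ[ℚ] L, ∀ x : K, σ (τ x) = τ x) (hω : σ • S.ω = S.ω)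
    (hα : ∀ τ, τ ≠ τ₁ → σ • S.α τ = S.α τ) (hh : h.toAlgHom.comp τ₁ = τ₀) :
    (∀ τ : K →ₐ[ℚ] L, ∀ x : K, (h * σ * h⁻¹) (τ x) = τ x) ∧
      ∀ τ, τ ≠ τ₀ → (h * σ * h⁻¹) • S.α τ = S.α τ := by
  constructor
  · intro τ x
    rw [AlgEquiv.mul_apply, AlgEquiv.mul_apply]
    have : σ (h⁻¹ (τ x)) = h⁻¹ (τ x) := hτ ((h⁻¹).toAlgHom.comp τ) x
    rw [this, ← AlgEquiv.mul_apply, mul_inv_cancel]; rfl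
  · intro τ hne
    obtain ⟨j, hj⟩ := S.smul_alpha ha hl h⁻¹ τ
    have h2 : (h⁻¹).toAlgHom.comp τ ≠ τ₁ := by
      rintro h3
      apply hne
      rw [← hh, ← h3]
      ext x
      change τ x = h (h⁻¹ (τ x))
      rw [← AlgEquiv.mul_apply, mul_inv_cancel]; rfl
    rw [mul_smul, mul_smul, hj, smul_mul', smul_pow', hω, hα _ h2, ← hj, smul_inv_smul]

lemma omega_not_mem (S : Setup a l n L) (hreal : Nonempty (K →+* ℝ)) (hl : l.Prime) (hlo : l ≠ 2)
    (τ : K →ₐ[ℚ] L) (x : K) : τ x ≠ (S.ω : L) := by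
  intro h
  obtain ⟨ρ⟩ := hreal
  have hωL : IsPrimitiveRoot (S.ω : L) l :=
    IsPrimitiveRoot.map_of_injective (f := algebraMap (𝓞 L) L) S.hω RingOfIntegers.coe_injective
  rw [← h] at hωL
  have h1 : IsPrimitiveRoot x l := IsPrimitiveRoot.of_map_of_injective (f := τ) hωL τ.injective
  have h2 : IsPrimitiveRoot (ρ x) l := h1.map_of_injective ρ.injective
  have h3 := h2.pow_eq_one
  have hodd : Odd l := hl.odd_of_ne_two hlo
  have h4 : ρ x = 1 := by
    have := hodd.strictMono_pow (R := ℝ)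
    exact this.injective (by simpa using h3)
  rw [h4] at h2
  have := h2.unique IsPrimitiveRoot.one
  exact hl.one_lt.ne' this

theorem NT_odd_L [NeZero n] [IsGalois ℚ L] (S : Setup a l n L) (hreal : Nonempty (K →+* ℝ)) (ha : Nice a)
    {θ : 𝓞 K} {D : ℤ} (hD : SepD θ D) (hl : l.Prime) (hlo : l ≠ 2) (hn : n = (Algebra.norm ℤ a).natAbs)
    (hcD : IsCoprime (n : ℤ) D) (hcl : Nat.Coprime n l) (P : Subgroup (ZMod n)ˣ) (hP : P ≠ ⊤)
    (hPl : ∀ u : (ZMod n)ˣ, u ^ l ∈ P) (B : ℕ) :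
    ∃ p : ℕ, p.Prime ∧ B < p ∧ (∃ u : (ZMod n)ˣ, u ∉ P ∧ (u : ZMod n) = p) ∧ ∃ z : 𝓞 K, (p : 𝓞 K) ∣ a - z ^ l := by
  have hl0 := hl.ne_zero
  by_contra hneg
  apply hP
  apply units_gen
  intro q k m hq hnq hc u hu
  by_contra huP
  apply hneg
  have hqn : q ∣ n := (dvd_pow_self q (Nat.succ_ne_zero k)).trans ⟨m, hnq⟩
  have hqD : ¬ (q : ℤ) ∣ D := by
    intro h
    have := hcD.isUnit_of_dvd' (Int.natCast_dvd_natCast.2 hqn) h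
    exact (Nat.prime_iff_prime_int.1 hq).not_unit this
  have hql : ¬ q ∣ l := by
    intro h
    exact Nat.not_coprime_of_dvd_of_dvd hq.one_lt hqn h hcl
  obtain ⟨Q, hQ, hqQ⟩ := exists_above (L := L) hq
  obtain ⟨σ, hσ, hσu⟩ := inert_cyc S hq hnq hc hQ hqQ u hu
  obtain ⟨τ₁, hτ₁⟩ := exists_tauq S ha hn hD hq hqD hqn hQ hqQ
  have hτ := inert_tau hD hq hqD hQ hqQ hσ
  have hα : ∀ τ, τ ≠ τ₁ → σ • S.α τ = S.α τ := by
    intro τ hne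
    refine inert_root hq hQ hqQ hσ hql ?_ ?_
    · intro h
      apply hτ₁ τ hne
      rw [← S.hα]
      exact Ideal.pow_mem_of_mem _ h _ hl.pos
    · rw [S.hα]; exact RingOfIntegers.ext (hτ τ a)
  have hω : σ • S.ω = S.ω := by
    refine inert_root hq hQ hqQ hσ hql ?_ ?_
    · intro h
      apply hQ.ne_top
      rw [Ideal.eq_top_iff_one, ← S.hω.pow_eq_one]
      exact Ideal.pow_mem_of_mem _ h _ hl.pos
    · rw [S.hω.pow_eq_one, smul_one]
  -- the automorphism h
  obtain ⟨h, hhτ, hhω⟩ : ∃ h : L ≃ₐ[ℚ] L, h.toAlgHom.comp τ₁ = τ₁ ∧ h • S.ω ≠ S.ω := by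
    by_contra hno
    push Not at hno
    have h1 : (S.ω : L) ∈ IntermediateField.fixedField (IntermediateField.fixingSubgroup τ₁.fieldRange) := by
      rintro ⟨g, hg⟩
      have h2 : g.toAlgHom.comp τ₁ = τ₁ := by
        ext x
        exact (IntermediateField.mem_fixingSubgroup_iff _ _).1 hg (τ₁ x) ⟨x, rfl⟩
      exact congrArg (algebraMap (𝓞 L) L) (hno g h2)
    rw [IsGalois.fixedField_fixingSubgroup] at h1
    obtain ⟨x, hx⟩ := h1
    exact omega_not_mem S hreal hl hlo τ₁ x hx
  haveI : NeZero l := ⟨hl0⟩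
  obtain ⟨g, -, hg⟩ := S.hω.eq_pow_of_pow_eq_one (ξ := h • S.ω) (by rw [← smul_pow', S.hω.pow_eq_one, smul_one])
  obtain ⟨c1, c2⟩ := fix_conj S ha.1 hl0 hτ hω hα hhτ
  have hpow : ∀ (x : 𝓞 L), σ • x = x → ∀ i : ℕ, (σ ^ i) • x = x := by
    intro x hx i
    induction i with
    | zero => simp
    | succ i ih => rw [pow_succ, mul_smul, hx, ih]
  obtain ⟨j, hj⟩ : ∃ j : ℕ, σ • S.α τ₁ = S.ω ^ j * S.α τ₁ := by
    obtain ⟨j, hj⟩ := S.smul_alpha ha.1 hl0 σ τ₁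
    refine ⟨j, ?_⟩
    rwa [show σ.toAlgHom.comp τ₁ = τ₁ from by ext x; exact hτ τ₁ x] at hj
  have hpj : ∀ i : ℕ, (σ ^ i) • S.α τ₁ = S.ω ^ (j * i) * S.α τ₁ := by
    intro i
    induction i with
    | zero => simp
    | succ i ih => rw [pow_succ', mul_smul, ih, smul_mul', smul_pow', hω, hj, ← mul_assoc, ← pow_add]; ring_nf
  have hcj : (h * σ * h⁻¹) • S.α τ₁ = S.ω ^ (j * g) * S.α τ₁ := by
    obtain ⟨i, hi⟩ := S.smul_alpha ha.1 hl0 h⁻¹ τ₁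
    have e : (h⁻¹).toAlgHom.comp τ₁ = τ₁ := by
      conv_lhs => rw [← hhτ]
      ext x
      change h⁻¹ (h (τ₁ x)) = τ₁ x
      rw [← AlgEquiv.mul_apply, inv_mul_cancel]; rfl
    rw [e] at hi
    rw [mul_smul, mul_smul, hi, smul_mul', smul_pow', hω, hj, mul_left_comm, ← hi, smul_mul', smul_inv_smul,
      smul_pow', ← hg, ← pow_mul, mul_comm g j]
  refine (CL S (σ := (σ ^ g)⁻¹ * (h * σ * h⁻¹)) ?_ ?_ P ⊤ le_top (Subgroup.mem_top _) ?_ B).imp ?_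
  · intro τ x
    rw [AlgEquiv.mul_apply, c1]
    have hσg : ∀ i : ℕ, (σ ^ i) (τ x) = τ x := by
      intro i
      induction i with
      | zero => rfl
      | succ i ih => rw [pow_succ, AlgEquiv.mul_apply, hτ, ih]
    conv_lhs => rw [← hσg g]
    rw [← AlgEquiv.mul_apply, inv_mul_cancel]; rfl
  · intro τ
    rw [mul_smul, inv_smul_eq_iff]
    by_cases hne : τ = τ₁
    · rw [hne, hcj, hpj]
    · rw [c2 τ hne, hpow _ (hα τ hne)]
  · intro hmem
    apply huP
    have e : S.cyc ((σ ^ g)⁻¹ * (h * σ * h⁻¹)) = u ^ (1 - (g : ℤ)) := by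
      rw [map_mul, map_inv, map_pow, map_mul, map_mul, map_inv, hσu, mul_comm (S.cyc h), mul_inv_cancel_right,
        zpow_sub, zpow_one, zpow_natCast, mul_comm]
    rw [e] at hmem
    have hgl : IsCoprime (1 - (g : ℤ)) (l : ℤ) := by
      refine IsCoprime.symm ((Nat.prime_iff_prime_int.1 hl).coprime_iff_not_dvd.2 ?_)
      intro hd
      apply hhω
      have h3 : g ≡ 1 [MOD l] := (Nat.modEq_iff_dvd.2 (by simpa using hd))
      rw [← hg, (prim_modeq hl0 S.hω).2 h3, pow_one]
    obtain ⟨x, y, hxy⟩ := hgl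
    have : u = (u ^ (1 - (g : ℤ))) ^ x * (u ^ l) ^ y := by
      rw [← zpow_natCast u l, ← zpow_mul, ← zpow_mul, ← zpow_add, mul_comm _ x, mul_comm _ y, hxy, zpow_one]
    rw [this]
    exact P.mul_mem (P.zpow_mem hmem x) (P.zpow_mem (hPl u) y)
  · rintro p ⟨h1, h2, ⟨u, -, h3⟩, h4⟩
    exact ⟨h1, h2, ⟨u, h3⟩, h4⟩

theorem NT_odd [NeZero n] (hreal : Nonempty (K →+* ℝ)) (ha : Nice a)
    {θ : 𝓞 K} {D : ℤ} (hD : SepD θ D) (hl : l.Prime) (hlo : l ≠ 2) (hn : n = (Algebra.norm ℤ a).natAbs)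
    (hcD : IsCoprime (n : ℤ) D) (hcl : Nat.Coprime n l) (P : Subgroup (ZMod n)ˣ) (hP : P ≠ ⊤)
    (hPl : ∀ u : (ZMod n)ˣ, u ^ l ∈ P) (B : ℕ) :
    ∃ p : ℕ, p.Prime ∧ B < p ∧ (∃ u : (ZMod n)ˣ, u ∉ P ∧ (u : ZMod n) = p) ∧ ∃ z : 𝓞 K, (p : 𝓞 K) ∣ a - z ^ l := by
  obtain ⟨L, _, _, _, ⟨S⟩⟩ := exists_setup a hl.ne_zero (NeZero.ne n)
  exact NT_odd_L S hreal ha hD hl hlo hn hcD hcl P hP hPl B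

end N8
end Vas

open NumberField

namespace Vas
section N9
variable {K : Type*} [Field K] [NumberField K]
variable {L : Type} [Field L] [NumberField L] {a : 𝓞 K} {n : ℕ}

/-- Jacobi symbol as a character of `(ℤ/n)ˣ`. -/
def jac (n : ℕ) [NeZero n] : (ZMod n)ˣ →* ℤ where
  toFun u := jacobiSym ((u : ZMod n).val : ℤ) n
  map_one' := by
    rw [← jacobiSym.one_left n]
    apply jacobiSym.mod_left'
    have : ((1 : ZMod n).val) ≡ 1 [MOD n] := by
      rw [← ZMod.natCast_eq_natCast_iff]; simp
    exact_mod_cast this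
  map_mul' u v := by
    rw [← jacobiSym.mul_left]
    apply jacobiSym.mod_left'
    have : ((u * v : (ZMod n)ˣ) : ZMod n).val ≡ (u : ZMod n).val * (v : ZMod n).val [MOD n] := by
      rw [← ZMod.natCast_eq_natCast_iff]; simp
    exact_mod_cast this

lemma jac_sq [NeZero n] (u : (ZMod n)ˣ) : jac n u * jac n u = 1 := by
  have h := jacobiSym.sq_one (a := ((u : ZMod n).val : ℤ)) (b := n) (by
    have := ZMod.val_coe_unit_coprime u
    exact_mod_cast this)
  rw [← sq]; exact h

lemma jac_inv [NeZero n] (u : (ZMod n)ˣ) : jac n u⁻¹ = jac n u := by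
  have h : jac n u⁻¹ * jac n u = 1 := by rw [← map_mul, inv_mul_cancel, map_one]
  calc jac n u⁻¹ = jac n u⁻¹ * (jac n u * jac n u) := by rw [jac_sq, mul_one]
    _ = _ := by rw [← mul_assoc, h, one_mul]

lemma jac_eq [NeZero n] {u : (ZMod n)ˣ} {x : ℤ} (h : (u : ZMod n) = x) : jac n u = jacobiSym x n := by
  apply jacobiSym.mod_left'
  have : (((u : ZMod n).val : ℤ) : ZMod n) = ((x : ℤ) : ZMod n) := by
    rw [← h]; simp
  exact (ZMod.intCast_eq_intCast_iff' _ _ _).1 this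

lemma recip {n p : ℕ} (hn : n % 4 = 3) (hp : p % 2 = 1) : jacobiSym (-(n : ℤ)) p = jacobiSym p n := by
  have hpo : Odd p := Nat.odd_iff.2 hp
  have hno : Odd n := by rw [Nat.odd_iff]; omega
  rw [jacobiSym.neg _ hpo]
  rcases Nat.odd_mod_four_iff.1 hp with h | h
  · rw [ZMod.χ₄_nat_one_mod_four h, one_mul, jacobiSym.quadratic_reciprocity_one_mod_four' hno h]
  · rw [ZMod.χ₄_nat_three_mod_four h, jacobiSym.quadratic_reciprocity_three_mod_four hn h]; ring

lemma beta_char [NeZero n] [IsGalois ℚ L] (S : Setup a 2 n L) (ha : a ≠ 0)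
    (hN : Algebra.norm ℤ a = -(n : ℤ)) (hn4 : n % 4 = 3) (σ : L ≃ₐ[ℚ] L) :
    σ • (∏ τ, S.α τ) = ((jac n (S.cyc σ) : ℤ) : 𝓞 L) * ∏ τ, S.α τ := by
  set β := ∏ τ, S.α τ with hβ
  have hβ2 : β ^ 2 = ((-(n : ℤ) : ℤ) : 𝓞 L) := by
    rw [← hN, norm_prod S, hβ, ← Finset.prod_pow]
    exact Finset.prod_congr rfl (fun τ _ => S.hα τ)
  have hn0 : n ≠ 0 := NeZero.ne n
  have hIntg : ∀ (σ : L ≃ₐ[ℚ] L) (z : ℤ), σ • ((z : ℤ) : 𝓞 L) = ((z : ℤ) : 𝓞 L) := by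
    intro σ z
    exact RingOfIntegers.ext (by
      change σ (algebraMap (𝓞 L) L (z : 𝓞 L)) = algebraMap (𝓞 L) L (z : 𝓞 L)
      simp)
  have hjj : ∀ v : (ZMod n)ˣ, ((jac n v : ℤ) : 𝓞 L) * ((jac n v : ℤ) : 𝓞 L) = 1 := by
    intro v
    rw [← Int.cast_mul, jac_sq, Int.cast_one]
  let H' : Subgroup (L ≃ₐ[ℚ] L) :=
    { carrier := {σ | σ • β = ((jac n (S.cyc σ) : ℤ) : 𝓞 L) * β}
      one_mem' := by simp
      mul_mem' := by
        intro x y hx hy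
        simp only [Set.mem_setOf_eq] at hx hy ⊢
        rw [mul_smul, hy, smul_mul', hIntg, hx, map_mul, map_mul, Int.cast_mul]; ring
      inv_mem' := by
        intro x hx
        simp only [Set.mem_setOf_eq] at hx ⊢
        rw [inv_smul_eq_iff, smul_mul', hIntg, hx, map_inv, jac_inv, ← mul_assoc, hjj, one_mul] }
  by_contra hσ
  obtain ⟨p, hp, hBp, Q, hQ, hpQ, φ, -, hφ, hfrob⟩ := AL H' ⊤ le_top σ (Subgroup.mem_top _) hσ (n + 2)
  apply hφ
  change φ • β = ((jac n (S.cyc φ) : ℤ) : 𝓞 L) * β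
  have hcyc : φ • S.ζ = S.ζ ^ p := by
    refine root_cong (k := n) hQ ?_ (hfrob S.ζ) ?_ (nat_not_mem hQ hp hpQ hn0 (by omega))
    · rw [← smul_pow', S.hζ.pow_eq_one, smul_one, ← pow_mul, mul_comm, pow_mul, S.hζ.pow_eq_one, one_pow]
    · rw [S.cyc_spec]
      intro h
      exact S.ζ_notMem hn0 hQ (hQ.mem_of_pow_mem _ h)
  have hc := S.cyc_eq hcyc
  have hj : jac n (S.cyc φ) = jacobiSym (-(n : ℤ)) p := by
    rw [recip hn4 ((Nat.odd_iff).1 (hp.odd_of_ne_two (by omega)))]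
    exact jac_eq (by rw [hc]; simp)
  have hβQ : β ∉ Q := by
    intro h
    have h2 : ((-(n : ℤ) : ℤ) : 𝓞 L) ∈ Q := by rw [← hβ2]; exact Ideal.pow_mem_of_mem _ h _ (by norm_num)
    refine nat_not_mem hQ hp hpQ hn0 (by omega) ?_
    have := Q.neg_mem h2
    simpa using this
  have hsq : (φ • β) ^ 2 = (((jac n (S.cyc φ) : ℤ) : 𝓞 L) * β) ^ 2 := by
    rw [← smul_pow', hβ2, hIntg, mul_pow, sq, hjj, one_mul, hβ2]
  refine root_cong (k := 2) hQ hsq ?_ ?_ (nat_not_mem hQ hp hpQ (by norm_num) (by omega))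
  · have h1 : β ^ p = ((((-(n : ℤ)) ^ (p / 2) : ℤ)) : 𝓞 L) * β := by
      have : p = 2 * (p / 2) + 1 := by
        have := hp.odd_of_ne_two (by omega); rw [Nat.odd_iff] at this; omega
      conv_lhs => rw [this, pow_add, pow_mul, hβ2, pow_one]
      rw [Int.cast_pow]
    haveI : Fact p.Prime := ⟨hp⟩
    have h2 : (p : ℤ) ∣ (-(n : ℤ)) ^ (p / 2) - jac n (S.cyc φ) := by
      rw [hj, ← jacobiSym.legendreSym.to_jacobiSym, ← ZMod.intCast_zmod_eq_zero_iff_dvd]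
      push_cast
      rw [legendreSym.eq_pow]; push_cast; ring
    have h3 : ((((-(n : ℤ)) ^ (p / 2) - jac n (S.cyc φ) : ℤ)) : 𝓞 L) ∈ Q := by
      have := map_dvd (Int.castRingHom (𝓞 L)) h2
      exact Q.mem_of_dvd this (by simpa using hpQ)
    have h4 := Q.add_mem (hfrob β) (Q.mul_mem_right β h3)
    rw [h1] at h4
    convert h4 using 1
    push_cast; ring
  · intro h
    have := Q.sub_mem h (hfrob β)
    rw [sub_sub_cancel] at this
    exact hβQ (hQ.mem_of_pow_mem _ this)

lemma exists_lift [IsGalois ℚ L] (τ₁ τ₀ : K →ₐ[ℚ] L) : ∃ h : L ≃ₐ[ℚ] L, h.toAlgHom.comp τ₁ = τ₀ := by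
  let χ : τ₁.fieldRange ≃ₐ[ℚ] τ₀.fieldRange :=
    (AlgEquiv.ofInjectiveField τ₁).symm.trans (AlgEquiv.ofInjectiveField τ₀)
  refine ⟨χ.liftNormal L, ?_⟩
  ext x
  have h1 := χ.liftNormal_commutes L (AlgEquiv.ofInjectiveField τ₁ x)
  have h2 : χ (AlgEquiv.ofInjectiveField τ₁ x) = AlgEquiv.ofInjectiveField τ₀ x := by
    change AlgEquiv.ofInjectiveField τ₀ ((AlgEquiv.ofInjectiveField τ₁).symm (AlgEquiv.ofInjectiveField τ₁ x)) = _
    rw [AlgEquiv.symm_apply_apply]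
  rw [h2] at h1
  exact h1

lemma Istar [NeZero n] [IsGalois ℚ L] (S : Setup a 2 n L) (ha : Nice a)
    {θ : 𝓞 K} {D : ℤ} (hD : SepD θ D) (hN : Algebra.norm ℤ a = -(n : ℤ)) (hn4 : n % 4 = 3)
    (hcD : IsCoprime (n : ℤ) D) (τ₀ : K →ₐ[ℚ] L) (u : (ZMod n)ˣ) (hu : jac n u = 1) :
    ∃ σ : L ≃ₐ[ℚ] L, (∀ τ : K →ₐ[ℚ] L, ∀ x : K, σ (τ x) = τ x) ∧ (∀ τ, σ • S.α τ = S.α τ) ∧ S.cyc σ = u := by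
  classical
  let H : Subgroup (L ≃ₐ[ℚ] L) :=
    { carrier := {σ | (∀ τ : K →ₐ[ℚ] L, ∀ x : K, σ (τ x) = τ x) ∧ (∀ τ, τ ≠ τ₀ → σ • S.α τ = S.α τ)}
      one_mem' := ⟨fun _ _ => rfl, fun _ _ => one_smul _ _⟩
      mul_mem' := by
        rintro σ ρ ⟨h1, h2⟩ ⟨k1, k2⟩
        refine ⟨fun τ x => ?_, fun τ hτ => ?_⟩
        · rw [AlgEquiv.mul_apply, k1, h1]
        · rw [mul_smul, k2 τ hτ, h2 τ hτ]
      inv_mem' := by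
        rintro σ ⟨h1, h2⟩
        refine ⟨fun τ x => ?_, fun τ hτ => ?_⟩
        · conv_lhs => rw [← h1 τ x]
          rw [← AlgEquiv.mul_apply, inv_mul_cancel]; rfl
        · rw [inv_smul_eq_iff, h2 τ hτ] }
  have htop : H.map S.cyc = ⊤ := by
    apply units_gen
    intro q k m hq hnq hc u hu
    have hqn : q ∣ n := (dvd_pow_self q (Nat.succ_ne_zero k)).trans ⟨m, hnq⟩
    have hqD : ¬ (q : ℤ) ∣ D := by
      intro h
      have := hcD.isUnit_of_dvd' (Int.natCast_dvd_natCast.2 hqn) h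
      exact (Nat.prime_iff_prime_int.1 hq).not_unit this
    have hql : ¬ q ∣ 2 := by
      intro h
      rw [(Nat.prime_dvd_prime_iff_eq hq Nat.prime_two).1 h] at hqn
      omega
    obtain ⟨Q, hQ, hqQ⟩ := exists_above (L := L) hq
    obtain ⟨σ, hσ, hσu⟩ := inert_cyc S hq hnq hc hQ hqQ u hu
    obtain ⟨τ₁, hτ₁⟩ := exists_tauq S ha (by rw [hN]; simp) hD hq hqD hqn hQ hqQ
    have hτ := inert_tau hD hq hqD hQ hqQ hσ
    have hα : ∀ τ, τ ≠ τ₁ → σ • S.α τ = S.α τ := by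
      intro τ hne
      refine inert_root hq hQ hqQ hσ hql ?_ ?_
      · intro h
        apply hτ₁ τ hne
        rw [← S.hα]
        exact Ideal.pow_mem_of_mem _ h _ (by norm_num)
      · rw [S.hα]; exact RingOfIntegers.ext (hτ τ a)
    have hω : σ • S.ω = S.ω := by
      refine inert_root hq hQ hqQ hσ hql ?_ ?_
      · intro h
        apply hQ.ne_top
        rw [Ideal.eq_top_iff_one, ← S.hω.pow_eq_one]
        exact Ideal.pow_mem_of_mem _ h _ (by norm_num)
      · rw [S.hω.pow_eq_one, smul_one]
    obtain ⟨h, hh⟩ := exists_lift τ₁ τ₀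
    refine ⟨h * σ * h⁻¹, fix_conj S ha.1 two_ne_zero hτ hω hα hh, ?_⟩
    rw [map_mul, map_mul, map_inv, hσu, mul_comm (S.cyc h), mul_inv_cancel_right]
  have hmem : u ∈ H.map S.cyc := by rw [htop]; exact Subgroup.mem_top _
  obtain ⟨σ, ⟨h1, h2⟩, hσu⟩ := hmem
  refine ⟨σ, h1, fun τ => ?_, hσu⟩
  by_cases hτ : τ = τ₀
  · subst hτ
    have hb := beta_char S ha.1 hN hn4 σ
    rw [hσu, hu, Int.cast_one, one_mul, ← Finset.mul_prod_erase _ _ (Finset.mem_univ τ), smul_mul'] at hb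
    have h3 : σ • (∏ x ∈ Finset.univ.erase τ, S.α x) = ∏ x ∈ Finset.univ.erase τ, S.α x := by
      rw [Finset.smul_prod']
      exact Finset.prod_congr rfl (fun x hx => h2 x (Finset.ne_of_mem_erase hx))
    rw [h3] at hb
    exact mul_right_cancel₀ (Finset.prod_ne_zero_iff.2 (fun x _ => S.α_ne ha.1 two_ne_zero x)) hb
  · exact h2 τ hτ

theorem NT2 [NeZero n] (ha : Nice a)
    {θ : 𝓞 K} {D : ℤ} (hD : SepD θ D) (hN : Algebra.norm ℤ a = -(n : ℤ)) (hn4 : n % 4 = 3)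
    (hcD : IsCoprime (n : ℤ) D) (u : (ZMod n)ˣ) (hu : jac n u = 1) (hns : ¬ ∃ s, u = s ^ 2) (B : ℕ) :
    ∃ r : ℕ, r.Prime ∧ B < r ∧ (∃ s : (ZMod n)ˣ, (r : ZMod n) = u * s ^ 2) ∧ ∃ z : 𝓞 K, (r : 𝓞 K) ∣ a - z ^ 2 := by
  obtain ⟨L, _, _, _, ⟨S⟩⟩ := exists_setup a two_ne_zero (NeZero.ne n)
  obtain ⟨τ₀⟩ : Nonempty (K →ₐ[ℚ] L) := by
    obtain ⟨τ, -⟩ := S.surj (Classical.choice (by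
      have h : 0 < Fintype.card (K →ₐ[ℚ] AlgebraicClosure ℚ) := by
        rw [AlgHom.card ℚ K (AlgebraicClosure ℚ)]; exact Module.finrank_pos
      exact Fintype.card_pos_iff.1 h))
    exact ⟨τ⟩
  obtain ⟨σ, h1, h2, h3⟩ := Istar S ha hD hN hn4 hcD τ₀ u hu
  let A' : Subgroup (ZMod n)ˣ := (powMonoidHom 2).range
  obtain ⟨p, hp, hB, ⟨v, hvA, hvA', hv⟩, hz⟩ := CL S h1 h2 A' (A' ⊔ Subgroup.zpowers u) le_sup_left
    (by rw [h3]; exact (le_sup_right : Subgroup.zpowers u ≤ A' ⊔ Subgroup.zpowers u) (Subgroup.mem_zpowers u))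
    (by rw [h3]; rintro ⟨s, hs⟩; exact hns ⟨s, hs.symm⟩) B
  refine ⟨p, hp, hB, ?_, hz⟩
  obtain ⟨x, ⟨s, rfl⟩, y, hy, hxy⟩ := Subgroup.mem_sup.1 hvA
  obtain ⟨k, rfl⟩ := Subgroup.mem_zpowers_iff.1 hy
  simp only [powMonoidHom_apply] at hxy
  rcases Int.even_or_odd' k with ⟨j, hj | hj⟩
  · exfalso
    apply hvA'
    refine ⟨s * u ^ j, ?_⟩
    rw [powMonoidHom_apply, mul_pow, ← zpow_natCast (u ^ j), ← zpow_mul, ← hxy, hj]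
    congr 2
    push_cast; ring
  · refine ⟨s * u ^ j, ?_⟩
    have : v = u * (s * u ^ j) ^ 2 := by
      rw [mul_pow, ← zpow_natCast (u ^ j), ← zpow_mul, ← hxy, hj, zpow_add, zpow_one, mul_comm 2 j]
      push_cast
      simp only [mul_assoc, mul_comm, mul_left_comm]
    rw [← hv, this]; simp

end N9
end Vas

open NumberField

namespace Vas
section F1
universe u
variable {K : Type u} [Field K] [NumberField K]

lemma norm_cong {M : ℕ} {x y : 𝓞 K} (h : (M : 𝓞 K) ∣ x - y) :
    (M : ℤ) ∣ Algebra.norm ℤ x - Algebra.norm ℤ y := by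
  obtain ⟨z, hz⟩ := h
  have hx : x = y + (M : 𝓞 K) * z := by linear_combination hz
  set b := Module.Free.chooseBasis ℤ (𝓞 K)
  rw [← ZMod.intCast_zmod_eq_zero_iff_dvd]
  rw [Int.cast_sub, sub_eq_zero, Algebra.norm_eq_matrix_det b, Algebra.norm_eq_matrix_det b]
  have := RingHom.map_det (Int.castRingHom (ZMod M)) (Algebra.leftMulMatrix b x)
  have h2 := RingHom.map_det (Int.castRingHom (ZMod M)) (Algebra.leftMulMatrix b y)
  simp only [eq_intCast] at this h2
  rw [this, h2]
  congr 1
  have h3 : x = y + M • z := by rw [hx, nsmul_eq_mul]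
  rw [h3, map_add, map_nsmul]
  ext i j
  rw [RingHom.mapMatrix_apply, RingHom.mapMatrix_apply, Matrix.map_apply, Matrix.map_apply, Matrix.add_apply,
    Matrix.smul_apply, map_add, map_nsmul, nsmul_eq_mul]
  simp

lemma bridge {a : 𝓞 K} (ha : Nice a) (x : ℤ) :
    a ∣ (x : 𝓞 K) ↔ (((Algebra.norm ℤ a).natAbs : ℕ) : ℤ) ∣ x := by
  obtain ⟨N, hN0, hN⟩ := exists_N ha.1
  suffices h : N = (Algebra.norm ℤ a).natAbs by rw [hN, h]
  have h1 : Nat.card (𝓞 K ⧸ Ideal.span {a}) = (Algebra.norm ℤ a).natAbs := by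
    rw [← Ideal.absNorm_span_singleton, Ideal.absNorm_apply]; rfl
  set φ : ℤ →+* 𝓞 K ⧸ Ideal.span {a} := (Ideal.Quotient.mk (Ideal.span {a})).comp (Int.castRingHom _)
  have hφ : Function.Surjective φ := by
    intro y
    obtain ⟨y, rfl⟩ := Ideal.Quotient.mk_surjective y
    obtain ⟨m, hm⟩ := ha.2 y
    refine ⟨m, ?_⟩
    have := mk_eq_zero'.2 hm
    rw [map_sub, sub_eq_zero] at this
    rw [this]; rfl
  have hker : RingHom.ker φ = Ideal.span {(N : ℤ)} := by
    ext z
    rw [RingHom.mem_ker, Ideal.mem_span_singleton, ← hN]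
    exact mk_eq_zero'
  have e1 := RingHom.quotientKerEquivOfSurjective hφ
  have e2 := Int.quotientSpanNatEquivZMod N
  rw [← h1, ← Nat.card_congr e1.toEquiv, Nat.card_congr (Ideal.quotEquivOfEq hker).toEquiv, Nat.card_congr e2.toEquiv, Nat.card_zmod]

lemma cop_mul {a t s : 𝓞 K} (h : IsCoprime a t) (h' : IsCoprime a s) : IsCoprime a (t * s) := h.mul_right h'

lemma cop_dvd {a c c' : 𝓞 K} (h : IsCoprime a c) (h' : a ∣ c' - c) : IsCoprime a c' := by
  obtain ⟨z, hz⟩ := h'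
  have : c' = c + a * z := by linear_combination hz
  rw [this]; exact h.add_mul_left_right z

lemma cop_dvd' {a a' c : 𝓞 K} (h : IsCoprime a c) (h' : c ∣ a' - a) : IsCoprime a' c :=
  (cop_dvd h.symm h').symm

lemma cop_one {a M : 𝓞 K} (h : M ∣ a - 1) : IsCoprime a M :=
  cop_dvd' isCoprime_one_left h

variable {M : 𝓞 K} {C : Type u} [CommGroup C] (S : Sym M C)

namespace Sym

lemma congL {a a' c : 𝓞 K} (h : M ∣ a - 1) (hc : IsCoprime a c) (h' : M * c ∣ a' - a) :
    S.f a' c = S.f a c := by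
  obtain ⟨t, ht⟩ := h'
  have : a' = a + t * M * c := by linear_combination ht
  rw [this]; exact S.add1 t h hc

lemma congR {a c c' : 𝓞 K} (h : M ∣ a - 1) (hc : IsCoprime a c) (h' : a ∣ c' - c) :
    S.f a c' = S.f a c := by
  obtain ⟨t, ht⟩ := h'
  have : c' = c + t * a := by linear_combination ht
  rw [this]; exact S.add2 t h hc

def B (a t : 𝓞 K) : C := S.f a (t ^ 2)

lemma B_mul {a t s : 𝓞 K} (h : M ∣ a - 1) (ht : IsCoprime a t) (hs : IsCoprime a s) :
    S.B a (t * s) = S.B a t * S.B a s := by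
  unfold B
  rw [mul_pow]; exact S.sq h ht.pow_right hs

lemma B_one {a : 𝓞 K} (h : M ∣ a - 1) : S.B a 1 = 1 := by
  unfold B; rw [one_pow]; exact S.one h

lemma B_neg {a t : 𝓞 K} : S.B a (-t) = S.B a t := by
  unfold B; rw [neg_sq]

lemma B_one_left {t : 𝓞 K} : S.B 1 t = 1 := by
  have := S.mulB (a := 1) (a' := 1) (t := t) (by simp) (by simp) isCoprime_one_left isCoprime_one_left
  rw [mul_one] at this
  exact left_eq_mul.1 this

lemma B_mulL {a a' t : 𝓞 K} (h : M ∣ a - 1) (h' : M ∣ a' - 1) (ht : IsCoprime a t) (ht' : IsCoprime a' t) :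
    S.B (a * a') t = S.B a t * S.B a' t := S.mulB h h' ht ht'

lemma B_pow {a t : 𝓞 K} (h : M ∣ a - 1) (ht : IsCoprime a t) (k : ℕ) : S.B (a ^ k) t = S.B a t ^ k := by
  induction k with
  | zero => rw [pow_zero, pow_zero, B_one_left]
  | succ k ih =>
    rw [pow_succ, pow_succ, S.B_mulL (h.trans (sub_one_dvd_pow_sub_one a k)) h ht.pow_left ht, ih]

lemma B_powR {a t : 𝓞 K} (h : M ∣ a - 1) (ht : IsCoprime a t) (k : ℕ) : S.B a (t ^ k) = S.B a t ^ k := by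
  induction k with
  | zero => rw [pow_zero, pow_zero, S.B_one h]
  | succ k ih =>
    rw [pow_succ, pow_succ, S.B_mul h ht.pow_right ht, ih]

lemma B_congL {a a' t : 𝓞 K} (h : M ∣ a - 1) (hc : IsCoprime a t) (h' : M * t ^ 2 ∣ a' - a) :
    S.B a' t = S.B a t := S.congL h hc.pow_right h'

lemma B_congR {a t t' : 𝓞 K} (h : M ∣ a - 1) (hc : IsCoprime a t) (h' : a ∣ t' - t) :
    S.B a t' = S.B a t := by
  refine S.congR h hc.pow_right ?_
  rw [show t' ^ 2 - t ^ 2 = (t' - t) * (t' + t) by ring]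
  exact h'.mul_right _

lemma B_pow_one {a t : 𝓞 K} (h : M ∣ a - 1) (ht : IsCoprime a t) {k : ℕ} (hk : M * t ^ 2 ∣ a ^ k - 1) :
    S.B a t ^ k = 1 := by
  rw [← S.B_pow h ht, S.B_congL (a := 1) (by simp) isCoprime_one_left hk, S.B_one_left]

end Sym

lemma dvd_of_sub {a b c : 𝓞 K} (h : M ∣ a - 1) (h' : M * c ∣ b - a) : M ∣ b - 1 := by
  have h2 : M ∣ b - a := (dvd_mul_right _ _).trans h'
  have := dvd_add h2 h
  rwa [sub_add_sub_cancel] at this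

theorem Sym.B_exp {M : ℕ} (S : Sym (M : 𝓞 K) C) (hM : M ≠ 0) (hreal : Nonempty (K →+* ℝ)) {a t : 𝓞 K}
    (h : (M : 𝓞 K) ∣ a - 1) (ht : IsCoprime a t) : S.B a t ^ (C0 (Module.finrank ℚ K)).toNat = 1 := by
  have hM' : (M : 𝓞 K) ≠ 0 := by exact_mod_cast hM
  by_cases ht0 : t = 0
  · rw [ht0] at ht ⊢
    have h1 : S.B a 0 = S.B a 1 := by
      apply S.B_congR h isCoprime_one_right
      exact (isCoprime_zero_right.1 ht).dvd
    rw [h1, S.B_one h, one_pow]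
  set k : 𝓞 K := (M : 𝓞 K) * t ^ 2 with hk
  have hk0 : k ≠ 0 := mul_ne_zero hM' (pow_ne_zero _ ht0)
  set l := lam k with hl
  have hl0 : l ≠ 0 := lam_ne_zero hk0
  have hak : IsCoprime a k := (cop_one h).mul_right ht.pow_right
  obtain ⟨a', hn, hca, -, hcl, hck⟩ := exists_nice hreal hak hk0 hl0
  have h' : (M : 𝓞 K) ∣ a' - 1 := dvd_of_sub h hca
  have ht' : IsCoprime a' t := cop_dvd' ht (((dvd_pow_self t two_ne_zero).mul_left _).trans hca)
  rw [← S.B_congL h ht hca]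
  have x1 : S.B a' t ^ l = 1 := S.B_pow_one h' ht' (lam_spec hck)
  have hbr := bridge hn
  set n := (Algebra.norm ℤ a').natAbs with hndef
  have hn0 : n ≠ 0 := by
    rw [hndef, Int.natAbs_ne_zero, Algebra.norm_ne_zero_iff]; exact hn.1
  have hln : IsCoprime (l : ℤ) (n : ℤ) := by
    apply N_coprime hbr hn.1
    rw [Int.cast_natCast]; exact hcl.symm
  obtain ⟨w, hw⟩ := hn.2 t
  have hw' : IsCoprime a' (w : 𝓞 K) := cop_dvd ht' (by rw [← dvd_neg, neg_sub]; exact hw)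
  have hwn : IsCoprime w (n : ℤ) := N_coprime hbr hn.1 hw'.symm
  obtain ⟨r, hrl, hr⟩ := exists_r (Module.finrank ℚ K) (Q := (l : ℤ)) (by positivity)
  obtain ⟨p, hp, hpB, hpl, hpn⟩ := dirichlet2 (Q := (l : ℤ)) (N := (n : ℤ)) (by exact_mod_cast hl0)
    (by exact_mod_cast hn0) hln hrl hwn (max l M)
  have hap : a' ∣ (p : 𝓞 K) - t := by
    have h1 : a' ∣ ((p - w : ℤ) : 𝓞 K) := (hbr _).2 hpn
    push_cast at h1
    rw [← dvd_neg] at hw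
    have := dvd_add h1 hw
    rwa [show (p : 𝓞 K) - w + -(t - w) = p - t by ring] at this
  have hcp : IsCoprime a' (p : 𝓞 K) := cop_dvd ht' hap
  obtain ⟨j, hj⟩ := upow hp hcp
  set e := (PI (Module.finrank ℚ K) p).toNat with he
  have h5 : ((M : 𝓞 K) * (p : 𝓞 K) ^ 2) ∣ a' ^ (e * p ^ (j+1)) - 1 := by
    apply IsCoprime.mul_dvd
    · apply IsCoprime.pow_right
      have : IsCoprime (M : ℤ) (p : ℤ) := by
        rw [Nat.isCoprime_iff_coprime]
        exact (Nat.coprime_of_lt_prime hM (lt_of_le_of_lt (le_max_right _ _) hpB) hp).symm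
      have := this.map (Int.castRingHom (𝓞 K))
      simpa using this
    · exact h'.trans (sub_one_dvd_pow_sub_one _ _)
    · have := dvd_sub_pow_of_dvd_sub hj 1
      rw [pow_one, one_pow, ← pow_mul] at this
      rw [pow_succ p j, ← mul_assoc]
      exact this
  have x2 : S.B a' t ^ (e * p ^ (j+1)) = 1 := by
    rw [← S.B_congR h' ht' hap]
    exact S.B_pow_one h' hcp h5
  have hPp : 0 < PI (Module.finrank ℚ K) p := PI_pos (by exact_mod_cast hp.two_le)
  have hC : 0 < C0 (Module.finrank ℚ K) := C0_pos _
  have hdv : Nat.gcd l (e * p ^ (j+1)) ∣ (C0 (Module.finrank ℚ K)).toNat := by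
    have hc : Nat.Coprime l (p ^ (j+1)) := by
      apply Nat.Coprime.pow_right
      exact (Nat.coprime_of_lt_prime hl0 (lt_of_le_of_lt (le_max_left _ _) hpB) hp).symm
    rw [Nat.Coprime.gcd_mul_right_cancel_right _ hc.symm]
    set g := Nat.gcd l e with hg
    have g1 : (g : ℤ) ∣ l := by exact_mod_cast Nat.gcd_dvd_left _ _
    have g2 : (g : ℤ) ∣ PI (Module.finrank ℚ K) p := by
      have : (g : ℤ) ∣ (e : ℤ) := by exact_mod_cast Nat.gcd_dvd_right _ _
      rwa [he, Int.toNat_of_nonneg hPp.le] at this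
    have g3 : (g : ℤ) ∣ PI (Module.finrank ℚ K) r := by
      have := dvd_sub g2 (PI_cong (d := Module.finrank ℚ K) (g1.trans hpl))
      rwa [sub_sub_cancel] at this
    have := hr g g1 1 (by rwa [pow_one])
    rw [pow_one] at this
    rw [← Int.natCast_dvd_natCast, Int.toNat_of_nonneg hC.le]
    exact this
  have := pow_of_gcd (⊥ : Subgroup C) hdv (Subgroup.mem_bot.2 x1) (Subgroup.mem_bot.2 x2)
  exact Subgroup.mem_bot.1 this

end F1
end Vas

open NumberField

namespace Vas
section F2
universe u
variable {K : Type u} [Field K] [NumberField K]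
variable {C : Type u} [CommGroup C] {M : ℕ}

/-- good representatives -/
structure Good (M : ℕ) (a : 𝓞 K) (n : ℕ) : Prop where
  nice : Nice a
  norm : Algebra.norm ℤ a = -(n : ℤ)
  cong : (M : 𝓞 K) ∣ a - 1
  ne : n ≠ 0

lemma exists_good (hreal : Nonempty (K →+* ℝ)) (hM : M ≠ 0) {a c : 𝓞 K} (h : (M : 𝓞 K) ∣ a - 1)
    (hc : IsCoprime a c) (hc0 : c ≠ 0) : ∃ a' n, Good M a' n ∧ (M : 𝓞 K) * c ∣ a' - a := by
  have hM' : (M : 𝓞 K) ≠ 0 := by exact_mod_cast hM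
  obtain ⟨a', hn, hca, hneg, -, -⟩ := exists_nice hreal ((cop_one h).mul_right hc) (mul_ne_zero hM' hc0) one_ne_zero
  refine ⟨a', (Algebra.norm ℤ a').natAbs, ⟨hn, ?_, dvd_of_sub h hca, ?_⟩, hca⟩
  · rw [Int.ofNat_natAbs_of_nonpos hneg.le, neg_neg]
  · rw [Int.natAbs_ne_zero]; exact hneg.ne

namespace Good
variable {a : 𝓞 K} {n : ℕ} (G : Good M a n)

lemma br (G : Good M a n) (x : ℤ) : a ∣ (x : 𝓞 K) ↔ (n : ℤ) ∣ x := by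
  rw [bridge G.nice, G.norm, Int.natAbs_neg, Int.natAbs_natCast]

lemma dvd1 (G : Good M a n) : (M : ℤ) ∣ n + 1 := by
  have := norm_cong G.cong
  rw [G.norm, map_one] at this
  rw [← dvd_neg]
  rwa [show -((n : ℤ) + 1) = -n - 1 by ring]

lemma mod4 (G : Good M a n) (h4 : 4 ∣ M) : n % 4 = 3 := by
  have h : (4 : ℤ) ∣ n + 1 := dvd_trans (by exact_mod_cast h4) G.dvd1
  omega

lemma copM (G : Good M a n) : IsCoprime (n : ℤ) (M : ℤ) := by
  obtain ⟨z, hz⟩ := G.dvd1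
  exact ⟨-1, z, by linear_combination -hz⟩

lemma copD (G : Good M a n) {D : ℤ} (hD : D ∣ M) : IsCoprime (n : ℤ) D := G.copM.of_isCoprime_of_dvd_right hD

lemma cop_int (G : Good M a n) {w : ℤ} (h : IsCoprime w n) : IsCoprime a (w : 𝓞 K) := by
  have h1 := h.map (Int.castRingHom (𝓞 K))
  simp only [eq_intCast] at h1
  exact (h1.of_isCoprime_of_dvd_right ((G.br n).2 dvd_rfl)).symm

lemma int_cop (G : Good M a n) {w : ℤ} (h : IsCoprime a (w : 𝓞 K)) : IsCoprime w n :=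
  N_coprime G.br G.nice.1 h.symm

lemma cop_unit (G : Good M a n) {u : (ZMod n)ˣ} {w : ℤ} (h : (u : ZMod n) = w) : IsCoprime a (w : 𝓞 K) := by
  apply G.cop_int
  have : IsUnit ((w : ℤ) : ZMod n) := by rw [← h]; exact u.isUnit
  exact ((ZMod.coe_int_isUnit_iff_isCoprime _ _).1 this).symm

lemma exists_unit (G : Good M a n) {w : ℤ} (h : IsCoprime a (w : 𝓞 K)) : ∃ u : (ZMod n)ˣ, (u : ZMod n) = w := by
  have := (ZMod.coe_int_isUnit_iff_isCoprime w n).2 (G.int_cop h).symm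
  exact ⟨this.unit, rfl⟩

lemma dvd_of_eq (G : Good M a n) {x y : ℤ} (h : (x : ZMod n) = y) : a ∣ (x : 𝓞 K) - (y : 𝓞 K) := by
  have := (ZMod.intCast_eq_intCast_iff_dvd_sub y x n).1 h.symm
  have := (G.br _).2 this
  push_cast at this
  exact this

lemma val_eq (G : Good M a n) (u : (ZMod n)ˣ) : (u : ZMod n) = (((u : ZMod n).val : ℤ) : ZMod n) := by
  haveI : NeZero n := ⟨G.ne⟩
  simp

noncomputable def β (G : Good M a n) (S : Sym (M : 𝓞 K) C) : (ZMod n)ˣ →* C :=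
  MonoidHom.mk' (fun u => S.B a (((u : ZMod n).val : ℤ) : 𝓞 K)) (by
    intro u v
    rw [← S.B_mul G.cong (G.cop_unit (G.val_eq u)) (G.cop_unit (G.val_eq v))]
    apply S.B_congR G.cong (cop_mul (G.cop_unit (G.val_eq u)) (G.cop_unit (G.val_eq v)))
    rw [← Int.cast_mul]
    apply G.dvd_of_eq
    rw [← G.val_eq, Int.cast_mul, ← G.val_eq, ← G.val_eq, Units.val_mul])

lemma β_eq (G : Good M a n) (S : Sym (M : 𝓞 K) C) {u : (ZMod n)ˣ} {w : ℤ} (h : (u : ZMod n) = w) :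
    S.B a (w : 𝓞 K) = G.β S u := by
  apply S.B_congR G.cong (G.cop_unit (G.val_eq u))
  apply G.dvd_of_eq
  rw [← G.val_eq, h]

end Good

lemma cop_nat_prime {p : ℕ} (hM : M ≠ 0) (hp : p.Prime) (h : M < p) : IsCoprime (M : 𝓞 K) (p : 𝓞 K) := by
  have : IsCoprime (M : ℤ) (p : ℤ) := by
    rw [Nat.isCoprime_iff_coprime]
    exact (Nat.coprime_of_lt_prime hM h hp).symm
  have := this.map (Int.castRingHom (𝓞 K))
  simpa using this

lemma lift_z {m p : 𝓞 K} (h : IsCoprime m p) (z : 𝓞 K) : ∃ z', m ∣ z' - 1 ∧ p ∣ z' - z := by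
  obtain ⟨x, y, hxy⟩ := h
  exact ⟨1 + (z - 1) * (x * m), ⟨(z-1)*x, by ring⟩, ⟨-(z-1)*y, by linear_combination (z-1) * hxy⟩⟩

lemma pow_root {x : C} {p l : ℕ} (h : x ^ p = 1) (hc : Nat.Coprime p l) : ∃ y, y ^ l = x := by
  obtain ⟨u, v, huv⟩ := (Nat.isCoprime_iff_coprime.2 hc)
  refine ⟨x ^ v, ?_⟩
  have h1 : x ^ (p : ℤ) = 1 := by rw [zpow_natCast, h]
  calc (x ^ v) ^ l = x ^ (v * l) := by rw [zpow_mul, zpow_natCast]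
    _ = x ^ (u * p + v * l) := by rw [zpow_add, mul_comm u, zpow_mul x p, h1, one_zpow, one_mul]
    _ = x := by rw [huv, zpow_one]

lemma primeB (S : Sym (M : 𝓞 K) C) (hM : M ≠ 0) {p l : ℕ} (hp : p.Prime) (hl : l.Prime) (hlp : l < p) (hMp : M < p)
    {a z : 𝓞 K} (h : (M : 𝓞 K) ∣ a - 1) (hap : IsCoprime a (p : 𝓞 K)) (hz : (p : 𝓞 K) ∣ a - z ^ l) :
    ∃ y, y ^ l = S.B a (p : 𝓞 K) := by
  have hcop := cop_nat_prime (K := K) hM hp hMp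
  obtain ⟨z', h1, h2⟩ := lift_z hcop z
  have hz' : (p : 𝓞 K) ∣ a - z' ^ l := by
    have := h2.trans (sub_dvd_pow_sub_pow z' z l)
    have := dvd_sub hz this
    rwa [sub_sub_sub_cancel_right] at this
  have hzc : IsCoprime z' (p : 𝓞 K) := by
    have : IsCoprime (z' ^ l) (p : 𝓞 K) := cop_dvd' hap (by rw [← dvd_neg, neg_sub]; exact hz')
    exact (IsCoprime.pow_left_iff hl.pos).1 this
  have hzM := cop_one h1
  obtain ⟨u, v, huv⟩ : IsCoprime (z' ^ l) ((M : 𝓞 K) * (p : 𝓞 K) ^ 2) := (hzM.mul_right hzc.pow_right).pow_left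
  have hzl : (M : 𝓞 K) ∣ z' ^ l - 1 := h1.trans (sub_one_dvd_pow_sub_one z' l)
  have hyM : (M : 𝓞 K) ∣ a * u - 1 := by
    have e : a * u - 1 = (a - 1) * u - (z' ^ l - 1) * u - v * (M * p ^ 2) := by linear_combination huv
    rw [e]
    exact dvd_sub (dvd_sub (h.mul_right _) (hzl.mul_right _)) ((dvd_mul_right _ _).mul_left _)
  have hyp : (p : 𝓞 K) ∣ a * u - 1 := by
    have e : a * u - 1 = (a - z' ^ l) * u - v * (M * p ^ 2) := by linear_combination huv
    rw [e]
    exact dvd_sub (hz'.mul_right _) (((dvd_pow_self _ two_ne_zero).mul_left _).mul_left _)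
  have e1 : S.B a (p : 𝓞 K) = S.B (z' ^ l * (a * u)) p := by
    symm
    apply S.B_congL h hap
    exact ⟨-v * a, by linear_combination a * huv⟩
  have hyc : IsCoprime (a * u) (p : 𝓞 K) := cop_one hyp
  rw [S.B_mulL hzl hyM hzc.pow_left hyc, S.B_pow h1 hzc] at e1
  have e2 : S.B (a * u) (p : 𝓞 K) ^ p = 1 := by
    apply S.B_pow_one hyM hyc
    apply IsCoprime.mul_dvd hcop.pow_right
    · exact hyM.trans (sub_one_dvd_pow_sub_one _ _)
    · have := dvd_sub_pow_of_dvd_sub hyp 1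
      rwa [pow_one, one_pow] at this
  obtain ⟨y, hy⟩ := pow_root e2 ((Nat.coprime_primes hp hl).2 hlp.ne')
  exact ⟨S.B z' p * y, by rw [mul_pow, hy, e1]⟩

variable {θ : 𝓞 K} {D : ℤ}

lemma stepII_good (S : Sym (M : 𝓞 K) C) (hM : M ≠ 0) (hreal : Nonempty (K →+* ℝ)) (h4 : 4 ∣ M)
    (hD : SepD θ D) (hDM : D ∣ M) {l : ℕ} (hl : l.Prime) (hlM : l ∣ M) {a : 𝓞 K} {n : ℕ} (G : Good M a n)
    (u : (ZMod n)ˣ) : ∃ y, y ^ l = G.β S u := by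
  haveI : NeZero n := ⟨G.ne⟩
  have hcD := G.copD hDM
  have key : ∀ (p : ℕ) (v : (ZMod n)ˣ) (z : 𝓞 K), p.Prime → max l M < p → (v : ZMod n) = p → (p : 𝓞 K) ∣ a - z ^ l →
      ∃ y, y ^ l = G.β S v := by
    intro p v z hp hlt hv hz
    have hv' : (v : ZMod n) = ((p : ℤ) : ZMod n) := by rw [hv]; simp
    have h2 := G.cop_unit hv'
    have h3 := G.β_eq S hv'
    rw [Int.cast_natCast] at h2 h3
    rw [← h3]
    exact primeB S hM hp hl ((le_max_left _ _).trans_lt hlt) ((le_max_right _ _).trans_lt hlt) G.cong h2 hz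
  by_cases hl2 : l = 2
  · subst hl2
    have h1 : ∀ u : (ZMod n)ˣ, jac n u = 1 → ∃ y, y ^ 2 = G.β S u := by
      intro u hu
      by_cases hs : ∃ s, u = s ^ 2
      · obtain ⟨s, rfl⟩ := hs
        exact ⟨G.β S s, (map_pow _ _ _).symm⟩
      · obtain ⟨r, hr, hrB, ⟨s, hs⟩, z, hz⟩ := NT2 G.nice hD G.norm (G.mod4 h4) hcD u hu hs (max 2 M)
        obtain ⟨y, hy⟩ := key r (u * s ^ 2) z hr hrB (by rw [hs]; simp) hz
        refine ⟨y * (G.β S s)⁻¹, ?_⟩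
        rw [mul_pow, hy, map_mul, map_pow, inv_pow, mul_inv_cancel_right]
    rcases mul_self_eq_one_iff.1 (jac_sq u) with h | h
    · exact h1 u h
    · have hm1 : jac n (-1) = -1 := by
        have e : ((-1 : (ZMod n)ˣ) : ZMod n) = ((-1 : ℤ) : ZMod n) := by simp
        rw [jac_eq e, jacobiSym.at_neg_one (by rw [Nat.odd_iff]; have := G.mod4 h4; omega),
          ZMod.χ₄_nat_three_mod_four (G.mod4 h4)]
      obtain ⟨y, hy⟩ := h1 (-1 * u) (by rw [map_mul, hm1, h]; norm_num)
      refine ⟨y, ?_⟩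
      have e : ((-1 : (ZMod n)ˣ) : ZMod n) = ((-1 : ℤ) : ZMod n) := by simp
      have := G.β_eq S e
      rw [Int.cast_neg, Int.cast_one, S.B_neg, S.B_one G.cong] at this
      rw [hy, map_mul, ← this, one_mul]
  · set P : Subgroup (ZMod n)ˣ := (powMonoidHom l : C →* C).range.comap (G.β S) with hPdef
    have hmem : ∀ v, v ∈ P ↔ ∃ y, y ^ l = G.β S v := fun v => Iff.rfl
    by_contra hcon
    have hP : P ≠ ⊤ := by
      intro h
      exact hcon ((hmem u).1 (h ▸ Subgroup.mem_top u))
    have hcl : Nat.Coprime n l := by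
      rw [← Nat.isCoprime_iff_coprime]
      exact G.copD (by exact_mod_cast hlM)
    obtain ⟨p, hp, hpB, ⟨v, hv, hvp⟩, z, hz⟩ := NT_odd hreal G.nice hD hl hl2
      (by rw [G.norm, Int.natAbs_neg, Int.natAbs_natCast]) hcD hcl P hP
      (fun u => (hmem _).2 ⟨G.β S u, (map_pow _ _ _).symm⟩) (max l M)
    exact hv ((hmem v).2 (key p v z hp hpB hvp hz))

lemma stepII (S : Sym (M : 𝓞 K) C) (hM : M ≠ 0) (hreal : Nonempty (K →+* ℝ)) (h4 : 4 ∣ M)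
    (hD : SepD θ D) (hDM : D ∣ M) {l : ℕ} (hl : l.Prime) (hlM : l ∣ M) {a t : 𝓞 K} (h : (M : 𝓞 K) ∣ a - 1)
    (ht : IsCoprime a t) : ∃ y, y ^ l = S.B a t := by
  by_cases ht0 : t = 0
  · rw [ht0] at ht ⊢
    have h1 : S.B a 0 = S.B a 1 := by
      apply S.B_congR h isCoprime_one_right
      exact (isCoprime_zero_right.1 ht).dvd
    rw [h1, S.B_one h]
    exact ⟨1, one_pow _⟩
  obtain ⟨a', n, G, hca⟩ := exists_good hreal hM h ht.pow_right (pow_ne_zero 2 ht0)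
  have ht' : IsCoprime a' t := cop_dvd' ht (((dvd_pow_self t two_ne_zero).mul_left _).trans hca)
  rw [← S.B_congL h ht hca]
  obtain ⟨w, hw⟩ := G.nice.2 t
  have hw' : a' ∣ (w : 𝓞 K) - t := by rw [← dvd_neg, neg_sub]; exact hw
  obtain ⟨u, hu⟩ := G.exists_unit (cop_dvd ht' hw')
  rw [← S.B_congR G.cong ht' hw', G.β_eq S hu]
  exact stepII_good S hM hreal h4 hD hDM hl hlM G u

def C2 (S : Sym (M : 𝓞 K) C) : Subgroup C :=
  Subgroup.closure {x | ∃ a t : 𝓞 K, (M : 𝓞 K) ∣ a - 1 ∧ IsCoprime a t ∧ x = S.B a t}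

lemma lemJ (S : Sym (M : 𝓞 K) C) (hM : M ≠ 0) (h4 : 4 ∣ M)
    (hD : SepD θ D) (hDM : D ∣ M) {a : 𝓞 K} {n : ℕ} (G : Good M a n) {w : ℤ} (hw : IsCoprime a (w : 𝓞 K))
    (hJ : jacobiSym w n = 1) : S.f a w ∈ C2 S := by
  haveI : NeZero n := ⟨G.ne⟩
  have hB : ∀ {a t : 𝓞 K}, (M : 𝓞 K) ∣ a - 1 → IsCoprime a t → S.B a t ∈ C2 S := fun h1 h2 =>
    Subgroup.subset_closure ⟨_, _, h1, h2, rfl⟩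
  obtain ⟨u, hu⟩ := G.exists_unit hw
  rw [← jac_eq hu] at hJ
  by_cases hs : ∃ s, u = s ^ 2
  · obtain ⟨s, rfl⟩ := hs
    have hsc := G.cop_unit (G.val_eq s)
    have : S.f a w = S.B a (((s : ZMod n).val : ℤ) : 𝓞 K) := by
      apply S.congR G.cong hsc.pow_right
      rw [← Int.cast_pow]
      apply G.dvd_of_eq
      rw [← hu, Int.cast_pow, ← G.val_eq, Units.val_pow_eq_pow_val]
    rw [this]
    exact hB G.cong hsc
  · obtain ⟨r, hr, hrB, ⟨s, hs⟩, z, hz⟩ := NT2 G.nice hD G.norm (G.mod4 h4) (G.copD hDM) u hJ hs M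
    have hsc := G.cop_unit (G.val_eq s)
    have hcop := cop_nat_prime (K := K) hM hr hrB
    have hdv : a ∣ (r : 𝓞 K) - (w : 𝓞 K) * (((s : ZMod n).val : ℤ) : 𝓞 K) ^ 2 := by
      rw [← Int.cast_pow, ← Int.cast_mul, ← Int.cast_natCast r]
      apply G.dvd_of_eq
      rw [Int.cast_natCast, hs, hu, Int.cast_mul, Int.cast_pow, ← G.val_eq]
    have hrc : IsCoprime a (r : 𝓞 K) := cop_dvd (cop_mul hw hsc.pow_right) hdv
    have e1 : S.f a r = S.f a w * S.B a (((s : ZMod n).val : ℤ) : 𝓞 K) := by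
      rw [S.congR G.cong (cop_mul hw hsc.pow_right) hdv, S.sq G.cong hw hsc]; rfl
    obtain ⟨z', h1, h2⟩ := lift_z hcop z
    have hz' : (r : 𝓞 K) ∣ a - z' ^ 2 := by
      have := h2.trans (sub_dvd_pow_sub_pow z' z 2)
      have := dvd_sub hz this
      rwa [sub_sub_sub_cancel_right] at this
    set a' := z' ^ 2 - r * (M : 𝓞 K) ^ 2 with ha'
    have ha'1 : (M : 𝓞 K) ∣ a' - 1 := by
      have e : a' - 1 = (z' - 1) * (z' + 1) - M * (r * M) := by rw [ha']; ring
      rw [e]; exact dvd_sub (h1.mul_right _) (dvd_mul_right _ _)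
    have hdd : (M : 𝓞 K) * r ∣ a' - a := by
      apply IsCoprime.mul_dvd hcop
      · have := dvd_sub ha'1 G.cong
        rwa [sub_sub_sub_cancel_right] at this
      · have e : a' - a = -(a - z' ^ 2) - r * M ^ 2 := by rw [ha']; ring
        rw [e]; exact dvd_sub ((dvd_neg).2 hz') (dvd_mul_right _ _)
    have hrc' : IsCoprime a' (r : 𝓞 K) := cop_dvd' hrc ((dvd_mul_left _ _).trans hdd)
    obtain ⟨x, y, hxy⟩ := (cop_one ha'1).symm
    have htr : a' ∣ (z' * x) ^ 2 - r := by
      refine ⟨x ^ 2 - r * y * (1 + x * M), ?_⟩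
      have e : z' ^ 2 = a' + r * (M : 𝓞 K) ^ 2 := by rw [ha']; ring
      linear_combination x ^ 2 * e + r * (1 + x * M) * hxy
    have htc : IsCoprime a' (z' * x) := (IsCoprime.pow_right_iff two_pos).1 (cop_dvd hrc' htr)
    have e2 : S.f a r = S.B a' (z' * x) := by
      rw [← S.congL G.cong hrc hdd]
      exact (S.congR ha'1 hrc' htr).symm
    have : S.f a w = S.B a' (z' * x) * (S.B a (((s : ZMod n).val : ℤ) : 𝓞 K))⁻¹ := by
      rw [← e2, e1, mul_inv_cancel_right]
    rw [this]
    exact mul_mem (hB ha'1 htc) (inv_mem (hB G.cong hsc))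

lemma stepI (S : Sym (M : 𝓞 K) C) (hM : M ≠ 0) (hreal : Nonempty (K →+* ℝ)) (h4 : 4 ∣ M)
    (hD : SepD θ D) (hDM : D ∣ M) (x : C) : x ∈ C2 S := by
  obtain ⟨a₀, c, h, hc, hc0, rfl⟩ := S.surj x
  obtain ⟨a, n, G, hca⟩ := exists_good hreal hM h hc hc0
  have hc' : IsCoprime a c := cop_dvd' hc ((dvd_mul_left _ _).trans hca)
  rw [← S.congL h hc hca]
  obtain ⟨w, hw⟩ := G.nice.2 c
  have hw' : a ∣ (w : 𝓞 K) - c := by rw [← dvd_neg, neg_sub]; exact hw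
  have hwc := cop_dvd hc' hw'
  have hn4 : IsCoprime (4 : ℤ) (n : ℤ) := (G.copD (by exact_mod_cast h4)).symm
  obtain ⟨r, hr, hrB, hr4, hrn⟩ := dirichlet2 (Q := 4) (N := (n : ℤ)) (by norm_num) (by exact_mod_cast G.ne)
    hn4 (x := 1) (y := w) isCoprime_one_left (G.int_cop hwc) M
  have hr41 : r % 4 = 1 := by omega
  have hrw : a ∣ (r : 𝓞 K) - w := by
    have := (G.br _).2 hrn
    push_cast at this; exact this
  have hrc : IsCoprime a (r : 𝓞 K) := cop_dvd hwc hrw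
  have e1 : S.f a c = S.f a r := by rw [S.congR G.cong hwc hrw, S.congR G.cong hc' hw']
  rw [e1]
  have hcop := cop_nat_prime (K := K) hM hr hrB
  have hodd : ∀ {n : ℕ}, n % 4 = 3 → Odd n := fun h => by rw [Nat.odd_iff]; omega
  have hrc2 : IsCoprime (r : ℤ) n := G.int_cop (by rw [Int.cast_natCast]; exact hrc)
  have hJ : jacobiSym (r : ℤ) n * jacobiSym (r : ℤ) n = 1 := by
    rw [← sq]; exact jacobiSym.sq_one (Int.isCoprime_iff_gcd_eq_one.1 hrc2)
  rcases mul_self_eq_one_iff.1 hJ with h1 | h1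
  · have := lemJ S hM h4 hD hDM G (w := (r : ℤ)) (by rw [Int.cast_natCast]; exact hrc) h1
    rwa [Int.cast_natCast] at this
  · obtain ⟨d, v, hdv⟩ : IsCoprime a ((M : 𝓞 K) * r) := (cop_one G.cong).mul_right hrc
    have hd1 : (M : 𝓞 K) ∣ d - 1 := by
      have e : d - 1 = -(a - 1) * d - v * (M * r) := by linear_combination hdv
      rw [e]; exact dvd_sub ((dvd_neg.2 G.cong).mul_right _) ((dvd_mul_right _ _).mul_left _)
    have hdc : IsCoprime d (r : 𝓞 K) := ⟨a, v * M, by linear_combination hdv⟩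
    have hr0 : (r : 𝓞 K) ≠ 0 := by exact_mod_cast hr.ne_zero
    obtain ⟨d', n', G', hd'⟩ := exists_good hreal hM hd1 hdc hr0
    have had : (M : 𝓞 K) * r ∣ a * d' - 1 := by
      have e : a * d' - 1 = a * (d' - d) - v * (M * r) := by linear_combination hdv
      rw [e]; exact dvd_sub (hd'.mul_left _) (dvd_mul_left _ _)
    have hinv := S.inv G.cong hrc had
    have hrc' : IsCoprime d' (r : 𝓞 K) := cop_dvd' hdc ((dvd_mul_left _ _).trans hd')
    have hnn : (r : ℤ) ∣ n * n' - 1 := by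
      have := norm_cong (x := a * d') (y := 1) ((dvd_mul_left _ _).trans had)
      rw [map_mul, G.norm, G'.norm, map_one, neg_mul_neg] at this
      exact this
    have j1 : jacobiSym (n : ℤ) r * jacobiSym (n' : ℤ) r = 1 := by
      rw [← jacobiSym.mul_left, ← jacobiSym.one_left r]
      apply jacobiSym.mod_left'
      exact (Int.modEq_iff_dvd.2 hnn).symm
    have j2 : jacobiSym (r : ℤ) n = jacobiSym (n : ℤ) r :=
      jacobiSym.quadratic_reciprocity_one_mod_four hr41 (hodd (G.mod4 h4))
    have j3 : jacobiSym (r : ℤ) n' = jacobiSym (n' : ℤ) r :=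
      jacobiSym.quadratic_reciprocity_one_mod_four hr41 (hodd (G'.mod4 h4))
    have j4 : jacobiSym (-(r : ℤ)) n' = 1 := by
      rw [jacobiSym.neg _ (hodd (G'.mod4 h4)), ZMod.χ₄_nat_three_mod_four (G'.mod4 h4), j3]
      rw [← j2, h1] at j1
      exact j1
    have := lemJ S hM h4 hD hDM G' (w := -(r : ℤ)) (by rw [Int.cast_neg, Int.cast_natCast]; exact hrc'.neg_right) j4
    rw [Int.cast_neg, Int.cast_natCast] at this
    rw [mul_eq_one_iff_eq_inv.1 hinv]
    exact inv_mem this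

theorem triv (S : Sym (M : 𝓞 K) C) (hM : M ≠ 0) (hreal : Nonempty (K →+* ℝ)) (h4 : 4 ∣ M)
    (hD : SepD θ D) (hDM : D ∣ M) (hCM : (C0 (Module.finrank ℚ K)).toNat ∣ M) (x : C) : x = 1 := by
  set c := (C0 (Module.finrank ℚ K)).toNat with hc
  have hexp : ∀ x : C, x ^ c = 1 := by
    intro x
    have hx := stepI S hM hreal h4 hD hDM x
    have hle : C2 S ≤ (powMonoidHom c : C →* C).ker := by
      rw [C2, Subgroup.closure_le]
      rintro y ⟨a, t, h1, h2, rfl⟩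
      exact S.B_exp hM hreal h1 h2
    exact hle hx
  have hdiv : ∀ l : ℕ, l.Prime → l ∣ M → ∀ x : C, ∃ y, y ^ l = x := by
    intro l hl hlM x
    have hx := stepI S hM hreal h4 hD hDM x
    have hle : C2 S ≤ (powMonoidHom l : C →* C).range := by
      rw [C2, Subgroup.closure_le]
      rintro y ⟨a, t, h1, h2, rfl⟩
      exact stepII S hM hreal h4 hD hDM hl hlM h1 h2
    exact hle hx
  have hall : ∀ k : ℕ, k ∣ M → ∀ x : C, ∃ y, y ^ k = x := by
    intro k
    induction k using induction_on_primes with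
    | zero => intro h; exact absurd (zero_dvd_iff.1 h) hM
    | one => intro _ x; exact ⟨x, pow_one x⟩
    | prime_mul p k hp ih =>
      intro h x
      obtain ⟨y, rfl⟩ := hdiv p hp ((dvd_mul_right _ _).trans h) x
      obtain ⟨z, rfl⟩ := ih ((dvd_mul_left _ _).trans h) y
      exact ⟨z, by rw [mul_comm, pow_mul]⟩
  obtain ⟨y, rfl⟩ := hall c hCM x
  exact hexp y

end F2
end Vas

open NumberField

namespace Vas
section F3
universe u
variable {K : Type u} [Field K] [NumberField K]

lemma exists_M (hdeg : 1 < Module.finrank ℚ K) (hreal : Nonempty (K →+* ℝ)) {m : Ideal (𝓞 K)} (hm : m ≠ 0) :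
    ∃ M : ℕ, M ≠ 0 ∧ (M : 𝓞 K) ∈ m ∧ GG (M : 𝓞 K) ≤ EE 1 (M : 𝓞 K) := by
  obtain ⟨x, hx, hx0⟩ := Submodule.exists_mem_ne_zero_of_ne_bot hm
  obtain ⟨n, hn0, hxn⟩ := exists_int_mul hx0
  obtain ⟨θ, D, hD⟩ := sepD (K := K)
  have hSD : SepD θ D := hD
  set c := (C0 (Module.finrank ℚ K)).toNat with hc
  have hc0 : c ≠ 0 := by have := C0_pos (Module.finrank ℚ K); omega
  have hD0 : D.natAbs ≠ 0 := Int.natAbs_ne_zero.2 hD.1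
  set M := n * (4 * (D.natAbs * c)) with hMdef
  have hM0 : M ≠ 0 := by positivity
  have hM0' : (M : 𝓞 K) ≠ 0 := by exact_mod_cast hM0
  have h4 : 4 ∣ M := (dvd_mul_right 4 _).mul_left _
  have hcM : c ∣ M := ((dvd_mul_left _ _).mul_left _).mul_left _
  have hDM : D ∣ M := by
    rw [← Int.natAbs_dvd]
    exact_mod_cast ((dvd_mul_right D.natAbs c).mul_left 4).mul_left n
  have hMu : ¬ IsUnit (M : 𝓞 K) := by
    intro h
    have h2 : IsUnit ((4 : ℕ) : 𝓞 K) := isUnit_of_dvd_unit (by exact_mod_cast Nat.cast_dvd_cast h4) h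
    have h3 := h2.map (Algebra.norm ℤ)
    have : Algebra.norm ℤ ((4 : ℕ) : 𝓞 K) = 4 ^ Module.finrank ℤ (𝓞 K) := by
      have := Algebra.norm_algebraMap (S := 𝓞 K) (4 : ℤ)
      simpa using this
    rw [this, Int.isUnit_iff_abs_eq, abs_pow] at h3
    have h5 : Module.finrank ℤ (𝓞 K) ≠ 0 := by rw [RingOfIntegers.rank]; omega
    have := one_lt_pow₀ (a := |(4:ℤ)|) (by norm_num) h5
    omega
  obtain ⟨C, _, S, hS⟩ := exists_sym hreal hdeg hM0' hMu
  refine ⟨M, hM0, ?_, hS fun x => triv S hM0 hreal h4 hSD hDM hcM x⟩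
  rw [hMdef, Nat.cast_mul]
  exact m.mul_mem_right _ (m.mem_of_dvd hxn hx)

abbrev SO (K : Type*) [Field K] := Matrix.SpecialLinearGroup (Fin 2) (𝓞 K)

/-- upper and lower unipotents over the integers -/
def uo (x : 𝓞 K) : SO K := ⟨!![1, x; 0, 1], by simp [Matrix.det_fin_two_of]⟩
def lo (x : 𝓞 K) : SO K := ⟨!![1, 0; x, 1], by simp [Matrix.det_fin_two_of]⟩

lemma uo00 (x : 𝓞 K) : ((uo x : SO K)).1 0 0 = 1 := by simp [uo]
lemma uo01 (x : 𝓞 K) : ((uo x : SO K)).1 0 1 = x := by simp [uo]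
lemma uo10 (x : 𝓞 K) : ((uo x : SO K)).1 1 0 = 0 := by simp [uo]
lemma uo11 (x : 𝓞 K) : ((uo x : SO K)).1 1 1 = 1 := by simp [uo]
lemma lo00 (x : 𝓞 K) : ((lo x : SO K)).1 0 0 = 1 := by simp [lo]
lemma lo01 (x : 𝓞 K) : ((lo x : SO K)).1 0 1 = 0 := by simp [lo]
lemma lo10 (x : 𝓞 K) : ((lo x : SO K)).1 1 0 = x := by simp [lo]
lemma lo11 (x : 𝓞 K) : ((lo x : SO K)).1 1 1 = 1 := by simp [lo]

lemma so_mul (g h : SO K) : (g * h).1 = g.1 * h.1 := rfl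
lemma so00 (g h : SO K) : (g * h).1 0 0 = g.1 0 0 * h.1 0 0 + g.1 0 1 * h.1 1 0 := by
  rw [so_mul, Matrix.mul_apply, Fin.sum_univ_two]
lemma so01 (g h : SO K) : (g * h).1 0 1 = g.1 0 0 * h.1 0 1 + g.1 0 1 * h.1 1 1 := by
  rw [so_mul, Matrix.mul_apply, Fin.sum_univ_two]
lemma so10 (g h : SO K) : (g * h).1 1 0 = g.1 1 0 * h.1 0 0 + g.1 1 1 * h.1 1 0 := by
  rw [so_mul, Matrix.mul_apply, Fin.sum_univ_two]
lemma so11 (g h : SO K) : (g * h).1 1 1 = g.1 1 0 * h.1 0 1 + g.1 1 1 * h.1 1 1 := by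
  rw [so_mul, Matrix.mul_apply, Fin.sum_univ_two]

/-- the group in question as a subgroup -/
def SG (m : Ideal (𝓞 K)) : Subgroup (SO K) where
  carrier := {γ | γ.1 0 0 - 1 ∈ m ∧ γ.1 1 0 ∈ m ∧ γ.1 1 1 - 1 ∈ m}
  mul_mem' := by
    rintro g h ⟨a1, a2, a3⟩ ⟨b1, b2, b3⟩
    refine ⟨?_, ?_, ?_⟩
    · rw [so00, show g.1 0 0 * h.1 0 0 + g.1 0 1 * h.1 1 0 - 1 =
        (g.1 0 0 - 1) * h.1 0 0 + (h.1 0 0 - 1) + g.1 0 1 * h.1 1 0 by ring]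
      exact add_mem (add_mem (m.mul_mem_right _ a1) b1) (m.mul_mem_left _ b2)
    · rw [so10]
      exact add_mem (m.mul_mem_right _ a2) (m.mul_mem_left _ b2)
    · rw [so11, show g.1 1 0 * h.1 0 1 + g.1 1 1 * h.1 1 1 - 1 =
        g.1 1 0 * h.1 0 1 + (g.1 1 1 - 1) * h.1 1 1 + (h.1 1 1 - 1) by ring]
      exact add_mem (add_mem (m.mul_mem_right _ a2) (m.mul_mem_right _ a3)) b3
  one_mem' := by
    refine ⟨?_, ?_, ?_⟩ <;> simp
  inv_mem' := by
    rintro g ⟨a1, a2, a3⟩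
    have e : (g⁻¹).1 = !![g.1 1 1, -g.1 0 1; -g.1 1 0, g.1 0 0] := by
      rw [Matrix.SpecialLinearGroup.SL2_inv_expl]; rfl
    refine ⟨?_, ?_, ?_⟩
    · rw [e]; simpa using a3
    · rw [e]; simpa using a2
    · rw [e]; simpa using a1

def gens (m : Ideal (𝓞 K)) : Set (SO K) :=
  {γ | γ.1 0 0 = 1 ∧ γ.1 1 0 = 0 ∧ γ.1 1 1 = 1} ∪
    {γ | γ.1 0 0 = 1 ∧ γ.1 0 1 = 0 ∧ γ.1 1 1 = 1 ∧ γ.1 1 0 ∈ m}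

lemma uo_mem (m : Ideal (𝓞 K)) (x : 𝓞 K) : uo x ∈ Subgroup.closure (gens m) :=
  Subgroup.subset_closure (Or.inl ⟨by simp [uo], by simp [uo], by simp [uo]⟩)

lemma lo_mem {m : Ideal (𝓞 K)} {x : 𝓞 K} (h : x ∈ m) : lo x ∈ Subgroup.closure (gens m) :=
  Subgroup.subset_closure (Or.inr ⟨by simp [lo], by simp [lo], by simp [lo], by simpa [lo] using h⟩)

noncomputable def toK : SO K →* SL K := Matrix.SpecialLinearGroup.map (algebraMap (𝓞 K) K)

lemma toK_apply (g : SO K) (i j : Fin 2) : (toK g).1 i j = ((g.1 i j : 𝓞 K) : K) := rfl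

lemma toK_inj : Function.Injective (toK (K := K)) := by
  intro g h hgh
  apply Subtype.ext
  ext i j
  have := toK_apply g i j
  rw [hgh, toK_apply] at this
  exact_mod_cast this.symm

lemma toK_uo (x : 𝓞 K) : toK (uo x) = UU (x : K) := by
  apply ext4 <;> rw [toK_apply] <;> simp [uo]

lemma toK_lo (x : 𝓞 K) : toK (lo x) = LL (x : K) := by
  apply ext4 <;> rw [toK_apply] <;> simp [lo]

lemma approxI {m : Ideal (𝓞 K)} {ν : 𝓞 K} (hν : ν ≠ 0) {γ : SO K} (hγ : γ ∈ SG m) :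
    ∃ e ∈ Subgroup.closure (gens m), toK (e * γ) ∈ GG ν := by
  obtain ⟨hma, hmc, hmd⟩ := hγ
  have hdet : γ.1 0 0 * γ.1 1 1 - γ.1 0 1 * γ.1 1 0 = 1 := by
    have := γ.2
    rwa [Matrix.det_fin_two] at this
  set a := γ.1 0 0 with ha
  set b := γ.1 0 1 with hb
  set c := γ.1 1 0 with hc
  set d := γ.1 1 1 with hd
  obtain ⟨t, ht⟩ := exists_coprime (a := a) (c := c) (n := ν) ⟨d, -b, by linear_combination hdet⟩ hν
  obtain ⟨x, y, hxy⟩ := ht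
  set a' := a + t * c with ha'
  have hma' : a' - 1 ∈ m := by
    have : a' - 1 = (a - 1) + t * c := by rw [ha']; ring
    rw [this]; exact add_mem hma (m.mul_mem_left _ hmc)
  set s := (1 - a' - c) * x with hs
  have hms : s ∈ m := by
    rw [hs]; apply m.mul_mem_right
    have : 1 - a' - c = -(a' - 1) - c := by ring
    rw [this]; exact sub_mem (neg_mem hma') hmc
  set e₀ : SO K := lo (a' - 1) * (uo 1 * (lo s * uo t)) with he0
  refine ⟨e₀, mul_mem (lo_mem hma') (mul_mem (uo_mem m _) (mul_mem (lo_mem hms) (uo_mem m _))), ?_⟩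
  have r1 : c + s * a' - (1 - a') = -(1 - a' - c) * y * ν := by
    rw [hs]; linear_combination (1 - a' - c) * hxy
  have e1 : (e₀ * γ).1 0 0 - 1 = -(1 - a' - c) * y * ν := by
    have : (e₀ * γ).1 0 0 = a' + (c + s * a') := by
      simp only [he0, so00, so01, so10, so11, uo00, uo01, uo10, uo11, lo00, lo01, lo10, lo11]
      rw [← ha, ← hc, ha']; ring
    rw [this]; linear_combination r1
  have e2 : (e₀ * γ).1 1 0 = (-(1 - a' - c) * y + (a' - 1) * (-(1 - a' - c) * y)) * ν := by
    have : (e₀ * γ).1 1 0 = (c + s * a') + (a' - 1) * (a' + (c + s * a')) := by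
      simp only [he0, so00, so01, so10, so11, uo00, uo01, uo10, uo11, lo00, lo01, lo10, lo11]
      rw [← ha, ← hc, ha']; ring
    rw [this]; linear_combination (1 + (a' - 1)) * r1
  have hdet2 : (e₀ * γ).1 0 0 * (e₀ * γ).1 1 1 - (e₀ * γ).1 0 1 * (e₀ * γ).1 1 0 = 1 := by
    have := (e₀ * γ).2
    rwa [Matrix.det_fin_two] at this
  set g := e₀ * γ with hg
  have n1 : ν ∣ g.1 0 0 - 1 := ⟨-(1 - a' - c) * y, by rw [e1]; ring⟩
  have n2 : ν ∣ g.1 1 0 := ⟨_, by rw [e2, mul_comm]⟩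
  have n3 : ν ∣ g.1 1 1 - 1 := by
    have : g.1 1 1 - 1 = g.1 0 1 * g.1 1 0 - (g.1 0 0 - 1) * g.1 1 1 := by linear_combination hdet2
    rw [this]; exact dvd_sub (dvd_mul_of_dvd_right n2 _) (dvd_mul_of_dvd_left n1 _)
  refine ⟨?_, ?_, ?_, ?_⟩
  · rw [toK_apply, show ((g.1 0 0 : 𝓞 K) : K) - 1 = ((g.1 0 0 - 1 : 𝓞 K) : K) by simp]
    exact inI_coe_iff.2 n1
  · rw [toK_apply]; exact inI_coe _
  · rw [toK_apply]; exact inI_coe_iff.2 n2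
  · rw [toK_apply, show ((g.1 1 1 : 𝓞 K) : K) - 1 = ((g.1 1 1 - 1 : 𝓞 K) : K) by simp]
    exact inI_coe_iff.2 n3

theorem main (hdeg : 1 < Module.finrank ℚ K) (hreal : Nonempty (K →+* ℝ)) (m : Ideal (𝓞 K)) (hm : m ≠ 0) :
    SG m = Subgroup.closure (gens m) := by
  apply le_antisymm
  · intro γ hγ
    obtain ⟨M, hM0, hMm, hGE⟩ := exists_M hdeg hreal hm
    obtain ⟨e, he, heg⟩ := approxI (ν := (M : 𝓞 K)) (by exact_mod_cast hM0) hγ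
    have hle : EE 1 (M : 𝓞 K) ≤ (Subgroup.closure (gens m)).map (toK (K := K)) := by
      apply EE_le
      · rintro x ⟨y, rfl⟩
        refine ⟨uo y, uo_mem m y, ?_⟩
        rw [toK_uo]; simp
      · rintro x ⟨y, rfl⟩
        refine ⟨lo (M * y), lo_mem (m.mul_mem_right _ hMm), ?_⟩
        rw [toK_lo]; simp
    obtain ⟨g, hg, hgg⟩ := hle (hGE heg)
    have := toK_inj hgg
    rw [this] at hg
    exact (Subgroup.mul_mem_cancel_left _ he).1 hg
  · rw [Subgroup.closure_le]
    rintro γ (⟨h1, h2, h3⟩ | ⟨h1, h2, h3, h4⟩)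
    · refine ⟨?_, ?_, ?_⟩
      · rw [h1, sub_self]; exact zero_mem _
      · rw [h2]; exact zero_mem _
      · rw [h3, sub_self]; exact zero_mem _
    · refine ⟨?_, h4, ?_⟩
      · rw [h1, sub_self]; exact zero_mem _
      · rw [h3, sub_self]; exact zero_mem _

end F3
end Vas

/-- **Vaserstein-type generation of `SΓ₁(𝔪)`.**
For a number field `K` of degree `> 1` with at least one real embedding and a nonzero ideal
`𝔪` of `O_K`, the group `SΓ₁(𝔪) = {γ ∈ SL₂(O_K) : γ ≡ (1,*;0,1) mod 𝔪}` equals the subgroup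
generated by the upper unitriangular matrices `(1,b;0,1)`, `b ∈ O_K`, and the lower
unitriangular matrices `(1,0;c,1)`, `c ∈ 𝔪`. -/
theorem stmt_6 (K : Type*) [Field K] [NumberField K]
    (hdeg : 1 < Module.finrank ℚ K) (hreal : Nonempty (K →+* ℝ))
    (m : Ideal (𝓞 K)) (hm : m ≠ 0) :
    {γ : Matrix.SpecialLinearGroup (Fin 2) (𝓞 K) |
        γ.1 0 0 - 1 ∈ m ∧ γ.1 1 0 ∈ m ∧ γ.1 1 1 - 1 ∈ m} =
      (Subgroup.closure
        ({γ : Matrix.SpecialLinearGroup (Fin 2) (𝓞 K) |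
            γ.1 0 0 = 1 ∧ γ.1 1 0 = 0 ∧ γ.1 1 1 = 1} ∪
         {γ : Matrix.SpecialLinearGroup (Fin 2) (𝓞 K) |
            γ.1 0 0 = 1 ∧ γ.1 0 1 = 0 ∧ γ.1 1 1 = 1 ∧ γ.1 1 0 ∈ m}) : Set _) := by
  exact congrArg (SetLike.coe : Subgroup (Matrix.SpecialLinearGroup (Fin 2) (𝓞 K)) → Set _)
    (Vas.main hdeg hreal m hm)
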